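/- Let D ⊂ ℂ^d be a bounded strongly pseudoconvex domain with smooth boundary and let n ≥ 2d. Then every continuous map f₀ : cl(D) → ℂⁿ that is holomorphic in D can be approximated, uniformly on every compact subset of D, by proper holomorphic immersions f : D → ℂⁿ, i.e., proper holomorphic maps f whose complex derivative Df(z) : ℂ^d → ℂⁿ is injective for every z ∈ D. -/

import Mathlib

open Set Metric Complex Bornology

noncomputable section

/-- The Levi form of a C² function `ρ` at `x` in direction `v`:
`L_ρ(x;v) = (1/4)(D²ρ(x)[v,v] + D²ρ(x)[iv,iv])`. -/
def leviForm {E : Type*} [NormedAddCommGroup E] [NormedSpace ℂ E]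
    (ρ : E → ℝ) (x v : E) : ℝ :=
  (1 / 4) * (iteratedFDeriv ℝ 2 ρ x ![v, v] +
    iteratedFDeriv ℝ 2 ρ x ![Complex.I • v, Complex.I • v])

/-- The Levi form of `ρ` at `x` has at least `r` positive eigenvalues: there is an
`r`-dimensional complex subspace on which it is positive on nonzero vectors. -/
def LeviPosEigenAtLeast {E : Type*} [NormedAddCommGroup E] [NormedSpace ℂ E]
    (ρ : E → ℝ) (x : E) (r : ℕ) : Prop :=
  ∃ V : Submodule ℂ E, Module.finrank ℂ V = r ∧ ∀ v ∈ V, v ≠ 0 → 0 < leviForm ρ x v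

/-- A bounded strongly pseudoconvex domain in `ℂ^d` with boundary of class `C^ℓ`. -/
def IsSPCDomain {d : ℕ} (D : Set (EuclideanSpace ℂ (Fin d))) (ℓ : ℕ∞) : Prop :=
  IsOpen D ∧ IsConnected D ∧ IsBounded D ∧
  ∃ (U : Set (EuclideanSpace ℂ (Fin d))) (rD : EuclideanSpace ℂ (Fin d) → ℝ),
    IsOpen U ∧ frontier D ⊆ U ∧ ContDiffOn ℝ ℓ rD U ∧
    D ∩ U = {x ∈ U | rD x < 0} ∧
    (∀ x ∈ frontier D, fderiv ℝ rD x ≠ 0) ∧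
    (∀ x ∈ frontier D, ∀ v : EuclideanSpace ℂ (Fin d), v ≠ 0 →
      fderiv ℝ rD x v = 0 → fderiv ℝ rD x (Complex.I • v) = 0 → 0 < leviForm rD x v)

namespace SCV

open MeasureTheory Filter Topology
open scoped ContDiff ENNReal NNReal Convolution

/-- The space `ℂ^d` with its Euclidean norm. -/
abbrev Cn (d : ℕ) := EuclideanSpace ℂ (Fin d)

section Mollifier

variable {d : ℕ}

/-- A radial smooth bump supported in the closed ball of radius `δ`. -/
def bump (δ : ℝ) (x : Cn d) : ℝ := expNegInvGlue (1 - ‖δ⁻¹ • x‖ ^ 2)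

lemma bump_nonneg (δ : ℝ) (x : Cn d) : 0 ≤ bump δ x := expNegInvGlue.nonneg _

lemma bump_contDiff (δ : ℝ) : ContDiff ℝ ∞ (bump δ : Cn d → ℝ) := by
  have h : ContDiff ℝ ∞ (fun x : Cn d => 1 - ‖δ⁻¹ • x‖ ^ 2) :=
    contDiff_const.sub ((contDiff_const_smul δ⁻¹).norm_sq ℝ)
  exact expNegInvGlue.contDiff.comp h

lemma bump_eq_zero {δ : ℝ} (hδ : 0 < δ) {x : Cn d} (hx : δ ≤ ‖x‖) : bump δ x = 0 := by
  apply expNegInvGlue.zero_of_nonpos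
  have h1 : 1 ≤ ‖δ⁻¹ • x‖ := by
    rw [norm_smul, norm_inv, Real.norm_eq_abs, abs_of_pos hδ]
    rwa [← div_eq_inv_mul, one_le_div hδ]
  nlinarith

lemma bump_tsupport {δ : ℝ} (hδ : 0 < δ) : tsupport (bump δ : Cn d → ℝ) ⊆ closedBall 0 δ := by
  apply closure_minimal _ isClosed_closedBall
  intro x hx
  by_contra h
  rw [mem_closedBall_zero_iff, not_le] at h
  exact hx (bump_eq_zero hδ h.le)

lemma bump_hasCompactSupport {δ : ℝ} (hδ : 0 < δ) :
    HasCompactSupport (bump δ : Cn d → ℝ) :=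
  (isCompact_closedBall _ _).of_isClosed_subset (isClosed_tsupport _) (bump_tsupport hδ)

lemma integral_bump_pos {δ : ℝ} (hδ : 0 < δ) : 0 < ∫ x : Cn d, bump δ x := by
  apply (bump_contDiff δ).continuous.integral_pos_of_hasCompactSupport_nonneg_nonzero
    (bump_hasCompactSupport hδ) (bump_nonneg δ) (x := 0)
  simp only [bump, smul_zero, norm_zero]
  exact (expNegInvGlue.pos_of_pos (by norm_num)).ne'

/-- The radial mollifier of radius `δ`. -/
def mol (δ : ℝ) (x : Cn d) : ℝ := bump δ x / ∫ y : Cn d, bump δ y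

lemma mol_nonneg {δ : ℝ} (hδ : 0 < δ) (x : Cn d) : 0 ≤ mol δ x :=
  div_nonneg (bump_nonneg _ _) (integral_bump_pos hδ).le

lemma mol_contDiff (δ : ℝ) : ContDiff ℝ ∞ (mol δ : Cn d → ℝ) :=
  (bump_contDiff δ).div_const _

lemma mol_eq_zero {δ : ℝ} (hδ : 0 < δ) {x : Cn d} (hx : δ ≤ ‖x‖) : mol δ x = 0 := by
  rw [mol, bump_eq_zero hδ hx, zero_div]

lemma mol_tsupport {δ : ℝ} (hδ : 0 < δ) : tsupport (mol δ : Cn d → ℝ) ⊆ closedBall 0 δ := by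
  apply closure_minimal _ isClosed_closedBall
  intro x hx
  by_contra h
  rw [mem_closedBall_zero_iff, not_le] at h
  exact hx (mol_eq_zero hδ h.le)

lemma mol_hasCompactSupport {δ : ℝ} (hδ : 0 < δ) : HasCompactSupport (mol δ : Cn d → ℝ) :=
  (isCompact_closedBall _ _).of_isClosed_subset (isClosed_tsupport _) (mol_tsupport hδ)

lemma integral_mol {δ : ℝ} (hδ : 0 < δ) : ∫ x : Cn d, mol δ x = 1 := by
  simp only [mol]
  rw [integral_div, div_self (integral_bump_pos hδ).ne']

lemma mol_integrable {δ : ℝ} (hδ : 0 < δ) : Integrable (mol δ : Cn d → ℝ) :=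
  (mol_contDiff δ).continuous.integrable_of_hasCompactSupport (mol_hasCompactSupport hδ)

lemma mol_eq_of_norm_eq (δ : ℝ) {x y : Cn d} (h : ‖x‖ = ‖y‖) : mol δ x = mol δ y := by
  simp only [mol, bump, norm_smul, h]

/-- Multiplication by a unimodular number preserves the volume of `ℂ^d`. -/
lemma measurePreserving_smul_unit {c : ℂ} (hc : ‖c‖ = 1) :
    MeasurePreserving (fun x : Cn d => c • x) volume volume := by
  have hc0 : c ≠ 0 := by intro h; simp [h] at hc
  let L : Cn d ≃ₗᵢ[ℝ] Cn d :=
    { toLinearEquiv := (LinearEquiv.smulOfNeZero ℂ (Cn d) c hc0).restrictScalars ℝ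
      norm_map' := by
        intro x
        change ‖c • x‖ = ‖x‖
        rw [norm_smul, hc, one_mul] }
  exact L.measurePreserving

/-- Mean value property of holomorphic functions with respect to a radial mollifier. -/
lemma mol_meanValue {f : Cn d → ℂ} {U : Set (Cn d)} (hU : IsOpen U) (hf : DifferentiableOn ℂ f U)
    {δ : ℝ} (hδ : 0 < δ) {x : Cn d} (hx : closedBall x δ ⊆ U) :
    ∫ t, mol δ t • f (x - t) = f x := by
  set H : ℝ × Cn d → ℂ := fun p => mol δ p.2 • f (x - circleMap 0 1 p.1 • p.2) with hH
  have hunit : ∀ θ : ℝ, ‖circleMap 0 1 θ‖ = 1 := fun θ => by simp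
  have hcont : Continuous H := by
    rw [continuous_iff_continuousAt]
    rintro ⟨θ, t⟩
    by_cases ht : ‖t‖ ≤ δ
    · have hm : x - circleMap 0 1 θ • t ∈ U := hx (by simpa [norm_smul] using ht)
      have hfc : ContinuousAt f (x - circleMap 0 1 θ • t) :=
        (hf.differentiableAt (hU.mem_nhds hm)).continuousAt
      have h1 : ContinuousAt (fun p : ℝ × Cn d => x - circleMap 0 1 p.1 • p.2) (θ, t) := by
        have := continuous_circleMap 0 1
        fun_prop
      have h2 : ContinuousAt (fun p : ℝ × Cn d => mol δ p.2) (θ, t) :=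
        ((mol_contDiff δ).continuous.comp continuous_snd).continuousAt
      exact h2.smul (ContinuousAt.comp (f := fun p : ℝ × Cn d => x - circleMap 0 1 p.1 • p.2) hfc h1)
    · push Not at ht
      have : H =ᶠ[𝓝 (θ, t)] fun _ => 0 := by
        have : ∀ᶠ p : ℝ × Cn d in 𝓝 (θ, t), δ < ‖p.2‖ :=
          (continuous_snd.norm.continuousAt (x := (θ, t))).eventually (lt_mem_nhds ht)
        filter_upwards [this] with p hp
        simp only [hH]
        rw [mol_eq_zero hδ hp.le, zero_smul]
      exact this.continuousAt
  have hInt : Integrable H ((volume.restrict (uIoc (0:ℝ) (2 * Real.pi))).prod volume) := by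
    have h1 : IntegrableOn H (Icc 0 (2 * Real.pi) ×ˢ closedBall 0 δ) (volume.prod volume) :=
      hcont.continuousOn.integrableOn_compact (isCompact_Icc.prod (isCompact_closedBall _ _))
    have h2 : IntegrableOn H (uIoc (0:ℝ) (2 * Real.pi) ×ˢ univ) (volume.prod volume) := by
      have h3 : IntegrableOn H (uIoc (0:ℝ) (2 * Real.pi) ×ˢ closedBall 0 δ) (volume.prod volume) :=
        h1.mono_set (prod_mono_left (by
          rw [uIoc_of_le (by positivity)]; exact Ioc_subset_Icc_self))
      refine h3.of_forall_sdiff_eq_zero (measurableSet_uIoc.prod MeasurableSet.univ) ?_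
      rintro ⟨θ, t⟩ ⟨h5, h6⟩
      have : δ < ‖t‖ := by
        by_contra h
        exact h6 ⟨h5.1, by simpa using h⟩
      simp only [hH]
      rw [mol_eq_zero hδ this.le, zero_smul]
    rwa [IntegrableOn, ← Measure.prod_restrict, Measure.restrict_univ] at h2
  have hrot : ∀ θ : ℝ, ∫ t, mol δ t • f (x - t) = ∫ t, H (θ, t) := by
    intro θ
    have hmp := measurePreserving_smul_unit (d := d) (hunit θ)
    have hc0 : circleMap 0 1 θ ≠ 0 := by intro h; simpa [h] using hunit θ
    have hemb : MeasurableEmbedding (fun x : Cn d => circleMap 0 1 θ • x) :=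
      (Homeomorph.smulOfNeZero _ hc0).measurableEmbedding
    rw [← hmp.integral_comp hemb]
    apply integral_congr_ae
    filter_upwards with t
    simp only [hH]
    rw [mol_eq_of_norm_eq δ (y := t) (by rw [norm_smul, hunit, one_mul])]
  have key : ∫ θ in (0:ℝ)..(2 * Real.pi), ∫ t, H (θ, t)
      = ∫ t, ∫ θ in (0:ℝ)..(2 * Real.pi), H (θ, t) := by
    exact intervalIntegral_integral_swap (f := fun θ t => H (θ, t)) hInt
  have hin : ∀ t, ∫ θ in (0:ℝ)..(2 * Real.pi), H (θ, t) = mol δ t • ((2 * Real.pi) • f x) := by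
    intro t
    simp only [hH]
    rw [intervalIntegral.integral_smul]
    by_cases ht : ‖t‖ < δ
    · congr 1
      have hg : DifferentiableOn ℂ (fun w : ℂ => f (x - w • t)) (closedBall 0 1) := by
        intro w hw
        have hm : x - w • t ∈ U := hx (by
          rw [mem_closedBall_zero_iff] at hw
          rw [mem_closedBall, dist_eq_norm]
          simp only [sub_sub_cancel_left, norm_neg, norm_smul]
          nlinarith [norm_nonneg t])
        have h1 : DifferentiableAt ℂ f (x - w • t) := hf.differentiableAt (hU.mem_nhds hm)
        have h2 : DifferentiableAt ℂ (fun w : ℂ => x - w • t) w := by fun_prop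
        exact (DifferentiableAt.comp w h1 h2).differentiableWithinAt
      have := (DifferentiableOn.diffContOnCl_ball (c := 0) (R := |1|) hg
        (by rw [abs_one])).circleAverage
      rw [Real.circleAverage] at this
      simp only [zero_smul, sub_zero] at this
      rw [← this, smul_smul, mul_inv_cancel₀ (by positivity), one_smul]
    · push Not at ht
      rw [mol_eq_zero hδ ht, zero_smul, zero_smul]
  simp_rw [hin, ← hrot] at key
  rw [intervalIntegral.integral_const, sub_zero, integral_smul_const, integral_mol hδ,
    one_smul] at key
  exact smul_right_injective ℂ (r := (2 * Real.pi : ℝ)) (by positivity) key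

end Mollifier

section Holomorphic

variable {d : ℕ}

/-- Holomorphic functions of several variables are smooth. -/
lemma contDiffAt_of_holomorphic {f : Cn d → ℂ} {U : Set (Cn d)} (hU : IsOpen U)
    (hf : DifferentiableOn ℂ f U) {a : Cn d} (ha : a ∈ U) : ContDiffAt ℝ ∞ f a := by
  obtain ⟨r, hr, hrU⟩ := Metric.isOpen_iff.1 hU a ha
  set g : Cn d → ℂ := (closedBall a (r / 2)).indicator f with hg
  have hsub : closedBall a (r / 2) ⊆ U := (closedBall_subset_ball (by linarith)).trans hrU
  have hgi : LocallyIntegrable g volume := by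
    apply Integrable.locallyIntegrable
    rw [hg, integrable_indicator_iff measurableSet_closedBall]
    exact (hf.continuousOn.mono hsub).integrableOn_compact (isCompact_closedBall _ _)
  have hr4 : 0 < r / 4 := by linarith
  have hsm : ContDiff ℝ ∞ (mol (r / 4) ⋆[ContinuousLinearMap.lsmul ℝ ℝ, volume] g) :=
    (mol_hasCompactSupport hr4).contDiff_convolution_left _ (mol_contDiff _) hgi
  refine hsm.contDiffAt.congr_of_eventuallyEq ?_
  filter_upwards [ball_mem_nhds a hr4] with x hx
  rw [convolution_def]
  have h1 : closedBall x (r / 4) ⊆ closedBall a (r / 2) := by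
    apply closedBall_subset_closedBall'
    rw [mem_ball] at hx
    linarith
  rw [← mol_meanValue hU hf hr4 (h1.trans hsub)]
  apply integral_congr_ae
  filter_upwards with t
  simp only [ContinuousLinearMap.lsmul_apply]
  by_cases ht : ‖t‖ < r / 4
  · rw [hg, indicator_of_mem (h1 (by simpa using ht.le))]
  · push Not at ht
    rw [mol_eq_zero hr4 ht, zero_smul, zero_smul]

lemma contDiffOn_of_holomorphic {f : Cn d → ℂ} {U : Set (Cn d)} (hU : IsOpen U)
    (hf : DifferentiableOn ℂ f U) : ContDiffOn ℝ ∞ f U :=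
  fun _ ha => (contDiffAt_of_holomorphic hU hf ha).contDiffWithinAt

/-- Cauchy estimate for the derivative. -/
lemma norm_fderiv_le_of_holomorphic {f : Cn d → ℂ} {a : Cn d} {R M : ℝ} (hR : 0 < R)
    (hf : DifferentiableOn ℂ f (ball a R)) (hM : ∀ z ∈ ball a R, ‖f z‖ ≤ M) :
    ‖fderiv ℂ f a‖ ≤ 2 * M / R := by
  have hM0 : 0 ≤ M := (norm_nonneg _).trans (hM a (mem_ball_self hR))
  apply ContinuousLinearMap.opNorm_le_bound _ (by positivity)
  intro v
  by_cases hv : v = 0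
  · simp [hv]
  have hvn : 0 < ‖v‖ := norm_pos_iff.2 hv
  set ρ := R / (2 * ‖v‖) with hρ
  have hρ0 : 0 < ρ := by positivity
  have hmem : ∀ w : ℂ, ‖w‖ ≤ ρ → a + w • v ∈ ball a R := by
    intro w hw
    rw [mem_ball, dist_eq_norm, add_sub_cancel_left, norm_smul]
    calc ‖w‖ * ‖v‖ ≤ ρ * ‖v‖ := by gcongr
      _ = R / 2 := by rw [hρ]; field_simp
      _ < R := by linarith
  have hdiff : ∀ w : ℂ, ‖w‖ ≤ ρ → HasDerivAt (fun w : ℂ => f (a + w • v))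
      (fderiv ℂ f (a + w • v) v) w := by
    intro w hw
    have h1 : HasFDerivAt f (fderiv ℂ f (a + w • v)) (a + w • v) :=
      (hf.differentiableAt (isOpen_ball.mem_nhds (hmem w hw))).hasFDerivAt
    have h2 : HasDerivAt (fun w : ℂ => a + w • v) v w := by
      simpa using ((hasDerivAt_id w).smul_const v).const_add a
    exact h1.comp_hasDerivAt w h2
  have hcl : DiffContOnCl ℂ (fun w : ℂ => f (a + w • v)) (ball 0 ρ) := by
    apply DifferentiableOn.diffContOnCl_ball (U := closedBall 0 ρ) _ subset_rfl
    intro w hw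
    exact (hdiff w (by simpa using hw)).differentiableAt.differentiableWithinAt
  have hb := Complex.norm_deriv_le_of_forall_mem_sphere_norm_le hρ0 hcl
    (C := M) (fun w hw => hM _ (hmem w (by simpa using (mem_sphere_zero_iff_norm.1 hw).le)))
  rw [(hdiff 0 (by simpa using hρ0.le)).deriv, zero_smul, add_zero] at hb
  calc _ ≤ M / ρ := hb
    _ = 2 * M / R * ‖v‖ := by rw [hρ]; field_simp

/-- Locally uniform limits of holomorphic functions are holomorphic. -/
lemma differentiableOn_of_tendstoLocallyUniformlyOn {F : ℕ → Cn d → ℂ} {f : Cn d → ℂ}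
    {U : Set (Cn d)} (hU : IsOpen U) (hF : ∀ n, DifferentiableOn ℂ (F n) U)
    (h : TendstoLocallyUniformlyOn F f atTop U) : DifferentiableOn ℂ f U := by
  have hcont : ContinuousOn f U := h.continuousOn (Frequently.of_forall fun n => (hF n).continuousOn)
  intro a ha
  obtain ⟨r, hr, hrU⟩ := Metric.isOpen_iff.1 hU a ha
  have hsub : closedBall a (r / 2) ⊆ U := (closedBall_subset_ball (by linarith)).trans hrU
  have hu : TendstoUniformlyOn F f atTop (closedBall a (r / 2)) :=
    (tendstoLocallyUniformlyOn_iff_forall_isCompact hU).1 h _ hsub (isCompact_closedBall _ _)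
  have hder : UniformCauchySeqOn (fun n => fderiv ℂ (F n)) atTop (ball a (r / 4)) := by
    rw [Metric.uniformCauchySeqOn_iff]
    intro ε hε
    have hc := Metric.uniformCauchySeqOn_iff.1 hu.uniformCauchySeqOn (ε * (r / 4) / 4)
      (by positivity)
    obtain ⟨N, hN⟩ := hc
    refine ⟨N, fun m hm n hn x hx => ?_⟩
    have hbx : ball x (r / 4) ⊆ closedBall a (r / 2) := by
      apply (ball_subset_ball' _).trans ball_subset_closedBall
      rw [mem_ball] at hx
      linarith
    have hxU : U ∈ 𝓝 x := hU.mem_nhds (hsub (hbx (mem_ball_self (by positivity))))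
    have h1 := norm_fderiv_le_of_holomorphic (f := fun z => F m z - F n z) (a := x) (R := r / 4)
      (M := ε * (r / 4) / 4) (by positivity)
      (((hF m).sub (hF n)).mono (hbx.trans hsub)) (fun z hz => by
        have := hN m hm n hn z (hbx hz)
        rw [dist_eq_norm] at this
        exact this.le)
    rw [fderiv_fun_sub ((hF m).differentiableAt hxU) ((hF n).differentiableAt hxU)] at h1
    rw [dist_eq_norm]
    calc _ ≤ _ := h1
      _ = ε / 2 := by field_simp; norm_num
      _ < ε := by linarith
  have hball : ball a (r / 4) ⊆ closedBall a (r / 2) :=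
    (ball_subset_ball (by linarith)).trans ball_subset_closedBall
  have hpt : ∀ x ∈ ball a (r / 4), ∃ L, Tendsto (fun n => fderiv ℂ (F n) x) atTop (𝓝 L) := by
    intro x hx
    exact cauchySeq_tendsto_of_complete (hder.cauchySeq hx)
  choose! L hL using hpt
  have hlu : TendstoUniformlyOn (fun n => fderiv ℂ (F n)) L atTop (ball a (r / 4)) :=
    hder.tendstoUniformlyOn_of_tendsto hL
  have := hasFDerivAt_of_tendstoUniformlyOn (f := F) (g := f) isOpen_ball hlu
    (fun n x hx => ((hF n).differentiableAt (hU.mem_nhds (hsub (hball hx)))).hasFDerivAt)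
    (fun x hx => hu.tendsto_at (hball hx)) (x := a) (mem_ball_self (by positivity))
  exact this.differentiableAt.differentiableWithinAt

end Holomorphic

end SCV

namespace SCV

open MeasureTheory Filter Topology
open scoped ContDiff ENNReal NNReal Convolution ComplexConjugate

lemma two_le_infty : (2 : WithTop ℕ∞) ≤ ((⊤ : ℕ∞) : WithTop ℕ∞) := by
  exact WithTop.coe_le_coe.2 (le_top : (2 : ℕ∞) ≤ ⊤)

section Wirtinger

variable {d : ℕ}

/-- The `j`-th standard basis vector of `ℂ^d`. -/
def ee (j : Fin d) : Cn d := EuclideanSpace.single j 1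

/-- The Wirtinger derivative `∂/∂z_j`. -/
def del (j : Fin d) (h : Cn d → ℂ) (x : Cn d) : ℂ :=
  (1 / 2) * (fderiv ℝ h x (ee j) - I * fderiv ℝ h x (I • ee j))

/-- The Wirtinger derivative `∂/∂\bar z_j`. -/
def dbar (j : Fin d) (h : Cn d → ℂ) (x : Cn d) : ℂ :=
  (1 / 2) * (fderiv ℝ h x (ee j) + I * fderiv ℝ h x (I • ee j))

lemma contDiff_del {h : Cn d → ℂ} (hh : ContDiff ℝ ∞ h) (j : Fin d) :
    ContDiff ℝ ∞ (del j h) := by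
  have h1 : ContDiff ℝ ∞ (fderiv ℝ h) := hh.fderiv_right (by simp)
  exact contDiff_const.mul ((h1.clm_apply contDiff_const).sub
    (contDiff_const.mul (h1.clm_apply contDiff_const)))

lemma contDiff_dbar {h : Cn d → ℂ} (hh : ContDiff ℝ ∞ h) (j : Fin d) :
    ContDiff ℝ ∞ (dbar j h) := by
  have h1 : ContDiff ℝ ∞ (fderiv ℝ h) := hh.fderiv_right (by simp)
  exact contDiff_const.mul ((h1.clm_apply contDiff_const).add
    (contDiff_const.mul (h1.clm_apply contDiff_const)))

lemma tsupport_del_subset (h : Cn d → ℂ) (j : Fin d) : tsupport (del j h) ⊆ tsupport h := by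
  refine closure_minimal (fun x hx => ?_) (isClosed_tsupport _)
  by_contra hc
  apply hx
  have : fderiv ℝ h x = 0 := by
    by_contra h2
    exact hc (support_fderiv_subset ℝ h2)
  simp [del, this]

lemma tsupport_dbar_subset (h : Cn d → ℂ) (j : Fin d) : tsupport (dbar j h) ⊆ tsupport h := by
  refine closure_minimal (fun x hx => ?_) (isClosed_tsupport _)
  by_contra hc
  apply hx
  have : fderiv ℝ h x = 0 := by
    by_contra h2
    exact hc (support_fderiv_subset ℝ h2)
  simp [dbar, this]

lemma hasCompactSupport_del {h : Cn d → ℂ} (hh : HasCompactSupport h) (j : Fin d) :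
    HasCompactSupport (del j h) :=
  hh.of_isClosed_subset (isClosed_tsupport _) (tsupport_del_subset h j)

lemma hasCompactSupport_dbar {h : Cn d → ℂ} (hh : HasCompactSupport h) (j : Fin d) :
    HasCompactSupport (dbar j h) :=
  hh.of_isClosed_subset (isClosed_tsupport _) (tsupport_dbar_subset h j)

lemma del_mul {f g : Cn d → ℂ} {x : Cn d} (hf : DifferentiableAt ℝ f x)
    (hg : DifferentiableAt ℝ g x) (j : Fin d) :
    del j (fun y => f y * g y) x = del j f x * g x + f x * del j g x := by
  simp only [del, fderiv_fun_mul hf hg, add_apply,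
    smul_apply, smul_eq_mul]
  ring

lemma dbar_mul {f g : Cn d → ℂ} {x : Cn d} (hf : DifferentiableAt ℝ f x)
    (hg : DifferentiableAt ℝ g x) (j : Fin d) :
    dbar j (fun y => f y * g y) x = dbar j f x * g x + f x * dbar j g x := by
  simp only [dbar, fderiv_fun_mul hf hg, add_apply,
    smul_apply, smul_eq_mul]
  ring

lemma dbar_sub {f g : Cn d → ℂ} {x : Cn d} (hf : DifferentiableAt ℝ f x)
    (hg : DifferentiableAt ℝ g x) (j : Fin d) :
    dbar j (fun y => f y - g y) x = dbar j f x - dbar j g x := by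
  simp only [dbar, fderiv_fun_sub hf hg, sub_apply]
  ring

lemma fderiv_conj {f : Cn d → ℂ} {x : Cn d} (hf : DifferentiableAt ℝ f x) (v : Cn d) :
    fderiv ℝ (fun y => conj (f y)) x v = conj (fderiv ℝ f x v) := by
  have := (conjCLE.toContinuousLinearMap.hasFDerivAt.comp x hf.hasFDerivAt).fderiv
  have h2 : (fun y => conj (f y)) = (conjCLE.toContinuousLinearMap ∘ f) := by
    ext y; simp
  rw [h2, this]; simp

lemma dbar_conj {f : Cn d → ℂ} {x : Cn d} (hf : DifferentiableAt ℝ f x) (j : Fin d) :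
    dbar j (fun y => conj (f y)) x = conj (del j f x) := by
  simp only [dbar, del, fderiv_conj hf, map_mul, map_sub, conj_I, map_div₀, map_one, map_ofNat]
  ring

lemma del_conj {f : Cn d → ℂ} {x : Cn d} (hf : DifferentiableAt ℝ f x) (j : Fin d) :
    del j (fun y => conj (f y)) x = conj (dbar j f x) := by
  simp only [dbar, del, fderiv_conj hf, map_mul, map_add, conj_I, map_div₀, map_one, map_ofNat]
  ring

lemma integral_mul_fderiv {f g : Cn d → ℂ} (hf : ContDiff ℝ ∞ f) (hg : ContDiff ℝ ∞ g)
    (hc : HasCompactSupport f) (v : Cn d) :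
    ∫ x, f x * fderiv ℝ g x v = -∫ x, fderiv ℝ f x v * g x := by
  have hf' : Continuous (fun x => fderiv ℝ f x v) :=
    ((hf.fderiv_right (m := ∞) (by simp)).continuous.clm_apply continuous_const)
  have hg' : Continuous (fun x => fderiv ℝ g x v) :=
    ((hg.fderiv_right (m := ∞) (by simp)).continuous.clm_apply continuous_const)
  apply integral_mul_fderiv_eq_neg_fderiv_mul_of_integrable
  · exact (hf'.mul hg.continuous).integrable_of_hasCompactSupport
      (HasCompactSupport.mul_right (hc.fderiv_apply ℝ v))
  · exact (hf.continuous.mul hg').integrable_of_hasCompactSupport hc.mul_right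
  · exact (hf.continuous.mul hg.continuous).integrable_of_hasCompactSupport hc.mul_right
  · exact fun x _ => hf.differentiable (by simp) x
  · exact fun x _ => hg.differentiable (by simp) x

lemma integral_mul_del {f g : Cn d → ℂ} (hf : ContDiff ℝ ∞ f) (hg : ContDiff ℝ ∞ g)
    (hc : HasCompactSupport f) (j : Fin d) :
    ∫ x, f x * del j g x = -∫ x, del j f x * g x := by
  have hf' : ∀ v, Continuous (fun x => fderiv ℝ f x v) := fun v =>
    ((hf.fderiv_right (m := ∞) (by simp)).continuous.clm_apply continuous_const)
  have hg' : ∀ v, Continuous (fun x => fderiv ℝ g x v) := fun v =>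
    ((hg.fderiv_right (m := ∞) (by simp)).continuous.clm_apply continuous_const)
  have i1 : ∀ v, Integrable (fun x => f x * fderiv ℝ g x v) := fun v =>
    (hf.continuous.mul (hg' v)).integrable_of_hasCompactSupport hc.mul_right
  have i2 : ∀ v, Integrable (fun x => fderiv ℝ f x v * g x) := fun v =>
    ((hf' v).mul hg.continuous).integrable_of_hasCompactSupport
      (HasCompactSupport.mul_right (hc.fderiv_apply ℝ v))
  have e1 : ∀ x, f x * del j g x = (1 / 2) * (f x * fderiv ℝ g x (ee j)) -
      (I / 2) * (f x * fderiv ℝ g x (I • ee j)) := fun x => by simp only [del]; ring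
  have e2 : ∀ x, del j f x * g x = (1 / 2) * (fderiv ℝ f x (ee j) * g x) -
      (I / 2) * (fderiv ℝ f x (I • ee j) * g x) := fun x => by simp only [del]; ring
  simp_rw [e1, e2]
  rw [integral_sub ((i1 _).const_mul _) ((i1 _).const_mul _),
    integral_sub ((i2 _).const_mul _) ((i2 _).const_mul _)]
  simp only [integral_const_mul, integral_mul_fderiv hf hg hc]
  ring

lemma integral_mul_dbar {f g : Cn d → ℂ} (hf : ContDiff ℝ ∞ f) (hg : ContDiff ℝ ∞ g)
    (hc : HasCompactSupport f) (j : Fin d) :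
    ∫ x, f x * dbar j g x = -∫ x, dbar j f x * g x := by
  have hconj : ∀ {h : Cn d → ℂ}, ContDiff ℝ ∞ h → ContDiff ℝ ∞ (fun x => conj (h x)) :=
    fun hh => conjCLE.contDiff.comp hh
  have hd : ∀ {h : Cn d → ℂ}, ContDiff ℝ ∞ h → ∀ x, DifferentiableAt ℝ h x :=
    fun hh x => hh.differentiable (by simp) x
  have h := integral_mul_del (hconj hf) (hconj hg)
    (hc.comp_left (g := fun z : ℂ => conj z) (by simp)) j
  simp_rw [del_conj (hd hf _), del_conj (hd hg _), ← map_mul] at h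
  rw [integral_conj, integral_conj, ← map_neg] at h
  exact (starRingEnd ℂ).injective h

lemma fderiv_fderiv_apply_comm {h : Cn d → ℂ} (hh : ContDiff ℝ ∞ h) (x v w : Cn d) :
    fderiv ℝ (fun y => fderiv ℝ h y v) x w = fderiv ℝ (fun y => fderiv ℝ h y w) x v := by
  have hd : DifferentiableAt ℝ (fderiv ℝ h) x :=
    ((hh.fderiv_right (m := ∞) (by simp)).differentiable (by simp)) x
  have key : ∀ v w, fderiv ℝ (fun y => fderiv ℝ h y v) x w = fderiv ℝ (fderiv ℝ h) x w v := by
    intro v w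
    rw [fderiv_clm_apply hd (differentiableAt_const v)]
    simp
  rw [key, key]
  have hs : IsSymmSndFDerivAt ℝ h x :=
    hh.contDiffAt.isSymmSndFDerivAt (by simpa using two_le_infty)
  exact hs.eq w v

lemma fderiv_del {h : Cn d → ℂ} (hh : ContDiff ℝ ∞ h) (j : Fin d) (x w : Cn d) :
    fderiv ℝ (del j h) x w = (1 / 2) * (fderiv ℝ (fun y => fderiv ℝ h y (ee j)) x w -
      I * fderiv ℝ (fun y => fderiv ℝ h y (I • ee j)) x w) := by
  have hd : ∀ v, DifferentiableAt ℝ (fun y => fderiv ℝ h y v) x := fun v =>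
    ((hh.fderiv_right (m := ∞) (by simp)).clm_apply contDiff_const).differentiable (by simp) x
  have : HasFDerivAt (del j h) ((1 / 2 : ℂ) • (fderiv ℝ (fun y => fderiv ℝ h y (ee j)) x -
      I • fderiv ℝ (fun y => fderiv ℝ h y (I • ee j)) x)) x :=
    (((hd _).hasFDerivAt.sub ((hd _).hasFDerivAt.const_mul I)).const_mul (1 / 2 : ℂ))
  rw [this.fderiv]
  simp only [sub_apply, smul_apply, smul_eq_mul]

lemma fderiv_dbar {h : Cn d → ℂ} (hh : ContDiff ℝ ∞ h) (j : Fin d) (x w : Cn d) :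
    fderiv ℝ (dbar j h) x w = (1 / 2) * (fderiv ℝ (fun y => fderiv ℝ h y (ee j)) x w +
      I * fderiv ℝ (fun y => fderiv ℝ h y (I • ee j)) x w) := by
  have hd : ∀ v, DifferentiableAt ℝ (fun y => fderiv ℝ h y v) x := fun v =>
    ((hh.fderiv_right (m := ∞) (by simp)).clm_apply contDiff_const).differentiable (by simp) x
  have : HasFDerivAt (dbar j h) ((1 / 2 : ℂ) • (fderiv ℝ (fun y => fderiv ℝ h y (ee j)) x +
      I • fderiv ℝ (fun y => fderiv ℝ h y (I • ee j)) x)) x :=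
    (((hd _).hasFDerivAt.add ((hd _).hasFDerivAt.const_mul I)).const_mul (1 / 2 : ℂ))
  rw [this.fderiv]
  simp only [add_apply, smul_apply, smul_eq_mul]

lemma dbar_del_comm {h : Cn d → ℂ} (hh : ContDiff ℝ ∞ h) (j k : Fin d) (x : Cn d) :
    dbar j (del k h) x = del k (dbar j h) x := by
  rw [dbar, del, fderiv_del hh, fderiv_del hh, fderiv_dbar hh, fderiv_dbar hh]
  simp only [fderiv_fderiv_apply_comm hh x (ee k), fderiv_fderiv_apply_comm hh x (I • ee k)]
  ring

lemma dbar_dbar_comm {h : Cn d → ℂ} (hh : ContDiff ℝ ∞ h) (j k : Fin d) (x : Cn d) :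
    dbar j (dbar k h) x = dbar k (dbar j h) x := by
  rw [dbar, dbar, fderiv_dbar hh, fderiv_dbar hh, fderiv_dbar hh, fderiv_dbar hh]
  simp only [fderiv_fderiv_apply_comm hh x (ee k), fderiv_fderiv_apply_comm hh x (I • ee k)]
  ring

end Wirtinger

section BasicIdentity

variable {d : ℕ}

/-- The weighted derivative `δ_j u = ∂_j u - u ∂_j φ`. -/
def wdel (φ : Cn d → ℝ) (j : Fin d) (u : Cn d → ℂ) (x : Cn d) : ℂ :=
  del j u x - u x * del j (fun y => (φ y : ℂ)) x

/-- The weight `e^{-φ}` as a complex function. -/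
def wt (φ : Cn d → ℝ) (x : Cn d) : ℂ := ((Real.exp (-φ x) : ℝ) : ℂ)

lemma contDiff_ofReal_comp {φ : Cn d → ℝ} (hφ : ContDiff ℝ ∞ φ) :
    ContDiff ℝ ∞ (fun y => (φ y : ℂ)) := ofRealCLM.contDiff.comp hφ

lemma contDiff_wt {φ : Cn d → ℝ} (hφ : ContDiff ℝ ∞ φ) : ContDiff ℝ ∞ (wt φ) :=
  contDiff_ofReal_comp hφ.neg.exp

lemma contDiff_wdel {φ : Cn d → ℝ} (hφ : ContDiff ℝ ∞ φ) {u : Cn d → ℂ}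
    (hu : ContDiff ℝ ∞ u) (j : Fin d) : ContDiff ℝ ∞ (wdel φ j u) :=
  (contDiff_del hu j).sub (hu.mul (contDiff_del (contDiff_ofReal_comp hφ) j))

lemma fderiv_ofReal_comp {φ : Cn d → ℝ} {x : Cn d} (hφ : DifferentiableAt ℝ φ x) (v : Cn d) :
    fderiv ℝ (fun y => (φ y : ℂ)) x v = (fderiv ℝ φ x v : ℝ) := by
  have := (ofRealCLM.hasFDerivAt.comp x hφ.hasFDerivAt).fderiv
  have h2 : (fun y => (φ y : ℂ)) = (ofRealCLM ∘ φ) := by ext y; simp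
  rw [h2, this]; simp

lemma del_wt {φ : Cn d → ℝ} (hφ : ContDiff ℝ ∞ φ) (j : Fin d) (x : Cn d) :
    del j (wt φ) x = - wt φ x * del j (fun y => (φ y : ℂ)) x := by
  have hd : DifferentiableAt ℝ φ x := hφ.differentiable (by simp) x
  have h1 : ∀ v, fderiv ℝ (wt φ) x v = - wt φ x * fderiv ℝ (fun y => (φ y : ℂ)) x v := by
    intro v
    rw [fderiv_ofReal_comp hd]
    have : DifferentiableAt ℝ (fun x => Real.exp (-φ x)) x := hd.fun_neg.exp
    change fderiv ℝ (fun y => ((Real.exp (-φ y) : ℝ) : ℂ)) x v = _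
    rw [fderiv_ofReal_comp this, fderiv_exp hd.fun_neg]
    simp [wt]
  rw [del, del, h1, h1]; ring

lemma wdel_mul_wt {φ : Cn d → ℝ} (hφ : ContDiff ℝ ∞ φ) {u : Cn d → ℂ}
    (hu : ContDiff ℝ ∞ u) (j : Fin d) (x : Cn d) :
    wdel φ j u x * wt φ x = del j (fun y => u y * wt φ y) x := by
  rw [del_mul (hu.differentiable (by simp) x) ((contDiff_wt hφ).differentiable (by simp) x),
    del_wt hφ, wdel]
  ring

lemma dbar_wdel {φ : Cn d → ℝ} (hφ : ContDiff ℝ ∞ φ) {u : Cn d → ℂ}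
    (hu : ContDiff ℝ ∞ u) (j k : Fin d) (x : Cn d) :
    dbar j (wdel φ k u) x = wdel φ k (dbar j u) x -
      u x * dbar j (del k (fun y => (φ y : ℂ))) x := by
  have h1 := (contDiff_del hu k).differentiable (by simp) x
  have h2 := hu.differentiable (by simp) x
  have h3 := (contDiff_del (contDiff_ofReal_comp hφ) k).differentiable (by simp) x
  change dbar j (fun y => del k u y - u y * del k (fun y => (φ y : ℂ)) y) x = _
  rw [dbar_sub h1 (h2.fun_mul h3) j, dbar_mul h2 h3, dbar_del_comm hu]
  rw [wdel]; ring

lemma conj_wt (φ : Cn d → ℝ) (x : Cn d) : conj (wt φ x) = wt φ x := conj_ofReal _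

/-- Integration by parts for the weighted derivatives. -/
theorem integral_wdel_mul_conj_wdel {φ : Cn d → ℝ} (hφ : ContDiff ℝ ∞ φ) {u v : Cn d → ℂ}
    (hu : ContDiff ℝ ∞ u) (hv : ContDiff ℝ ∞ v) (hcu : HasCompactSupport u) (j k : Fin d) :
    ∫ x, wdel φ j u x * conj (wdel φ k v x) * wt φ x =
      (∫ x, dbar k u x * conj (dbar j v x) * wt φ x) +
      ∫ x, conj (dbar j (del k (fun y => (φ y : ℂ))) x) * (u x * conj (v x)) * wt φ x := by
  have hw := contDiff_wt hφ
  have hconj : ∀ {h : Cn d → ℂ}, ContDiff ℝ ∞ h → ContDiff ℝ ∞ (fun x => conj (h x)) :=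
    fun hh => conjCLE.contDiff.comp hh
  have hd : ∀ {h : Cn d → ℂ}, ContDiff ℝ ∞ h → ∀ x, DifferentiableAt ℝ h x :=
    fun hh x => hh.differentiable (by simp) x
  have hΦ := contDiff_dbar (contDiff_del (contDiff_ofReal_comp hφ) k) j
  have s1 : ∫ x, wdel φ j u x * conj (wdel φ k v x) * wt φ x =
      -∫ x, (u x * wt φ x) * conj (dbar j (wdel φ k v) x) := by
    have := integral_mul_del (hu.mul hw) (hconj (contDiff_wdel hφ hv k)) hcu.mul_right j
    simp_rw [del_conj (hd (contDiff_wdel hφ hv k) _)] at this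
    rw [this, neg_neg]
    congr 1; ext x
    rw [← wdel_mul_wt hφ hu]; ring
  have s2 : ∫ x, dbar k u x * conj (dbar j v x) * wt φ x =
      -∫ x, (u x * wt φ x) * conj (wdel φ k (dbar j v) x) := by
    have h3 : ContDiff ℝ ∞ (fun x => dbar j v x * wt φ x) := (contDiff_dbar hv j).mul hw
    have := integral_mul_dbar hu (hconj h3) hcu k
    rw [eq_neg_iff_add_eq_zero] at this
    rw [eq_neg_iff_add_eq_zero, ← this, add_comm]
    congr 1
    · congr 1; ext x
      rw [dbar_conj (hd h3 x), ← wdel_mul_wt hφ (contDiff_dbar hv j), map_mul, conj_wt]; ring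
    · congr 1; ext x
      rw [map_mul, conj_wt]; ring
  rw [s1, s2, neg_add_eq_sub, ← sub_eq_zero, ← integral_neg]
  have i1 : Integrable (fun x => conj (dbar j (del k (fun y => (φ y : ℂ))) x) *
      (u x * conj (v x)) * wt φ x) :=
    (((hconj hΦ).continuous.mul (hu.mul (hconj hv)).continuous).mul
      hw.continuous).integrable_of_hasCompactSupport
      (HasCompactSupport.mul_right (HasCompactSupport.mul_left (HasCompactSupport.mul_right hcu)))
  have i2 : Integrable (fun x => (u x * wt φ x) * conj (wdel φ k (dbar j v) x)) :=
    ((hu.mul hw).mul (hconj (contDiff_wdel hφ (contDiff_dbar hv j) k))).continuous.integrable_of_hasCompactSupport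
      (HasCompactSupport.mul_right (HasCompactSupport.mul_right hcu))
  rw [← integral_sub i1 i2, sub_eq_zero]
  congr 1; ext x
  rw [dbar_wdel hφ hv, map_sub, map_mul]
  ring

end BasicIdentity

section Levi

variable {d : ℕ}

/-- The Levi form of `φ` at `x` written with directional derivatives. -/
def levi (φ : Cn d → ℝ) (x v : Cn d) : ℝ :=
  (1 / 4) * (fderiv ℝ (fun y => fderiv ℝ φ y v) x v +
    fderiv ℝ (fun y => fderiv ℝ φ y (I • v)) x (I • v))

/-- The sesquilinear form associated with a real bilinear form. -/
def hermForm (B : Cn d →L[ℝ] Cn d →L[ℝ] ℝ) (w : Cn d) : Cn d →ₗ[ℂ] ℂ where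
  toFun v := (1 / 4) * ((B w v : ℂ) + B (I • w) (I • v) + I * (B (I • w) v - B w (I • v)))
  map_add' v v' := by simp only [map_add, smul_add, ofReal_add]; ring
  map_smul' c v := by
    have h1 : c • v = c.re • v + c.im • (I • v) := by
      conv_lhs => rw [← re_add_im c]
      rw [add_smul, mul_smul, coe_smul, coe_smul]
    have h2 : I • c • v = c.re • (I • v) - c.im • v := by
      rw [h1, smul_add, smul_comm I c.re, smul_comm I c.im, smul_smul I I, I_mul_I]
      simp [sub_eq_add_neg]
    rw [h2, h1]
    simp only [map_add, map_sub, map_smul, smul_eq_mul, ofReal_add, ofReal_sub, ofReal_mul,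
      RingHom.id_apply]
    conv_rhs => rw [← re_add_im c]
    linear_combination (-(1 / 4) * (c.im : ℂ) * (B (I • w) v - B w (I • v))) * I_mul_I

lemma hermForm_apply (B : Cn d →L[ℝ] Cn d →L[ℝ] ℝ) (w v : Cn d) :
    hermForm B w v =
      (1 / 4) * ((B w v : ℂ) + B (I • w) (I • v) + I * (B (I • w) v - B w (I • v))) := rfl

lemma hermForm_conj {B : Cn d →L[ℝ] Cn d →L[ℝ] ℝ} (hB : ∀ v w, B v w = B w v) (v w : Cn d) :
    conj (hermForm B w v) = hermForm B v w := by
  simp only [hermForm_apply, map_mul, map_add, map_sub, conj_I, conj_ofReal, map_div₀, map_one,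
    map_ofNat]
  rw [hB v w, hB (I • v) (I • w), hB v (I • w), hB (I • v) w]
  ring

lemma hermForm_self {B : Cn d →L[ℝ] Cn d →L[ℝ] ℝ} (hB : ∀ v w, B v w = B w v) (v : Cn d) :
    hermForm B v v = ((1 / 4 * (B v v + B (I • v) (I • v)) : ℝ) : ℂ) := by
  rw [hermForm_apply, hB (I • v) v]
  push_cast
  ring

lemma sum_smul_ee (v : Cn d) : v = ∑ j, v j • ee j := by
  ext k
  simp [ee, Pi.single_apply]

lemma sum_hermForm {B : Cn d →L[ℝ] Cn d →L[ℝ] ℝ} (hB : ∀ v w, B v w = B w v) (v : Cn d) :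
    ∑ j, ∑ k, hermForm B (ee k) (ee j) * (v j * conj (v k)) =
      ((1 / 4 * (B v v + B (I • v) (I • v)) : ℝ) : ℂ) := by
  have h1 : ∀ w, hermForm B w v = ∑ j, v j * hermForm B w (ee j) := by
    intro w
    conv_lhs => rw [sum_smul_ee v]
    simp
  rw [← hermForm_self hB, h1]
  refine Finset.sum_congr rfl fun j _ => ?_
  rw [← hermForm_conj hB, h1, map_sum, Finset.mul_sum]
  refine Finset.sum_congr rfl fun k _ => ?_
  rw [map_mul, hermForm_conj hB]
  ring

lemma dbar_del_ofReal {φ : Cn d → ℝ} (hφ : ContDiff ℝ ∞ φ) (j k : Fin d) (x : Cn d) :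
    dbar k (del j (fun y => (φ y : ℂ))) x =
      hermForm (fderiv ℝ (fderiv ℝ φ) x) (ee k) (ee j) := by
  have hd : DifferentiableAt ℝ (fderiv ℝ φ) x :=
    ((hφ.fderiv_right (m := ∞) (by simp)).differentiable (by simp)) x
  have key : ∀ v w, fderiv ℝ (fun y => fderiv ℝ (fun z => (φ z : ℂ)) y v) x w =
      fderiv ℝ (fderiv ℝ φ) x w v := by
    intro v w
    have : (fun y => fderiv ℝ (fun z => (φ z : ℂ)) y v) = fun y => ((fderiv ℝ φ y v : ℝ) : ℂ) := by
      ext y; exact fderiv_ofReal_comp (hφ.differentiable (by simp) y) v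
    rw [this, fderiv_ofReal_comp (hd.clm_apply (differentiableAt_const v)),
      fderiv_clm_apply hd (differentiableAt_const v)]
    simp
  rw [dbar, fderiv_del (contDiff_ofReal_comp hφ), fderiv_del (contDiff_ofReal_comp hφ)]
  simp only [key, hermForm_apply]
  linear_combination (-(1 / 4) * (fderiv ℝ (fderiv ℝ φ) x (I • ee k) (I • ee j) : ℂ)) * I_mul_I

lemma levi_eq {φ : Cn d → ℝ} {x : Cn d} (hφ : ContDiffAt ℝ 2 φ x) (v : Cn d) :
    levi φ x v = 1 / 4 * (fderiv ℝ (fderiv ℝ φ) x v v +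
      fderiv ℝ (fderiv ℝ φ) x (I • v) (I • v)) := by
  have hd : DifferentiableAt ℝ (fderiv ℝ φ) x :=
    (hφ.fderiv_right (m := 1) (by norm_num)).differentiableAt (by simp)
  simp only [levi, fderiv_clm_apply hd (differentiableAt_const _)]
  simp

lemma sum_dbar_del {φ : Cn d → ℝ} (hφ : ContDiff ℝ ∞ φ) (x v : Cn d) :
    ∑ j, ∑ k, dbar k (del j (fun y => (φ y : ℂ))) x * (v j * conj (v k)) =
      (levi φ x v : ℂ) := by
  simp_rw [dbar_del_ofReal hφ]
  have hs : IsSymmSndFDerivAt ℝ φ x :=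
    hφ.contDiffAt.isSymmSndFDerivAt (by simpa using two_le_infty)
  rw [sum_hermForm (fun v w => hs.eq v w), levi_eq (hφ.of_le two_le_infty).contDiffAt]

lemma conj_dbar_del_ofReal {φ : Cn d → ℝ} (hφ : ContDiff ℝ ∞ φ) (j k : Fin d) (x : Cn d) :
    conj (dbar j (del k (fun y => (φ y : ℂ))) x) = dbar k (del j (fun y => (φ y : ℂ))) x := by
  have hs : IsSymmSndFDerivAt ℝ φ x :=
    hφ.contDiffAt.isSymmSndFDerivAt (by simpa using two_le_infty)
  rw [dbar_del_ofReal hφ, dbar_del_ofReal hφ, hermForm_conj fun v w => hs.eq v w]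

end Levi

section BasicEstimate

variable {d : ℕ}

lemma sum_norm_sub_sq (a : Fin d → Fin d → ℂ) :
    (1 / 2 : ℝ) * ∑ j, ∑ k, ‖a j k - a k j‖ ^ 2 =
      (∑ j, ∑ k, ‖a j k‖ ^ 2) - (∑ j, ∑ k, a k j * conj (a j k)).re := by
  have h : ∀ z w : ℂ, ‖z - w‖ ^ 2 = ‖z‖ ^ 2 + ‖w‖ ^ 2 - 2 * (w * conj z).re := by
    intro z w
    rw [← normSq_eq_norm_sq, ← normSq_eq_norm_sq, ← normSq_eq_norm_sq]
    simp only [normSq_apply, sub_re, sub_im, mul_re, conj_re, conj_im]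
    ring
  simp_rw [h, Finset.sum_sub_distrib, Finset.sum_add_distrib, re_sum]
  rw [Finset.sum_comm (f := fun j k => ‖a k j‖ ^ 2)]
  simp_rw [← Finset.mul_sum]
  ring

/-- The Morrey–Kohn–Hörmander inequality for smooth compactly supported forms. -/
theorem integral_basic_nonneg {φ : Cn d → ℝ} (hφ : ContDiff ℝ ∞ φ) {g : Fin d → Cn d → ℂ}
    (hg : ∀ j, ContDiff ℝ ∞ (g j)) (hc : ∀ j, HasCompactSupport (g j)) :
    Integrable (fun x => (‖∑ j, wdel φ j (g j) x‖ ^ 2 +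
      1 / 2 * ∑ j, ∑ k, ‖dbar j (g k) x - dbar k (g j) x‖ ^ 2 -
      levi φ x (WithLp.toLp 2 fun j => g j x)) * Real.exp (-φ x)) ∧
    0 ≤ ∫ x, (‖∑ j, wdel φ j (g j) x‖ ^ 2 +
      1 / 2 * ∑ j, ∑ k, ‖dbar j (g k) x - dbar k (g j) x‖ ^ 2 -
      levi φ x (WithLp.toLp 2 fun j => g j x)) * Real.exp (-φ x) := by
  have hconj : ∀ {h : Cn d → ℂ}, ContDiff ℝ ∞ h → ContDiff ℝ ∞ (fun x => conj (h x)) :=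
    fun hh => conjCLE.contDiff.comp hh
  have hw := contDiff_wt hφ
  set P : Fin d → Fin d → Cn d → ℂ := fun j k x => wdel φ j (g j) x * conj (wdel φ k (g k) x) * wt φ x
  set Q : Fin d → Fin d → Cn d → ℂ := fun j k x => dbar k (g j) x * conj (dbar j (g k) x) * wt φ x
  set R : Fin d → Fin d → Cn d → ℂ := fun j k x =>
    conj (dbar j (del k (fun y => (φ y : ℂ))) x) * (g j x * conj (g k x)) * wt φ x
  have hwc : ∀ j, HasCompactSupport (wdel φ j (g j)) := fun j =>
    (hasCompactSupport_del (hc j) j).sub (hc j).mul_right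
  have iP : ∀ j k, Integrable (P j k) := fun j k =>
    (((contDiff_wdel hφ (hg j) j).mul (hconj (contDiff_wdel hφ (hg k) k))).mul
      hw).continuous.integrable_of_hasCompactSupport (((hwc j).mul_right).mul_right)
  have iQ : ∀ j k, Integrable (Q j k) := fun j k =>
    (((contDiff_dbar (hg j) k).mul (hconj (contDiff_dbar (hg k) j))).mul
      hw).continuous.integrable_of_hasCompactSupport
        (((hasCompactSupport_dbar (hc j) k).mul_right).mul_right)
  have iR : ∀ j k, Integrable (R j k) := fun j k =>
    (((hconj (contDiff_dbar (contDiff_del (contDiff_ofReal_comp hφ) k) j)).mul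
      ((hg j).mul (hconj (hg k)))).mul hw).continuous.integrable_of_hasCompactSupport
        (((hc j).mul_right).mul_left.mul_right)
  have h0 : ∫ x, ∑ j, ∑ k, (P j k x - Q j k x - R j k x) = 0 := by
    have i3 : ∀ j k, Integrable (fun x => P j k x - Q j k x - R j k x) := fun j k =>
      ((iP j k).sub (iQ j k)).sub (iR j k)
    rw [integral_finsetSum _ fun j _ => integrable_finsetSum _ fun k _ => i3 j k]
    refine Finset.sum_eq_zero fun j _ => ?_
    rw [integral_finsetSum _ fun k _ => i3 j k]
    refine Finset.sum_eq_zero fun k _ => ?_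
    rw [integral_sub ((iP j k).sub' (iQ j k)) (iR j k), integral_sub (iP j k) (iQ j k)]
    have := integral_wdel_mul_conj_wdel hφ (hg j) (hg k) (hc j) j k
    simp only [P, Q, R]
    rw [this]; ring
  have iT : Integrable (fun x => ∑ j, ∑ k, (P j k x - Q j k x - R j k x)) :=
    integrable_finsetSum _ fun j _ => integrable_finsetSum _ fun k _ =>
      ((iP j k).sub (iQ j k)).sub (iR j k)
  have h1 : ∫ x, (∑ j, ∑ k, (P j k x - Q j k x - R j k x)).re = 0 := by
    have := integral_re iT
    simp only [RCLike.re_to_complex] at this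
    rw [this, h0]; simp
  have h2 : ∀ x, (‖∑ j, wdel φ j (g j) x‖ ^ 2 +
      1 / 2 * ∑ j, ∑ k, ‖dbar j (g k) x - dbar k (g j) x‖ ^ 2 -
      levi φ x (WithLp.toLp 2 fun j => g j x)) * Real.exp (-φ x) =
      (∑ j, ∑ k, (P j k x - Q j k x - R j k x)).re +
        (∑ j, ∑ k, ‖dbar j (g k) x‖ ^ 2) * Real.exp (-φ x) := by
    intro x
    have e1 : ∑ j, ∑ k, P j k x = ((‖∑ j, wdel φ j (g j) x‖ ^ 2 * Real.exp (-φ x) : ℝ) : ℂ) := by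
      simp only [P, ← Finset.sum_mul, ← Finset.mul_sum, ← map_sum, wt]
      rw [mul_conj, normSq_eq_norm_sq]; push_cast; rfl
    have e2 : ∑ j, ∑ k, Q j k x =
        (∑ j, ∑ k, dbar k (g j) x * conj (dbar j (g k) x)) * (Real.exp (-φ x) : ℝ) := by
      simp only [Q, Finset.sum_mul, wt]
    have e3 : ∑ j, ∑ k, R j k x =
        ((levi φ x (WithLp.toLp 2 fun j => g j x) * Real.exp (-φ x) : ℝ) : ℂ) := by
      simp only [R, conj_dbar_del_ofReal hφ, ← Finset.sum_mul]
      have := sum_dbar_del hφ x (WithLp.toLp 2 fun j => g j x)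
      simp only at this
      rw [this, wt]; push_cast; rfl
    simp only [Finset.sum_sub_distrib]
    rw [e1, e2, e3, sub_re, sub_re, ofReal_re, ofReal_re, re_mul_ofReal,
      sum_norm_sub_sq fun j k => dbar j (g k) x]
    ring
  simp_rw [h2]
  have iT' : Integrable (fun x => (∑ j, ∑ k, (P j k x - Q j k x - R j k x)).re) := iT.re
  have iZ : Integrable (fun x => (∑ j, ∑ k, ‖dbar j (g k) x‖ ^ 2) * Real.exp (-φ x)) := by
    simp_rw [Finset.sum_mul]
    refine integrable_finsetSum _ fun j _ => integrable_finsetSum _ fun k _ =>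
      Continuous.integrable_of_hasCompactSupport ?_ ?_
    · exact ((contDiff_dbar (hg k) j).continuous.norm.pow 2).mul
        (Real.continuous_exp.comp hφ.continuous.neg)
    · apply HasCompactSupport.mul_right
      exact (hasCompactSupport_dbar (hc k) j).comp_left (g := fun z : ℂ => ‖z‖ ^ 2) (by simp)
  refine ⟨iT'.add iZ, ?_⟩
  rw [integral_add iT' iZ, h1, zero_add]
  exact integral_nonneg fun x => by positivity

/-- Smooth cutoff functions. -/
lemma exists_cutoff {D K : Set (Cn d)} (hD : IsOpen D) (hK : IsCompact K) (hKD : K ⊆ D) :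
    ∃ χ : Cn d → ℝ, ContDiff ℝ ∞ χ ∧ HasCompactSupport χ ∧ tsupport χ ⊆ D ∧
      (∀ x ∈ K, ∀ᶠ y in 𝓝 x, χ y = 1) ∧ ∀ x, χ x ∈ Icc (0 : ℝ) 1 := by
  obtain ⟨L, hL, hKL, hLD⟩ := exists_compact_between hK hD hKD
  obtain ⟨χ, h1, h0, h01⟩ := exists_contMDiffMap_one_nhds_of_subset_interior
    (modelWithCornersSelf ℝ (Cn d)) (n := ⊤) hK.isClosed hKL
  have hts : tsupport χ ⊆ L := closure_minimal (fun x hx => by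
    by_contra hc; exact hx (h0 x hc)) hL.isClosed
  refine ⟨χ, χ.contMDiff.contDiff, hL.of_isClosed_subset (isClosed_tsupport _) hts,
    hts.trans hLD, fun x hx => ?_, h01⟩
  exact h1.filter_mono (nhds_le_nhdsSet hx)

/-- A cutoff of a function smooth on an open set is globally smooth. -/
lemma contDiff_cutoff_smul {F : Type*} [NormedAddCommGroup F] [NormedSpace ℝ F]
    {D : Set (Cn d)} (hD : IsOpen D) {χ : Cn d → ℝ} (hχ : ContDiff ℝ ∞ χ)
    (hχD : tsupport χ ⊆ D) {φ : Cn d → F} (hφ : ContDiffOn ℝ ∞ φ D) :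
    ContDiff ℝ ∞ (fun x => χ x • φ x) := by
  rw [contDiff_iff_contDiffAt]
  intro x
  by_cases hx : x ∈ D
  · exact hχ.contDiffAt.smul (hφ.contDiffAt (hD.mem_nhds hx))
  · have : (fun x => χ x • φ x) =ᶠ[𝓝 x] fun _ => 0 := by
      have h2 : (tsupport χ)ᶜ ∈ 𝓝 x :=
        (isClosed_tsupport χ).isOpen_compl.mem_nhds fun h => hx (hχD h)
      filter_upwards [h2] with y hy
      rw [image_eq_zero_of_notMem_tsupport hy, zero_smul]
    exact contDiffAt_const.congr_of_eventuallyEq this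

/-- A function smooth on a neighbourhood of a compact set agrees near that set with a globally
smooth function. -/
lemma exists_contDiff_eq_near {F : Type*} [NormedAddCommGroup F] [NormedSpace ℝ F]
    {D K : Set (Cn d)} (hD : IsOpen D) (hK : IsCompact K) (hKD : K ⊆ D)
    {φ : Cn d → F} (hφ : ContDiffOn ℝ ∞ φ D) :
    ∃ φ' : Cn d → F, ContDiff ℝ ∞ φ' ∧ HasCompactSupport φ' ∧ ∀ x ∈ K, φ' =ᶠ[𝓝 x] φ := by
  obtain ⟨χ, h1, h2, h3, h4, -⟩ := exists_cutoff hD hK hKD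
  refine ⟨fun x => χ x • φ x, contDiff_cutoff_smul hD h1 h3 hφ, h2.smul_right, fun x hx => ?_⟩
  filter_upwards [h4 x hx] with y hy
  rw [hy, one_smul]

/-- The a priori estimate with weights `φ` and `ψ` on an open set. -/
theorem integral_apriori_nonneg {D : Set (Cn d)} (hD : IsOpen D) {φ ψ : Cn d → ℝ}
    (hφ : ContDiffOn ℝ ∞ φ D)
    (hL : ∀ x ∈ D, ∀ v, 2 * (∑ j, ‖del j (fun y => (ψ y : ℂ)) x‖ ^ 2 + Real.exp (ψ x)) * ‖v‖ ^ 2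
      ≤ levi φ x v)
    {g : Fin d → Cn d → ℂ} (hg : ∀ j, ContDiff ℝ ∞ (g j)) (hc : ∀ j, HasCompactSupport (g j))
    (hgD : ∀ j, tsupport (g j) ⊆ D) :
    0 ≤ ∫ x, (2 * ‖∑ j, (wdel φ j (g j) x + g j x * del j (fun y => (ψ y : ℂ)) x)‖ ^ 2 +
      1 / 2 * ∑ j, ∑ k, ‖dbar j (g k) x - dbar k (g j) x‖ ^ 2 -
      2 * Real.exp (ψ x) * ∑ j, ‖g j x‖ ^ 2) * Real.exp (-φ x) := by
  set K := ⋃ j, tsupport (g j) with hKdef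
  have hK : IsCompact K := isCompact_iUnion hc
  have hKD : K ⊆ D := iUnion_subset hgD
  obtain ⟨φ', hφ', -, hφφ'⟩ := exists_contDiff_eq_near hD hK hKD hφ
  obtain ⟨hi, h0⟩ := integral_basic_nonneg hφ' hg hc
  by_cases hInt : Integrable (fun x => (2 * ‖∑ j, (wdel φ j (g j) x +
      g j x * del j (fun y => (ψ y : ℂ)) x)‖ ^ 2 +
      1 / 2 * ∑ j, ∑ k, ‖dbar j (g k) x - dbar k (g j) x‖ ^ 2 -
      2 * Real.exp (ψ x) * ∑ j, ‖g j x‖ ^ 2) * Real.exp (-φ x))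
  swap
  · rw [integral_undef hInt]
  refine h0.trans (integral_mono hi hInt fun x => ?_)
  by_cases hx : x ∈ K
  · have he := hφφ' x hx
    have e1 : φ' x = φ x := he.eq_of_nhds
    have e2 : fderiv ℝ φ' =ᶠ[𝓝 x] fderiv ℝ φ := he.fderiv
    have e3 : ∀ v, levi φ' x v = levi φ x v := by
      intro v
      have : ∀ w, (fun y => fderiv ℝ φ' y w) =ᶠ[𝓝 x] fun y => fderiv ℝ φ y w := by
        intro w
        filter_upwards [e2] with y hy using by rw [hy]
      simp only [levi, (this _).fderiv_eq]
    have e4 : ∀ j, wdel φ' j (g j) x = wdel φ j (g j) x := by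
      intro j
      have : (fun y => (φ' y : ℂ)) =ᶠ[𝓝 x] fun y => (φ y : ℂ) := by
        filter_upwards [he] with y hy using by rw [hy]
      simp only [wdel, del, this.fderiv_eq]
    simp only [e1, e3, e4]
    refine mul_le_mul_of_nonneg_right ?_ (Real.exp_nonneg _)
    have hl := hL x (hKD hx) (WithLp.toLp 2 fun j => g j x)
    rw [EuclideanSpace.norm_sq_eq] at hl
    simp only at hl
    set S := ∑ j, wdel φ j (g j) x
    set T := ∑ j, g j x * del j (fun y => (ψ y : ℂ)) x
    have hST : ∑ j, (wdel φ j (g j) x + g j x * del j (fun y => (ψ y : ℂ)) x) = S + T :=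
      Finset.sum_add_distrib
    have hT : ‖T‖ ^ 2 ≤ (∑ j, ‖g j x‖ ^ 2) * ∑ j, ‖del j (fun y => (ψ y : ℂ)) x‖ ^ 2 := by
      refine le_trans ?_ (Finset.sum_mul_sq_le_sq_mul_sq _ _ _)
      gcongr
      refine (norm_sum_le _ _).trans_eq ?_
      simp
    have hS : ‖S‖ ^ 2 ≤ 2 * ‖S + T‖ ^ 2 + 2 * ‖T‖ ^ 2 := by
      have : ‖S‖ ≤ ‖S + T‖ + ‖T‖ := by simpa using norm_sub_le (S + T) T
      nlinarith [norm_nonneg S, norm_nonneg (S + T), norm_nonneg T, sq_nonneg (‖S + T‖ - ‖T‖)]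
    rw [hST]
    linarith
  · have hx' : ∀ j, x ∉ tsupport (g j) := fun j hj => hx (mem_iUnion.2 ⟨j, hj⟩)
    have z1 : ∀ j, g j x = 0 := fun j => image_eq_zero_of_notMem_tsupport (hx' j)
    have z2 : ∀ j k, del j (g k) x = 0 := fun j k =>
      image_eq_zero_of_notMem_tsupport fun h => hx' k (tsupport_del_subset _ _ h)
    have z3 : ∀ j k, dbar j (g k) x = 0 := fun j k =>
      image_eq_zero_of_notMem_tsupport fun h => hx' k (tsupport_dbar_subset _ _ h)
    have z4 : (WithLp.toLp 2 fun j : Fin d => (0 : ℂ)) = (0 : Cn d) := rfl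
    simp [wdel, z1, z2, z3, z4, levi]

end BasicEstimate

end SCV

namespace SCV

open MeasureTheory Filter Topology
open scoped ContDiff ENNReal NNReal Convolution ComplexConjugate

section Mollification

variable {d : ℕ}

/-- The regularization of `f` by the mollifier of radius `δ`. -/
def conv (δ : ℝ) (f : Cn d → ℂ) (x : Cn d) : ℂ := ∫ t, mol δ t • f (x - t)

lemma conv_eq_convolution (δ : ℝ) (f : Cn d → ℂ) :
    conv δ f = mol δ ⋆[ContinuousLinearMap.lsmul ℝ ℝ, volume] f := rfl

lemma conv_eq_swap (δ : ℝ) (f : Cn d → ℂ) (x : Cn d) :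
    conv δ f x = ∫ t, mol δ (x - t) • f t := by
  rw [conv, ← integral_sub_left_eq_self _ volume x]
  simp

lemma contDiff_conv {δ : ℝ} (hδ : 0 < δ) {f : Cn d → ℂ} (hf : LocallyIntegrable f) :
    ContDiff ℝ ∞ (conv δ f) := by
  rw [conv_eq_convolution]
  exact (mol_hasCompactSupport hδ).contDiff_convolution_left _ (mol_contDiff δ) hf

lemma conv_eq_zero {δ : ℝ} (hδ : 0 < δ) {f : Cn d → ℂ} {x : Cn d}
    (h : ∀ y ∈ ball x δ, f y = 0) : conv δ f x = 0 := by
  rw [conv_eq_swap]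
  apply integral_eq_zero_of_ae
  filter_upwards with t
  by_cases ht : t ∈ ball x δ
  · simp [h t ht]
  · rw [mol_eq_zero hδ (by rw [mem_ball, dist_comm, dist_eq_norm, not_lt] at ht; exact ht)]
    simp

lemma locallyIntegrable_of_memLp {f : Cn d → ℂ} (hf : MemLp f 2) : LocallyIntegrable f :=
  hf.locallyIntegrable (by norm_num)

lemma tendsto_eLpNorm_translate {f : Cn d → ℂ} (hf : MemLp f 2) :
    Tendsto (fun t : Cn d => eLpNorm (fun x => f (x - t) - f x) 2 volume) (𝓝 0) (𝓝 0) := by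
  let G : C(Cn d × Cn d, Cn d) := ⟨fun p => p.2 - p.1, by fun_prop⟩
  have hG : Continuous (fun t : Cn d => G.curry t) := G.curry.continuous
  have hm : ∀ t, MeasurePreserving (G.curry t) volume volume := fun t =>
    measurePreserving_sub_right volume t
  have h := ((continuous_const (y := hf.toLp f)).compMeasurePreservingLp hG hm
    (by norm_num)).tendsto 0
  rw [Lp.tendsto_Lp_iff_tendsto_eLpNorm'] at h
  refine h.congr fun t => eLpNorm_congr_ae ?_
  have e : ∀ t, ∀ᵐ x, (Lp.compMeasurePreserving (G.curry t) (hm t) (hf.toLp f)) x = f (x - t) := by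
    intro t
    filter_upwards [Lp.coeFn_compMeasurePreserving (hf.toLp f) (hm t),
      (hm t).quasiMeasurePreserving.ae_eq_comp hf.coeFn_toLp] with x h1 h2
    rw [h1, h2]; rfl
  filter_upwards [e t, e 0] with x h1 h2
  rw [Pi.sub_apply, h1, h2, sub_zero]

lemma integrable_mol_smul {δ : ℝ} (hδ : 0 < δ) {f : Cn d → ℂ} (hf : LocallyIntegrable f)
    (x : Cn d) : Integrable (fun t => mol δ t • f (x - t)) :=
  (mol_hasCompactSupport hδ).convolutionExists_left (ContinuousLinearMap.lsmul ℝ ℝ)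
    (mol_contDiff δ).continuous hf x

lemma lintegral_mol {δ : ℝ} (hδ : 0 < δ) : ∫⁻ t : Cn d, ENNReal.ofReal (mol δ t) = 1 := by
  rw [← ofReal_integral_eq_lintegral_ofReal (mol_integrable hδ)
    (Eventually.of_forall (mol_nonneg hδ)), integral_mol hδ, ENNReal.ofReal_one]

lemma enorm_conv_sub_sq_le {δ : ℝ} (hδ : 0 < δ) {f : Cn d → ℂ} (hf : LocallyIntegrable f)
    (x : Cn d) :
    ‖conv δ f x - f x‖ₑ ^ (2 : ℝ) ≤
      ∫⁻ t, ENNReal.ofReal (mol δ t) * ‖f (x - t) - f x‖ₑ ^ (2 : ℝ) := by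
  have h1 : conv δ f x - f x = ∫ t, mol δ t • (f (x - t) - f x) := by
    simp_rw [smul_sub]
    rw [integral_sub (integrable_mol_smul hδ hf x) ((mol_integrable hδ).smul_const _),
      integral_smul_const, integral_mol hδ, one_smul, conv]
  have hm : AEStronglyMeasurable (fun t => f (x - t) - f x) volume :=
    (hf.aestronglyMeasurable.comp_measurePreserving
      (Measure.measurePreserving_sub_left volume x)).sub aestronglyMeasurable_const
  have hmol : AEMeasurable (fun t : Cn d => ENNReal.ofReal (mol δ t)) :=
    (mol_contDiff δ).continuous.measurable.ennreal_ofReal.aemeasurable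
  have h2 : ‖conv δ f x - f x‖ₑ ≤ ∫⁻ t, ENNReal.ofReal (mol δ t) ^ (1 / 2 : ℝ) *
      (ENNReal.ofReal (mol δ t) ^ (1 / 2 : ℝ) * ‖f (x - t) - f x‖ₑ) := by
    rw [h1]
    refine (enorm_integral_le_lintegral_enorm _).trans_eq (lintegral_congr fun t => ?_)
    rw [enorm_smul, ← mul_assoc, ← ENNReal.rpow_add_of_nonneg _ _ (by norm_num) (by norm_num),
      Real.enorm_of_nonneg (mol_nonneg hδ t)]
    norm_num
  have h3 := ENNReal.lintegral_mul_le_Lp_mul_Lq volume Real.HolderConjugate.two_two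
    (hmol.pow_const (1 / 2 : ℝ)) ((hmol.pow_const (1 / 2 : ℝ)).mul hm.enorm)
  have h4 : ∀ t : Cn d, (ENNReal.ofReal (mol δ t) ^ (1 / 2 : ℝ)) ^ (2 : ℝ) =
      ENNReal.ofReal (mol δ t) := fun t => by
    rw [← ENNReal.rpow_mul]; norm_num
  simp only [Pi.mul_apply, h4, lintegral_mol hδ, ENNReal.one_rpow, one_mul,
    ENNReal.mul_rpow_of_nonneg _ _ (zero_le_two (α := ℝ))] at h3
  calc ‖conv δ f x - f x‖ₑ ^ (2 : ℝ) ≤ _ := ENNReal.rpow_le_rpow (h2.trans h3) zero_le_two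
    _ = _ := by rw [← ENNReal.rpow_mul]; norm_num

/-- Regularizations of a square integrable function converge in `L²`. -/
theorem tendsto_eLpNorm_conv_sub {f : Cn d → ℂ} (hf : MemLp f 2) :
    Tendsto (fun δ : ℝ => eLpNorm (fun x => conv δ f x - f x) 2 volume) (𝓝[>] 0) (𝓝 0) := by
  have hloc := locallyIntegrable_of_memLp hf
  rw [ENNReal.tendsto_nhds_zero]
  intro ε hε
  have h1 := (ENNReal.tendsto_nhds_zero.1 (tendsto_eLpNorm_translate hf)) ε hε
  obtain ⟨r, hr, hr'⟩ := Metric.eventually_nhds_iff.1 h1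
  filter_upwards [Ioo_mem_nhdsGT hr] with δ hδ
  have hδ0 := hδ.1
  have hpow : ∀ g : Cn d → ℂ, eLpNorm g 2 volume ^ (2 : ℝ) = ∫⁻ x, ‖g x‖ₑ ^ (2 : ℝ) := fun g => by
    have := eLpNorm_nnreal_pow_eq_lintegral (f := g) (μ := volume) (p := 2) two_ne_zero
    simpa using this
  rw [← ENNReal.rpow_le_rpow_iff (z := 2) two_pos, hpow]
  calc ∫⁻ x, ‖conv δ f x - f x‖ₑ ^ (2 : ℝ)
      ≤ ∫⁻ x, ∫⁻ t, ENNReal.ofReal (mol δ t) * ‖f (x - t) - f x‖ₑ ^ (2 : ℝ) :=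
        lintegral_mono fun x => enorm_conv_sub_sq_le hδ0 hloc x
    _ = ∫⁻ t, ∫⁻ x, ENNReal.ofReal (mol δ t) * ‖f (x - t) - f x‖ₑ ^ (2 : ℝ) := by
        apply lintegral_lintegral_swap
        have m1 : AEStronglyMeasurable (fun p : Cn d × Cn d => f (p.1 - p.2))
            (volume.prod volume) :=
          hf.1.comp_quasiMeasurePreserving (quasiMeasurePreserving_sub_of_right_invariant _ _)
        have m2 : AEStronglyMeasurable (fun p : Cn d × Cn d => f p.1) (volume.prod volume) :=
          hf.1.comp_fst
        have m3 : AEMeasurable (fun p : Cn d × Cn d => ENNReal.ofReal (mol δ p.2))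
            (volume.prod volume) :=
          (((mol_contDiff δ).continuous.measurable.comp measurable_snd).ennreal_ofReal).aemeasurable
        exact m3.mul ((m1.sub m2).enorm.pow_const _)
    _ = ∫⁻ t, ENNReal.ofReal (mol δ t) * eLpNorm (fun x => f (x - t) - f x) 2 volume ^ (2 : ℝ) := by
        refine lintegral_congr fun t => ?_
        rw [lintegral_const_mul' _ _ ENNReal.ofReal_ne_top, hpow]
    _ ≤ ∫⁻ t : Cn d, ENNReal.ofReal (mol δ t) * ε ^ (2 : ℝ) := by
        refine lintegral_mono fun t => ?_
        by_cases ht : ‖t‖ < r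
        · gcongr
          exact hr' (by simpa using ht)
        · rw [mol_eq_zero hδ0 (hδ.2.le.trans (not_lt.1 ht))]
          simp
    _ = ε ^ (2 : ℝ) := by
        rw [lintegral_mul_const _ ((mol_contDiff δ).continuous.measurable.ennreal_ofReal),
          lintegral_mol hδ0, one_mul]

lemma fderiv_conv {δ : ℝ} (hδ : 0 < δ) {f : Cn d → ℂ} (hf : LocallyIntegrable f) (x v : Cn d) :
    fderiv ℝ (conv δ f) x v = ∫ t, fderiv ℝ (mol δ) (x - t) v • f t := by
  have h1 := (mol_hasCompactSupport hδ).hasFDerivAt_convolution_left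
    (ContinuousLinearMap.lsmul ℝ ℝ) ((mol_contDiff δ).of_le (by simp)) hf x
  rw [conv_eq_convolution, h1.fderiv]
  have hc : HasCompactSupport (fderiv ℝ (mol δ : Cn d → ℝ)) := (mol_hasCompactSupport hδ).fderiv ℝ
  have h2 := hc.convolutionExists_left ((ContinuousLinearMap.lsmul ℝ ℝ : ℝ →L[ℝ] ℂ →L[ℝ] ℂ).precompL (Cn d))
    ((mol_contDiff δ).fderiv_right (m := ∞) (by simp)).continuous hf x
  rw [convolution_def, ContinuousLinearMap.integral_apply h2, ← integral_sub_left_eq_self _ volume x]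
  simp

/-- The translated reflected mollifier as a complex test function. -/
def molAt (δ : ℝ) (x : Cn d) (t : Cn d) : ℂ := (mol δ (x - t) : ℝ)

lemma contDiff_molAt (δ : ℝ) (x : Cn d) : ContDiff ℝ ∞ (molAt δ x) :=
  contDiff_ofReal_comp ((mol_contDiff δ).comp (contDiff_const.sub contDiff_id))

lemma tsupport_molAt {δ : ℝ} (hδ : 0 < δ) (x : Cn d) : tsupport (molAt δ x) ⊆ closedBall x δ := by
  refine closure_minimal (fun t ht => ?_) isClosed_closedBall
  by_contra hc
  apply ht
  rw [mem_closedBall, dist_comm, dist_eq_norm, not_le] at hc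
  simp [molAt, mol_eq_zero hδ hc.le]

lemma hasCompactSupport_molAt {δ : ℝ} (hδ : 0 < δ) (x : Cn d) : HasCompactSupport (molAt δ x) :=
  (isCompact_closedBall x δ).of_isClosed_subset (isClosed_tsupport _) (tsupport_molAt hδ x)

lemma fderiv_molAt (δ : ℝ) (x t v : Cn d) :
    fderiv ℝ (molAt δ x) t v = -((fderiv ℝ (mol δ) (x - t) v : ℝ) : ℂ) := by
  have hd : Differentiable ℝ (mol δ : Cn d → ℝ) := (mol_contDiff δ).differentiable (by simp)
  have h1 : HasFDerivAt (fun t => mol δ (x - t))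
      ((fderiv ℝ (mol δ) (x - t)).comp (-ContinuousLinearMap.id ℝ (Cn d))) t :=
    (hd (x - t)).hasFDerivAt.comp t ((hasFDerivAt_id t).const_sub x)
  change fderiv ℝ (fun t => ((mol δ (x - t) : ℝ) : ℂ)) t v = _
  rw [fderiv_ofReal_comp h1.differentiableAt, h1.fderiv]
  simp

lemma integrable_fderiv_mol_smul {δ : ℝ} (hδ : 0 < δ) {f : Cn d → ℂ} (hf : LocallyIntegrable f)
    (x v : Cn d) : Integrable (fun t => f t * fderiv ℝ (molAt δ x) t v) := by
  have := hf.integrable_smul_left_of_hasCompactSupport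
    ((contDiff_molAt δ x).fderiv_right (m := ∞) (by simp) |>.continuous.clm_apply
      (continuous_const (y := v))) ((hasCompactSupport_molAt hδ x).fderiv_apply ℝ v)
  simpa [mul_comm] using this

lemma fderiv_conv' {δ : ℝ} (hδ : 0 < δ) {f : Cn d → ℂ} (hf : LocallyIntegrable f) (x v : Cn d) :
    fderiv ℝ (conv δ f) x v = -∫ t, f t * fderiv ℝ (molAt δ x) t v := by
  rw [fderiv_conv hδ hf, ← integral_neg]
  congr 1; ext t
  rw [fderiv_molAt]
  simp [mul_comm]

lemma dbar_conv {δ : ℝ} (hδ : 0 < δ) {f : Cn d → ℂ} (hf : LocallyIntegrable f) (j : Fin d)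
    (x : Cn d) : dbar j (conv δ f) x = -∫ t, f t * dbar j (molAt δ x) t := by
  have e : ∀ t, f t * dbar j (molAt δ x) t = (1 / 2) * (f t * fderiv ℝ (molAt δ x) t (ee j)) +
      (I / 2) * (f t * fderiv ℝ (molAt δ x) t (I • ee j)) := fun t => by simp only [dbar]; ring
  simp_rw [e]
  rw [integral_add ((integrable_fderiv_mol_smul hδ hf x _).const_mul _)
    ((integrable_fderiv_mol_smul hδ hf x _).const_mul _), integral_const_mul, integral_const_mul,
    dbar, fderiv_conv' hδ hf, fderiv_conv' hδ hf]
  ring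

lemma del_conv {δ : ℝ} (hδ : 0 < δ) {f : Cn d → ℂ} (hf : LocallyIntegrable f) (j : Fin d)
    (x : Cn d) : del j (conv δ f) x = -∫ t, f t * del j (molAt δ x) t := by
  have e : ∀ t, f t * del j (molAt δ x) t = (1 / 2) * (f t * fderiv ℝ (molAt δ x) t (ee j)) -
      (I / 2) * (f t * fderiv ℝ (molAt δ x) t (I • ee j)) := fun t => by simp only [del]; ring
  simp_rw [e]
  rw [integral_sub ((integrable_fderiv_mol_smul hδ hf x _).const_mul _)
    ((integrable_fderiv_mol_smul hδ hf x _).const_mul _), integral_const_mul, integral_const_mul,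
    del, fderiv_conv' hδ hf, fderiv_conv' hδ hf]
  ring

lemma conv_eq_integral_molAt (δ : ℝ) (f : Cn d → ℂ) (x : Cn d) :
    conv δ f x = ∫ t, f t * molAt δ x t := by
  rw [conv_eq_swap]
  congr 1; ext t
  simp [molAt, mul_comm]

end Mollification

end SCV

namespace SCV

open MeasureTheory Filter Topology
open scoped ContDiff ENNReal NNReal Convolution ComplexConjugate

section CauchyRiemann

variable {d : ℕ}

lemma differentiableAt_of_dbar_eq_zero {f : Cn d → ℂ} {x : Cn d} (hf : DifferentiableAt ℝ f x)
    (h : ∀ j, dbar j f x = 0) : DifferentiableAt ℂ f x := by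
  set L := fderiv ℝ f x with hL
  have h1 : ∀ j, L (I • ee j) = I * L (ee j) := by
    intro j
    have := h j
    rw [dbar, mul_eq_zero] at this
    have h2 := this.resolve_left (by norm_num)
    linear_combination (-I) * h2 + (L (I • ee j)) * I_mul_I
  have h2 : ∀ v, L (I • v) = I * L v := by
    intro v
    have e : ∀ (c : ℂ) j, L (I • c • ee j) = I * L (c • ee j) := by
      intro c j
      have e1 : c • ee j = c.re • ee j + c.im • (I • ee j) := by
        conv_lhs => rw [← re_add_im c]
        rw [add_smul, mul_smul, coe_smul, coe_smul]
      have e2 : I • c • ee j = c.re • (I • ee j) - c.im • ee j := by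
        rw [e1, smul_add, smul_comm I c.re, smul_comm I c.im, smul_smul I I, I_mul_I]
        simp [sub_eq_add_neg]
      rw [e2, e1]
      simp only [map_add, map_sub, map_smul, h1, real_smul]
      linear_combination (-(c.im : ℂ) * L (ee j)) * I_mul_I
    rw [sum_smul_ee v, Finset.smul_sum, map_sum, map_sum, Finset.mul_sum]
    exact Finset.sum_congr rfl fun j _ => e _ _
  let L' : Cn d →L[ℂ] ℂ :=
    { toFun := L
      map_add' := L.map_add
      map_smul' := fun c v => by
        have e1 : c • v = c.re • v + c.im • (I • v) := by
          conv_lhs => rw [← re_add_im c]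
          rw [add_smul, mul_smul, coe_smul, coe_smul]
        rw [e1, map_add, map_smul, map_smul, h2]
        conv_rhs => rw [RingHom.id_apply, ← re_add_im c]
        simp only [real_smul, smul_eq_mul]
        ring
      cont := L.continuous }
  exact (hasFDerivAt_of_restrictScalars ℝ hf.hasFDerivAt (f' := L') rfl).differentiableAt

lemma dbar_eq_zero_of_differentiableAt {f : Cn d → ℂ} {x : Cn d} (hf : DifferentiableAt ℂ f x)
    (j : Fin d) : dbar j f x = 0 := by
  have h : fderiv ℝ f x = (fderiv ℂ f x).restrictScalars ℝ :=
    (hf.hasFDerivAt.restrictScalars ℝ).fderiv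
  simp only [dbar, h, ContinuousLinearMap.coe_restrictScalars', map_smul, smul_eq_mul]
  linear_combination (1 / 2 * fderiv ℂ f x (ee j)) * I_mul_I

end CauchyRiemann

section Weyl

variable {d : ℕ}

lemma conv_comm {δ δ' : ℝ} (hδ : 0 < δ) (hδ' : 0 < δ') {v : Cn d → ℂ} (hv : Integrable v)
    (x : Cn d) : conv δ' (conv δ v) x = conv δ (conv δ' v) x := by
  have hI : Integrable (fun p : Cn d × Cn d => mol δ' p.1 • (mol δ p.2 • v (x - p.1 - p.2)))
      (volume.prod volume) := by
    have h1 := (mol_integrable (d := d) hδ).convolution_integrand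
      (ContinuousLinearMap.lsmul ℝ ℝ) hv
    have h2 : MeasurePreserving (fun p : Cn d × Cn d => (x - p.1, p.2))
        (volume.prod volume) (volume.prod volume) :=
      (Measure.measurePreserving_sub_left volume x).prod (MeasurePreserving.id volume)
    have h3 := (h2.integrable_comp h1.aestronglyMeasurable).2 h1
    obtain ⟨C, hC⟩ := (mol_contDiff (d := d) δ').continuous.bounded_above_of_compact_support
      (mol_hasCompactSupport hδ')
    exact h3.bdd_smul C ((mol_contDiff δ').continuous.comp continuous_fst).aestronglyMeasurable
      (Eventually.of_forall fun p => hC p.1)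
  have e1 : conv δ' (conv δ v) x = ∫ t, ∫ s, mol δ' t • (mol δ s • v (x - t - s)) := by
    simp only [conv, integral_smul]
  have e2 : conv δ (conv δ' v) x = ∫ s, ∫ t, mol δ' t • (mol δ s • v (x - t - s)) := by
    simp only [conv, ← integral_smul]
    congr 1; ext s; congr 1; ext t
    rw [smul_comm, sub_right_comm]
  rw [e1, e2, integral_integral_swap hI]

lemma weyl_local {x₀ : Cn d} {R : ℝ} (hR : 0 < R) {v : Cn d → ℂ} (hv : Integrable v)
    (hv2 : MemLp v 2)
    (hw : ∀ θ : Cn d → ℂ, ContDiff ℝ ∞ θ → HasCompactSupport θ → tsupport θ ⊆ ball x₀ R →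
      ∀ j, ∫ x, v x * dbar j θ x = 0) :
    ∃ F : Cn d → ℂ, DifferentiableOn ℂ F (ball x₀ (R / 2)) ∧
      ∀ᵐ x ∂(volume.restrict (ball x₀ (R / 2))), v x = F x := by
  have hloc := hv.locallyIntegrable
  have hhol : ∀ δ, 0 < δ → DifferentiableOn ℂ (conv δ v) (ball x₀ (R - δ)) := by
    intro δ hδ x hx
    apply DifferentiableAt.differentiableWithinAt
    refine differentiableAt_of_dbar_eq_zero
      ((contDiff_conv hδ hloc).differentiable (by simp) x) fun j => ?_
    rw [dbar_conv hδ hloc, hw _ (contDiff_molAt δ x) (hasCompactSupport_molAt hδ x), neg_zero]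
    refine (tsupport_molAt hδ x).trans (closedBall_subset_ball' ?_)
    rw [mem_ball] at hx; linarith
  have hmv : ∀ δ δ', 0 < δ → 0 < δ' → δ < R / 4 → δ' < R / 4 → ∀ x ∈ ball x₀ (R / 2),
      conv δ' (conv δ v) x = conv δ v x := by
    intro δ δ' hδ hδ' h1 h2 x hx
    refine mol_meanValue isOpen_ball (hhol δ hδ) hδ' (closedBall_subset_ball' ?_)
    rw [mem_ball] at hx; linarith
  have heq : ∀ δ δ', 0 < δ → 0 < δ' → δ < R / 4 → δ' < R / 4 → ∀ x ∈ ball x₀ (R / 2),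
      conv δ v x = conv δ' v x := by
    intro δ δ' hδ hδ' h1 h2 x hx
    rw [← hmv δ δ' hδ hδ' h1 h2 x hx, conv_comm hδ hδ' hv, hmv δ' δ hδ' hδ h2 h1 x hx]
  set δ₀ := R / 8 with hδ₀
  have hδ₀p : 0 < δ₀ := by positivity
  refine ⟨conv δ₀ v, (hhol δ₀ hδ₀p).mono (ball_subset_ball (by rw [hδ₀]; linarith)), ?_⟩
  have hlim : eLpNorm (fun x => conv δ₀ v x - v x) 2 (volume.restrict (ball x₀ (R / 2))) ≤ 0 := by
    refine ge_of_tendsto (tendsto_eLpNorm_conv_sub hv2) ?_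
    filter_upwards [Ioo_mem_nhdsGT (show (0 : ℝ) < R / 4 by positivity)] with δ hδ
    calc _ = eLpNorm (fun x => conv δ v x - v x) 2 (volume.restrict (ball x₀ (R / 2))) := by
          apply eLpNorm_congr_ae
          filter_upwards [ae_restrict_mem measurableSet_ball] with x hx
          rw [heq δ₀ δ hδ₀p hδ.1 (by rw [hδ₀]; linarith) hδ.2 x hx]
      _ ≤ _ := eLpNorm_restrict_le _ _ _ _
  have hm : AEStronglyMeasurable (fun x => conv δ₀ v x - v x)
      (volume.restrict (ball x₀ (R / 2))) :=
    ((contDiff_conv hδ₀p hloc).continuous.aestronglyMeasurable.sub hv.1).restrict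
  rw [nonpos_iff_eq_zero, eLpNorm_eq_zero_iff hm two_ne_zero] at hlim
  filter_upwards [hlim] with x hx
  exact (sub_eq_zero.1 hx).symm

/-- Weyl's lemma for the Cauchy–Riemann equations. -/
theorem exists_holomorphic_ae_eq {D : Set (Cn d)} (hD : IsOpen D) {v : Cn d → ℂ}
    (hv : ∀ K ⊆ D, IsCompact K → MemLp v 2 (volume.restrict K))
    (hw : ∀ θ : Cn d → ℂ, ContDiff ℝ ∞ θ → HasCompactSupport θ → tsupport θ ⊆ D →
      ∀ j, ∫ x, v x * dbar j θ x = 0) :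
    ∃ F : Cn d → ℂ, DifferentiableOn ℂ F D ∧ ∀ᵐ x ∂(volume.restrict D), v x = F x := by
  have hlocal : ∀ x₀ : Cn d, ∃ (r : ℝ) (F : Cn d → ℂ), x₀ ∈ D → (0 < r ∧ ball x₀ r ⊆ D ∧
      DifferentiableOn ℂ F (ball x₀ r) ∧ ∀ᵐ x ∂(volume.restrict (ball x₀ r)), v x = F x) := by
    intro x₀
    by_cases hx₀ : x₀ ∈ D
    swap
    · exact ⟨0, 0, fun h => absurd h hx₀⟩
    obtain ⟨R, hR, hRD⟩ := nhds_basis_closedBall.mem_iff.1 (hD.mem_nhds hx₀)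
    set B := closedBall x₀ R
    have hBm : MeasurableSet B := measurableSet_closedBall
    have h2 : MemLp v 2 (volume.restrict B) := hv B hRD (isCompact_closedBall _ _)
    have : IsFiniteMeasure (volume.restrict B) :=
      ⟨by simpa using (isCompact_closedBall x₀ R).measure_lt_top⟩
    have h1 : Integrable v (volume.restrict B) := h2.integrable (by norm_num)
    obtain ⟨F, hF, hFv⟩ := weyl_local (v := B.indicator v) (x₀ := x₀) hR
      ((integrable_indicator_iff hBm).2 h1) ((memLp_indicator_iff_restrict hBm).2 h2) (by
        intro θ h3 h4 h5 j
        rw [← hw θ h3 h4 (h5.trans (ball_subset_closedBall.trans hRD)) j]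
        congr 1; ext x
        by_cases hx : x ∈ B
        · rw [indicator_of_mem hx]
        · have : dbar j θ x = 0 := image_eq_zero_of_notMem_tsupport fun h =>
            hx (ball_subset_closedBall (h5 (tsupport_dbar_subset _ _ h)))
          rw [this]; simp)
    refine ⟨R / 2, F, fun _ => ⟨by positivity, ?_, hF, ?_⟩⟩
    · exact (ball_subset_ball (by linarith)).trans (ball_subset_closedBall.trans hRD)
    · filter_upwards [hFv, ae_restrict_mem measurableSet_ball] with x hx hxb
      rw [← hx, indicator_of_mem]
      exact ball_subset_closedBall (ball_subset_ball (by linarith) hxb)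
  choose r F hrF using hlocal
  have hglue : ∀ x₀ ∈ D, ∀ y ∈ ball x₀ (r x₀), F y y = F x₀ y := by
    intro x₀ hx₀ y hy
    obtain ⟨-, h2, h3, h4⟩ := hrF x₀ hx₀
    obtain ⟨k1, -, k3, k4⟩ := hrF y (h2 hy)
    set O := ball y (r y) ∩ ball x₀ (r x₀)
    have hO : IsOpen O := isOpen_ball.inter isOpen_ball
    have hae : F y =ᵐ[volume.restrict O] F x₀ := by
      filter_upwards [ae_restrict_of_ae_restrict_of_subset inter_subset_left k4,
        ae_restrict_of_ae_restrict_of_subset inter_subset_right h4] with x e1 e2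
      rw [← e1, e2]
    exact Measure.eqOn_open_of_ae_eq hae hO (k3.continuousOn.mono inter_subset_left)
      (h3.continuousOn.mono inter_subset_right) ⟨mem_ball_self k1, hy⟩
  refine ⟨fun x => F x x, fun x hx => ?_, ?_⟩
  · obtain ⟨h1, -, h3, -⟩ := hrF x hx
    have hd : DifferentiableAt ℂ (F x) x := h3.differentiableAt (ball_mem_nhds x h1)
    refine (hd.congr_of_eventuallyEq ?_).differentiableWithinAt
    filter_upwards [ball_mem_nhds x h1] with y hy using hglue x hx y hy
  · rw [ae_restrict_iff' hD.measurableSet, ae_iff]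
    refine measure_null_of_locally_null _ fun x hx => ?_
    have hxD : x ∈ D := by
      by_contra h
      exact hx fun h' => absurd h' h
    obtain ⟨h1, -, -, h4⟩ := hrF x hxD
    rw [ae_restrict_iff' measurableSet_ball, ae_iff] at h4
    refine ⟨{a | ¬(a ∈ ball x (r x) → v a = F x a)} ∪ {a | ¬(a ∈ D → v a = F a a)} ∩ (ball x (r x)), ?_, ?_⟩
    · refine mem_of_superset (inter_mem_nhdsWithin _ (ball_mem_nhds x h1)) subset_union_right
    · refine measure_mono_null (union_subset subset_rfl ?_) h4
      rintro a ⟨ha, hab⟩ h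
      exact ha fun _ => by rw [h hab, hglue x hxD a hab]

end Weyl

end SCV

namespace SCV

open MeasureTheory Filter Topology
open scoped ContDiff ENNReal NNReal Convolution ComplexConjugate

section L2Limits

variable {d : ℕ}

/-- `F δ → f` in `L²` as `δ → 0⁺`. -/
def L2Tendsto (F : ℝ → Cn d → ℂ) (f : Cn d → ℂ) : Prop :=
  (∀ᶠ δ in 𝓝[>] (0 : ℝ), MemLp (F δ) 2) ∧ MemLp f 2 ∧
    Tendsto (fun δ => eLpNorm (fun x => F δ x - f x) 2 volume) (𝓝[>] 0) (𝓝 0)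

lemma L2Tendsto.add {F G : ℝ → Cn d → ℂ} {f g : Cn d → ℂ} (hF : L2Tendsto F f)
    (hG : L2Tendsto G g) : L2Tendsto (fun δ x => F δ x + G δ x) (fun x => f x + g x) := by
  refine ⟨?_, hF.2.1.add hG.2.1, ?_⟩
  · filter_upwards [hF.1, hG.1] with δ h1 h2 using h1.add h2
  · have h := hF.2.2.add hG.2.2
    rw [add_zero] at h
    refine tendsto_of_tendsto_of_tendsto_of_le_of_le' tendsto_const_nhds h
      (Eventually.of_forall fun _ => zero_le) ?_
    filter_upwards [hF.1, hG.1] with δ h1 h2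
    have e : (fun x => F δ x + G δ x - (f x + g x)) =
        (fun x => F δ x - f x) + (fun x => G δ x - g x) := by ext x; simp; ring
    rw [e]
    exact eLpNorm_add_le (h1.sub hF.2.1).1 (h2.sub hG.2.1).1 (by norm_num)

lemma L2Tendsto.zero : L2Tendsto (fun _ (_ : Cn d) => 0) (fun _ => 0) := by
  refine ⟨Eventually.of_forall fun _ => MemLp.zero, MemLp.zero, ?_⟩
  simp

lemma L2Tendsto.sum {ι : Type*} (s : Finset ι) {F : ι → ℝ → Cn d → ℂ} {f : ι → Cn d → ℂ}
    (h : ∀ i ∈ s, L2Tendsto (F i) (f i)) :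
    L2Tendsto (fun δ x => ∑ i ∈ s, F i δ x) (fun x => ∑ i ∈ s, f i x) := by
  classical
  induction s using Finset.induction_on with
  | empty => simpa using L2Tendsto.zero
  | insert i s hi ih =>
    simp only [Finset.sum_insert hi]
    exact (h i (by simp)).add (ih fun k hk => h k (by simp [hk]))

lemma memLp_bounded_mul {w f : Cn d → ℂ} {C : ℝ} (hw : Continuous w) (hC : ∀ x, ‖w x‖ ≤ C)
    (hf : MemLp f 2) : MemLp (fun x => w x * f x) 2 :=
  MemLp.of_le_mul (c := C) hf (hw.aestronglyMeasurable.mul hf.1) (Eventually.of_forall fun x => by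
    rw [norm_mul]; exact mul_le_mul_of_nonneg_right (hC x) (norm_nonneg _))

lemma L2Tendsto.mul {F : ℝ → Cn d → ℂ} {f w : Cn d → ℂ} (hF : L2Tendsto F f)
    (hw : Continuous w) {C : ℝ} (hC : ∀ x, ‖w x‖ ≤ C) :
    L2Tendsto (fun δ x => w x * F δ x) (fun x => w x * f x) := by
  refine ⟨?_, memLp_bounded_mul hw hC hF.2.1, ?_⟩
  · filter_upwards [hF.1] with δ h1 using memLp_bounded_mul hw hC h1
  · have h := ENNReal.Tendsto.const_mul (a := ENNReal.ofReal C) hF.2.2 (Or.inr ENNReal.ofReal_ne_top)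
    rw [mul_zero] at h
    refine tendsto_of_tendsto_of_tendsto_of_le_of_le tendsto_const_nhds h
      (fun _ => zero_le) (fun δ => ?_)
    refine eLpNorm_le_mul_eLpNorm_of_ae_le_mul (Eventually.of_forall fun x => ?_) 2
    rw [← mul_sub, norm_mul]
    exact mul_le_mul_of_nonneg_right (hC x) (norm_nonneg _)

lemma integral_norm_sq_eq {f : Cn d → ℂ} (hf : MemLp f 2) :
    ∫ x, ‖f x‖ ^ 2 = (eLpNorm f 2 volume).toReal ^ 2 := by
  have h0 : 0 ≤ ∫ x, ‖f x‖ ^ 2 := integral_nonneg fun x => by positivity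
  have := hf.eLpNorm_eq_integral_rpow_norm (by norm_num) (by norm_num)
  rw [this]
  simp only [ENNReal.toReal_ofNat, Real.rpow_two]
  rw [ENNReal.toReal_ofReal (by positivity), inv_eq_one_div, ← Real.sqrt_eq_rpow, Real.sq_sqrt h0]

lemma L2Tendsto.tendsto_integral {F : ℝ → Cn d → ℂ} {f : Cn d → ℂ} (hF : L2Tendsto F f) :
    Tendsto (fun δ => ∫ x, ‖F δ x‖ ^ 2) (𝓝[>] 0) (𝓝 (∫ x, ‖f x‖ ^ 2)) := by
  rw [integral_norm_sq_eq hF.2.1]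
  have h1 : Tendsto (fun δ => (eLpNorm (F δ) 2 volume).toReal) (𝓝[>] 0)
      (𝓝 (eLpNorm f 2 volume).toReal) := by
    rw [tendsto_iff_dist_tendsto_zero]
    have h0 : Tendsto (fun δ => (eLpNorm (fun x => F δ x - f x) 2 volume).toReal) (𝓝[>] 0) (𝓝 0) := by
      exact (ENNReal.tendsto_toReal ENNReal.zero_ne_top).comp hF.2.2
    refine squeeze_zero' (Eventually.of_forall fun _ => dist_nonneg) ?_ h0
    filter_upwards [hF.1] with δ hδ
    have hs := hδ.sub hF.2.1
    rw [← Lp.norm_toLp (F δ) hδ, ← Lp.norm_toLp f hF.2.1]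
    change _ ≤ (eLpNorm (F δ - f) 2 volume).toReal
    rw [← Lp.norm_toLp (F δ - f) hs, Real.dist_eq, MemLp.toLp_sub]
    exact abs_norm_sub_norm_le _ _
  refine Tendsto.congr' ?_ (h1.pow 2)
  filter_upwards [hF.1] with δ hδ
  rw [integral_norm_sq_eq hδ]

lemma L2Tendsto.conv {f : Cn d → ℂ} (hf : MemLp f 2) : L2Tendsto (fun δ => conv δ f) f := by
  have ht := tendsto_eLpNorm_conv_sub hf
  refine ⟨?_, hf, ht⟩
  filter_upwards [ht.eventually (gt_mem_nhds (zero_lt_one (α := ℝ≥0∞))), self_mem_nhdsWithin] with δ h1 h2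
  have h3 : MemLp (fun x => SCV.conv δ f x - f x) 2 :=
    ⟨(contDiff_conv h2 (locallyIntegrable_of_memLp hf)).continuous.aestronglyMeasurable.sub hf.1,
      h1.trans ENNReal.one_lt_top⟩
  have h4 := h3.add hf
  rwa [show (fun x => SCV.conv δ f x - f x) + f = SCV.conv δ f by ext x; simp] at h4

end L2Limits

section WeakApriori

variable {d : ℕ}

/-- Smooth functions with compact support in `D`. -/
structure IsTest (D : Set (Cn d)) (θ : Cn d → ℂ) : Prop where
  contDiff : ContDiff ℝ ∞ θ
  hasCompactSupport : HasCompactSupport θ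
  tsupport_subset : tsupport θ ⊆ D

lemma weak_apriori_of_compactSupport {D K : Set (Cn d)} (hD : IsOpen D) (hK : IsCompact K)
    (hKD : K ⊆ D) {φ ψ : Cn d → ℝ} (hφ : ContDiff ℝ ∞ φ) (hψ : ContDiff ℝ ∞ ψ)
    (hφc : HasCompactSupport φ) (hψc : HasCompactSupport ψ)
    (hL : ∀ x ∈ D, ∀ v, 2 * (∑ j, ‖del j (fun y => (ψ y : ℂ)) x‖ ^ 2 + Real.exp (ψ x)) * ‖v‖ ^ 2
      ≤ levi φ x v)
    {k : Fin d → Cn d → ℂ} {ξ : Cn d → ℂ} {ζ : Fin d → Fin d → Cn d → ℂ}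
    (hk : ∀ j, MemLp (k j) 2) (hkK : ∀ j x, x ∉ K → k j x = 0) (hξ : MemLp ξ 2)
    (hζ : ∀ j l, MemLp (ζ j l) 2)
    (h1 : ∀ θ, IsTest univ θ → ∑ j, ∫ x, k j x * del j θ x = -∫ x, ξ x * θ x)
    (h2 : ∀ θ, IsTest univ θ → ∀ j l, (∫ x, k l x * dbar j θ x) - ∫ x, k j x * dbar l θ x =
      -∫ x, ζ j l x * θ x) :
    2 * ∑ j, ∫ x, ‖(Real.exp ((ψ x - φ x) / 2) : ℂ) * k j x‖ ^ 2 ≤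
      2 * (∫ x, ‖(Real.exp (-φ x / 2) : ℂ) * (ξ x + ∑ j, (del j (fun y => (ψ y : ℂ)) x -
        del j (fun y => (φ y : ℂ)) x) * k j x)‖ ^ 2) +
      1 / 2 * ∑ j, ∑ l, ∫ x, ‖(Real.exp (-φ x / 2) : ℂ) * ζ j l x‖ ^ 2 := by
  set w0 : Cn d → ℂ := fun x => (Real.exp (-φ x / 2) : ℂ) with hw0
  set wE : Cn d → ℂ := fun x => (Real.exp ((ψ x - φ x) / 2) : ℂ) with hwE
  set c : Fin d → Cn d → ℂ := fun j x => del j (fun y => (ψ y : ℂ)) x -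
        del j (fun y => (φ y : ℂ)) x with hc
  have bdd : ∀ u : Cn d → ℝ, Continuous u → HasCompactSupport u →
      ∃ C, ∀ x, ‖(Real.exp (u x) : ℂ)‖ ≤ C := by
    intro u hu huc
    obtain ⟨C, hC⟩ := huc.exists_bound_of_continuous hu
    refine ⟨Real.exp C, fun x => ?_⟩
    rw [Complex.norm_real, Real.norm_of_nonneg (Real.exp_pos _).le]
    exact Real.exp_le_exp.2 ((le_abs_self _).trans (hC x))
  obtain ⟨C0, hC0⟩ := bdd (fun x => -φ x / 2) (by have := hφ.continuous; fun_prop)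
    (hφc.comp_left (g := fun t => -t / 2) (by simp))
  obtain ⟨CE, hCE⟩ := bdd (fun x => (ψ x - φ x) / 2)
    (by have := hφ.continuous; have := hψ.continuous; fun_prop)
    ((hψc.sub hφc).comp_left (g := fun t => t / 2) (by simp))
  have w0c : Continuous w0 := by have := hφ.continuous; fun_prop
  have wEc : Continuous wE := by have := hφ.continuous; have := hψ.continuous; fun_prop
  have cφ := contDiff_ofReal_comp hφ
  have cψ := contDiff_ofReal_comp hψ
  have cφc : HasCompactSupport (fun y => (φ y : ℂ)) := hφc.comp_left (g := fun t : ℝ => (t : ℂ)) (by simp)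
  have cψc : HasCompactSupport (fun y => (ψ y : ℂ)) := hψc.comp_left (g := fun t : ℝ => (t : ℂ)) (by simp)
  have cc : ∀ j, Continuous (c j) := fun j =>
    (contDiff_del cψ j).continuous.sub (contDiff_del cφ j).continuous
  have cb : ∀ j, ∃ C, ∀ x, ‖c j x‖ ≤ C := fun j =>
    HasCompactSupport.exists_bound_of_continuous
      ((hasCompactSupport_del cψc j).sub (hasCompactSupport_del cφc j)) (cc j)
  choose Cc hCc using cb
  have T1 : L2Tendsto (fun δ x => w0 x * (conv δ ξ x + ∑ j, c j x * conv δ (k j) x))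
      (fun x => w0 x * (ξ x + ∑ j, c j x * k j x)) :=
    ((L2Tendsto.conv hξ).add (L2Tendsto.sum _ fun j _ =>
      (L2Tendsto.conv (hk j)).mul (cc j) (hCc j))).mul w0c hC0
  have T2 : ∀ j l, L2Tendsto (fun δ x => w0 x * conv δ (ζ j l) x) (fun x => w0 x * ζ j l x) :=
    fun j l => (L2Tendsto.conv (hζ j l)).mul w0c hC0
  have T3 : ∀ j, L2Tendsto (fun δ x => wE x * conv δ (k j) x) (fun x => wE x * k j x) :=
    fun j => (L2Tendsto.conv (hk j)).mul wEc hCE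
  have lim := ((T1.tendsto_integral.const_mul 2).add
    ((tendsto_finsetSum Finset.univ fun j _ => tendsto_finsetSum Finset.univ fun l _ =>
      (T2 j l).tendsto_integral).const_mul (1 / 2))).sub
    ((tendsto_finsetSum Finset.univ fun j _ => (T3 j).tendsto_integral).const_mul 2)
  rw [← sub_nonneg]
  refine ge_of_tendsto lim ?_
  obtain ⟨r, hr, hrD⟩ := hK.exists_cthickening_subset_open hD hKD
  have E2 : ∀ᶠ δ in 𝓝[>] (0 : ℝ), ∀ j l, MemLp (fun x => w0 x * conv δ (ζ j l) x) 2 := by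
    simp only [eventually_all]; exact fun j l => (T2 j l).1
  have E3 : ∀ᶠ δ in 𝓝[>] (0 : ℝ), ∀ j, MemLp (fun x => wE x * conv δ (k j) x) 2 := by
    simp only [eventually_all]; exact fun j => (T3 j).1
  filter_upwards [T1.1, E2, E3, self_mem_nhdsWithin, Ioo_mem_nhdsGT hr] with δ m1 m2 m3 hδ hδr
  have hδ : 0 < δ := hδ
  have lk := fun j => locallyIntegrable_of_memLp (hk j)
  have supp : ∀ j, tsupport (conv δ (k j)) ⊆ cthickening r K := by
    intro j
    refine closure_minimal (fun x hx => ?_) isClosed_cthickening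
    by_contra hxc
    apply hx
    refine conv_eq_zero hδ fun y hy => hkK j y fun hyK => hxc ?_
    exact mem_cthickening_of_dist_le x y r K hyK ((mem_ball'.1 hy).le.trans hδr.2.le)
  have tm : ∀ x : Cn d, IsTest univ (molAt δ x) := fun x =>
    ⟨contDiff_molAt δ x, hasCompactSupport_molAt hδ x, subset_univ _⟩
  have e1 : ∀ x, ∑ j, (wdel φ j (conv δ (k j)) x + conv δ (k j) x * del j (fun y => (ψ y : ℂ)) x) =
      conv δ ξ x + ∑ j, c j x * conv δ (k j) x := by
    intro x
    have := h1 _ (tm x)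
    have e : conv δ ξ x = ∑ j, del j (conv δ (k j)) x := by
      simp_rw [del_conv hδ (lk _)]
      rw [Finset.sum_neg_distrib, this, neg_neg, conv_eq_integral_molAt]
    rw [e, ← Finset.sum_add_distrib]
    refine Finset.sum_congr rfl fun j _ => ?_
    simp only [wdel, hc]; ring
  have e2 : ∀ x j l, dbar j (conv δ (k l)) x - dbar l (conv δ (k j)) x = conv δ (ζ j l) x := by
    intro x j l
    have := h2 _ (tm x) j l
    rw [dbar_conv hδ (lk _), dbar_conv hδ (lk _), conv_eq_integral_molAt]
    linear_combination -this
  have key := integral_apriori_nonneg hD hφ.contDiffOn hL (g := fun j => conv δ (k j))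
    (fun j => contDiff_conv hδ (lk j))
    (fun j => (hK.cthickening (r := r)).of_isClosed_subset (isClosed_tsupport _) (supp j))
    (fun j => (supp j).trans hrD)
  simp_rw [e1, e2] at key
  have n0 : ∀ x, ‖w0 x‖ ^ 2 = Real.exp (-φ x) := fun x => by
    simp only [hw0]
    rw [Complex.norm_real, Real.norm_of_nonneg (Real.exp_pos _).le, ← Real.exp_nat_mul]
    congr 1; push_cast; ring
  have nE : ∀ x, ‖wE x‖ ^ 2 = Real.exp (ψ x) * Real.exp (-φ x) := fun x => by
    simp only [hwE]
    rw [Complex.norm_real, Real.norm_of_nonneg (Real.exp_pos _).le, ← Real.exp_nat_mul, ← Real.exp_add]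
    congr 1; push_cast; ring
  have i1 := (memLp_two_iff_integrable_sq_norm m1.1).1 m1
  have i2 := fun j l => (memLp_two_iff_integrable_sq_norm (m2 j l).1).1 (m2 j l)
  have i3 := fun j => (memLp_two_iff_integrable_sq_norm (m3 j).1).1 (m3 j)
  have i2' : Integrable (fun x => ∑ j, ∑ l, ‖w0 x * conv δ (ζ j l) x‖ ^ 2) :=
    integrable_finsetSum _ fun j _ => integrable_finsetSum _ fun l _ => i2 j l
  have i3' : Integrable (fun x => ∑ j, ‖wE x * conv δ (k j) x‖ ^ 2) :=
    integrable_finsetSum _ fun j _ => i3 j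
  have i12 : Integrable (fun x => 2 * ‖w0 x * (conv δ ξ x + ∑ j, c j x * conv δ (k j) x)‖ ^ 2 +
      1 / 2 * ∑ j, ∑ l, ‖w0 x * conv δ (ζ j l) x‖ ^ 2) := (i1.const_mul 2).add (i2'.const_mul _)
  refine key.trans_eq (Eq.symm ?_)
  rw [show (∑ j, ∑ l, ∫ x, ‖w0 x * conv δ (ζ j l) x‖ ^ 2) =
      ∫ x, ∑ j, ∑ l, ‖w0 x * conv δ (ζ j l) x‖ ^ 2 by
    rw [integral_finsetSum _ fun j _ => integrable_finsetSum _ fun l _ => i2 j l]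
    exact Finset.sum_congr rfl fun j _ => (integral_finsetSum _ fun l _ => i2 j l).symm,
    show (∑ j, ∫ x, ‖wE x * conv δ (k j) x‖ ^ 2) = ∫ x, ∑ j, ‖wE x * conv δ (k j) x‖ ^ 2 from
    (integral_finsetSum _ fun j _ => i3 j).symm, ← integral_const_mul, ← integral_const_mul,
    ← integral_const_mul, ← integral_add (i1.const_mul 2) (i2'.const_mul _),
    ← integral_sub i12 (i3'.const_mul _)]
  congr 1; ext x
  simp only [norm_mul, mul_pow, n0, nE, ← Finset.mul_sum]
  ring

end WeakApriori

end SCV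

namespace SCV

open MeasureTheory Filter Topology
open scoped ContDiff ENNReal NNReal Convolution ComplexConjugate

section WeakCutoff

variable {d : ℕ}

lemma integrable_mul_of_memLp {f w : Cn d → ℂ} (hf : MemLp f 2) (hw : Continuous w)
    (hc : HasCompactSupport w) : Integrable (fun x => w x * f x) := by
  have := (hw.memLp_of_hasCompactSupport hc (p := 2) (μ := volume)).integrable_mul hf
  exact this

lemma memLp_mul_of_hasCompactSupport {f w : Cn d → ℂ} (hf : MemLp f 2) (hw : Continuous w)
    (hc : HasCompactSupport w) : MemLp (fun x => w x * f x) 2 := by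
  obtain ⟨C, hC⟩ := hc.exists_bound_of_continuous hw
  exact memLp_bounded_mul hw hC hf

lemma weak_cutoff_global {D : Set (Cn d)} (hD : IsOpen D)
    {φ ψ : Cn d → ℝ} (hφ : ContDiff ℝ ∞ φ) (hψ : ContDiff ℝ ∞ ψ)
    (hφc : HasCompactSupport φ) (hψc : HasCompactSupport ψ)
    (hL : ∀ x ∈ D, ∀ v, 2 * (∑ j, ‖del j (fun y => (ψ y : ℂ)) x‖ ^ 2 + Real.exp (ψ x)) * ‖v‖ ^ 2
      ≤ levi φ x v)
    {h : Fin d → Cn d → ℂ} {σ : Cn d → ℂ} (hh : ∀ j, MemLp (h j) 2) (hσ : MemLp σ 2)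
    (hN : ∀ θ, IsTest D θ → ∀ j l, ∫ x, (Real.exp ((φ x - ψ x) / 2) : ℂ) * h l x * dbar j θ x =
      ∫ x, (Real.exp ((φ x - ψ x) / 2) : ℂ) * h j x * dbar l θ x)
    (hS : ∀ θ, IsTest D θ → ∑ j, ∫ x, (Real.exp ((φ x - ψ x) / 2) : ℂ) * h j x *
      (del j θ x + θ x * (del j (fun y => (φ y : ℂ)) x - del j (fun y => (ψ y : ℂ)) x)) =
      -∫ x, σ x * θ x)
    {η : Cn d → ℂ} (hη : IsTest D η) :
    2 * ∑ j, ∫ x, ‖η x * h j x‖ ^ 2 ≤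
      2 * (∫ x, ‖(Real.exp (-φ x / 2) : ℂ) * (η x * σ x) +
        (Real.exp (-ψ x / 2) : ℂ) * ∑ j, h j x * del j η x‖ ^ 2) +
      1 / 2 * ∑ j, ∑ l, ∫ x, ‖(Real.exp (-ψ x / 2) : ℂ) *
        (h l x * dbar j η x - h j x * dbar l η x)‖ ^ 2 := by
  set E : Cn d → ℂ := fun x => (Real.exp ((φ x - ψ x) / 2) : ℂ) with hE
  set c : Fin d → Cn d → ℂ := fun j x => del j (fun y => (φ y : ℂ)) x -
    del j (fun y => (ψ y : ℂ)) x with hc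
  have Ec : Continuous E := by have := hφ.continuous; have := hψ.continuous; fun_prop
  have cc : ∀ j, Continuous (c j) := fun j =>
    (contDiff_del (contDiff_ofReal_comp hφ) j).continuous.sub
      (contDiff_del (contDiff_ofReal_comp hψ) j).continuous
  have ηc := hη.contDiff.continuous
  have dη : ∀ j, Continuous (del j η) := fun j => (contDiff_del hη.contDiff j).continuous
  have bη : ∀ j, Continuous (dbar j η) := fun j => (contDiff_dbar hη.contDiff j).continuous
  have sη := hη.hasCompactSupport
  have sdη : ∀ j, HasCompactSupport (del j η) := fun j => hasCompactSupport_del sη j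
  have sbη : ∀ j, HasCompactSupport (dbar j η) := fun j => hasCompactSupport_dbar sη j
  set k : Fin d → Cn d → ℂ := fun j x => (E x * η x) * h j x with hk
  set ξ : Cn d → ℂ := fun x => η x * σ x + ∑ j, (E x * (del j η x + η x * c j x)) * h j x with hξ
  set ζ : Fin d → Fin d → Cn d → ℂ := fun j l x =>
    (E x * dbar j η x) * h l x - (E x * dbar l η x) * h j x with hζ
  have mk : ∀ j, MemLp (k j) 2 := fun j =>
    memLp_mul_of_hasCompactSupport (hh j) (Ec.mul ηc) (sη.mul_left)
  have wc : ∀ j, Continuous (fun x => E x * (del j η x + η x * c j x)) := fun j =>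
    Ec.mul ((dη j).add (ηc.mul (cc j)))
  have ws : ∀ j, HasCompactSupport (fun x => E x * (del j η x + η x * c j x)) := fun j =>
    ((sdη j).add (sη.mul_right)).mul_left
  have mξ : MemLp ξ 2 := (memLp_mul_of_hasCompactSupport hσ ηc sη).add
    (memLp_finsetSum _ fun j _ => memLp_mul_of_hasCompactSupport (hh j) (wc j) (ws j))
  have mζ : ∀ j l, MemLp (ζ j l) 2 := fun j l =>
    (memLp_mul_of_hasCompactSupport (hh l) (Ec.mul (bη j)) (sbη j).mul_left).sub
      (memLp_mul_of_hasCompactSupport (hh j) (Ec.mul (bη l)) (sbη l).mul_left)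
  have tη : ∀ θ, IsTest univ θ → IsTest D (fun x => η x * θ x) := fun θ hθ =>
    ⟨hη.contDiff.mul hθ.contDiff, sη.mul_right,
      (tsupport_mul_subset_left (f := η) (g := θ)).trans hη.tsupport_subset⟩
  have key := weak_apriori_of_compactSupport hD (K := tsupport η) sη hη.tsupport_subset hφ hψ hφc hψc
    hL (k := k) (ξ := ξ) (ζ := ζ) mk
    (fun j x hx => by simp [hk, image_eq_zero_of_notMem_tsupport hx]) mξ mζ ?_ ?_
  · have e1 : ∀ x, (Real.exp (-φ x / 2) : ℂ) * E x = (Real.exp (-ψ x / 2) : ℂ) := fun x => by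
      simp only [hE]
      rw [← ofReal_mul, ← Real.exp_add]; congr 2; ring
    have A1 : ∀ j x, (Real.exp ((ψ x - φ x) / 2) : ℂ) * k j x = η x * h j x := fun j x => by
      simp only [hk, hE]
      rw [← mul_assoc, ← mul_assoc, ← ofReal_mul, ← Real.exp_add]
      simp [← add_div]
    have A2 : ∀ x, (Real.exp (-φ x / 2) : ℂ) * (ξ x + ∑ j, (del j (fun y => (ψ y : ℂ)) x -
        del j (fun y => (φ y : ℂ)) x) * k j x) = (Real.exp (-φ x / 2) : ℂ) * (η x * σ x) +
        (Real.exp (-ψ x / 2) : ℂ) * ∑ j, h j x * del j η x := fun x => by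
      simp only [hξ, hk]
      rw [← e1, add_assoc, ← Finset.sum_add_distrib, mul_add, mul_assoc (Real.exp (-φ x / 2) : ℂ) (E x),
        Finset.mul_sum _ _ (E x)]
      congr 2
      refine Finset.sum_congr rfl fun j _ => ?_
      simp only [hc]; ring
    have A3 : ∀ j l x, (Real.exp (-φ x / 2) : ℂ) * ζ j l x = (Real.exp (-ψ x / 2) : ℂ) *
        (h l x * dbar j η x - h j x * dbar l η x) := fun j l x => by
      simp only [hζ]
      rw [← e1]; ring
    simp_rw [A1, A2, A3] at key
    exact key
  · intro θ hθ
    have hs := hS _ (tη θ hθ)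
    have dθ := fun x => (hθ.contDiff.differentiable (by simp)) x
    have dη' := fun x => (hη.contDiff.differentiable (by simp)) x
    have θc := hθ.contDiff.continuous
    have i1 : ∀ j, Integrable (fun x => k j x * del j θ x) := fun j => by
      have := integrable_mul_of_memLp (mk j) (contDiff_del hθ.contDiff j).continuous
        (hasCompactSupport_del hθ.hasCompactSupport j)
      simpa only [mul_comm] using this
    have i2 : ∀ j, Integrable (fun x => E x * (del j η x + η x * c j x) * h j x * θ x) := fun j => by
      have := integrable_mul_of_memLp
        (memLp_mul_of_hasCompactSupport (hh j) (wc j) (ws j)) θc hθ.hasCompactSupport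
      simpa only [mul_comm] using this
    have i3 : Integrable (fun x => η x * σ x * θ x) := by
      have := integrable_mul_of_memLp
        (memLp_mul_of_hasCompactSupport hσ ηc sη) θc hθ.hasCompactSupport
      simpa only [mul_comm] using this
    have e1 : ∀ j, ∫ x, E x * h j x * (del j (fun x => η x * θ x) x + η x * θ x * c j x) =
        (∫ x, k j x * del j θ x) + ∫ x, E x * (del j η x + η x * c j x) * h j x * θ x := by
      intro j
      rw [← integral_add (i1 j) (i2 j)]
      congr 1; ext x
      rw [del_mul (dη' x) (dθ x)]
      simp only [hk]; ring
    have e2 : ∫ x, ξ x * θ x = (∫ x, η x * σ x * θ x) +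
        ∑ j, ∫ x, E x * (del j η x + η x * c j x) * h j x * θ x := by
      rw [← integral_finsetSum _ fun j _ => i2 j, ← integral_add i3 (integrable_finsetSum _ fun j _ => i2 j)]
      congr 1; ext x
      simp only [hξ, add_mul, Finset.sum_mul]
    rw [Finset.sum_congr rfl fun j _ => e1 j, Finset.sum_add_distrib] at hs
    rw [e2, eq_sub_of_add_eq hs]
    have e3 : ∫ x, σ x * (η x * θ x) = ∫ x, η x * σ x * θ x := by congr 1; ext x; ring
    rw [e3]; ring
  · intro θ hθ j l
    have hs := hN _ (tη θ hθ) j l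
    have dθ := fun x => (hθ.contDiff.differentiable (by simp)) x
    have dη' := fun x => (hη.contDiff.differentiable (by simp)) x
    have θc := hθ.contDiff.continuous
    have i1 : ∀ j l, Integrable (fun x => k l x * dbar j θ x) := fun j l => by
      have := integrable_mul_of_memLp (mk l) (contDiff_dbar hθ.contDiff j).continuous
        (hasCompactSupport_dbar hθ.hasCompactSupport j)
      simpa only [mul_comm] using this
    have i2 : ∀ j l, Integrable (fun x => E x * dbar j η x * h l x * θ x) := fun j l => by
      have := integrable_mul_of_memLp
        (memLp_mul_of_hasCompactSupport (hh l) (Ec.mul (bη j)) (sbη j).mul_left) θc hθ.hasCompactSupport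
      simp only [Pi.mul_apply] at this
      simpa only [mul_comm] using this
    have e1 : ∀ j l, ∫ x, E x * h l x * dbar j (fun x => η x * θ x) x =
        (∫ x, k l x * dbar j θ x) + ∫ x, E x * dbar j η x * h l x * θ x := by
      intro j l
      rw [← integral_add (i1 j l) (i2 j l)]
      congr 1; ext x
      rw [dbar_mul (dη' x) (dθ x)]
      simp only [hk]; ring
    have e2 : ∫ x, ζ j l x * θ x = (∫ x, E x * dbar j η x * h l x * θ x) -
        ∫ x, E x * dbar l η x * h j x * θ x := by
      rw [← integral_sub (i2 j l) (i2 l j)]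
      congr 1; ext x
      simp only [hζ]; ring
    rw [e1, e1] at hs
    rw [e2]
    linear_combination hs

end WeakCutoff

end SCV

namespace SCV

open MeasureTheory Filter Topology
open scoped ContDiff ENNReal NNReal Convolution ComplexConjugate

section WeakEstimate

variable {d : ℕ}

lemma del_congr {f g : Cn d → ℂ} {x : Cn d} (h : f =ᶠ[𝓝 x] g) (j : Fin d) : del j f x = del j g x := by
  simp only [del, h.fderiv_eq]

lemma dbar_congr {f g : Cn d → ℂ} {x : Cn d} (h : f =ᶠ[𝓝 x] g) (j : Fin d) :
    dbar j f x = dbar j g x := by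
  simp only [dbar, h.fderiv_eq]

lemma del_ofReal_congr {f g : Cn d → ℝ} {x : Cn d} (h : f =ᶠ[𝓝 x] g) (j : Fin d) :
    del j (fun y => (f y : ℂ)) x = del j (fun y => (g y : ℂ)) x :=
  del_congr (h.mono fun y hy => by simp only [hy]) j

lemma levi_congr {f g : Cn d → ℝ} {x : Cn d} (h : f =ᶠ[𝓝 x] g) (v : Cn d) :
    levi f x v = levi g x v := by
  have h' : ∀ w, (fun y => fderiv ℝ f y w) =ᶠ[𝓝 x] (fun y => fderiv ℝ g y w) := fun w => by
    filter_upwards [h.fderiv (𝕜 := ℝ)] with y hy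
    rw [hy]
  simp only [levi, (h' _).fderiv_eq]

lemma del_eq_zero_of_notMem {θ : Cn d → ℂ} {x : Cn d} (hx : x ∉ tsupport θ) (j : Fin d) :
    del j θ x = 0 :=
  image_eq_zero_of_notMem_tsupport fun h => hx (tsupport_del_subset θ j h)

lemma dbar_eq_zero_of_notMem {θ : Cn d → ℂ} {x : Cn d} (hx : x ∉ tsupport θ) (j : Fin d) :
    dbar j θ x = 0 :=
  image_eq_zero_of_notMem_tsupport fun h => hx (tsupport_dbar_subset θ j h)

lemma IsTest.mono {D D' : Set (Cn d)} {θ : Cn d → ℂ} (h : IsTest D' θ) (hD : D' ⊆ D) : IsTest D θ :=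
  ⟨h.1, h.2, h.3.trans hD⟩

/-- The data of a weakly `∂̄`-closed form `e^{(φ-ψ)/2} h` whose formal adjoint image is `σ`. -/
structure WeakPair (D : Set (Cn d)) (φ ψ : Cn d → ℝ) (h : Fin d → Cn d → ℂ) (σ : Cn d → ℂ) :
    Prop where
  memLp : ∀ j, MemLp (h j) 2
  closed : ∀ θ, IsTest D θ → ∀ j l, ∫ x, (Real.exp ((φ x - ψ x) / 2) : ℂ) * h l x * dbar j θ x =
      ∫ x, (Real.exp ((φ x - ψ x) / 2) : ℂ) * h j x * dbar l θ x
  adjoint : ∀ θ, IsTest D θ → ∑ j, ∫ x, (Real.exp ((φ x - ψ x) / 2) : ℂ) * h j x *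
      (del j θ x + θ x * (del j (fun y => (φ y : ℂ)) x - del j (fun y => (ψ y : ℂ)) x)) =
      -∫ x, σ x * θ x

lemma weak_cutoff {D : Set (Cn d)} (hD : IsOpen D)
    {φ ψ : Cn d → ℝ} (hφ : ContDiffOn ℝ ∞ φ D) (hψ : ContDiffOn ℝ ∞ ψ D)
    (hL : ∀ x ∈ D, ∀ v, 2 * (∑ j, ‖del j (fun y => (ψ y : ℂ)) x‖ ^ 2 + Real.exp (ψ x)) * ‖v‖ ^ 2
      ≤ levi φ x v)
    {h : Fin d → Cn d → ℂ} {σ : Cn d → ℂ} (hσ : MemLp σ 2) (hw : WeakPair D φ ψ h σ)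
    {η : Cn d → ℂ} (hη : IsTest D η) :
    2 * ∑ j, ∫ x, ‖η x * h j x‖ ^ 2 ≤
      2 * (∫ x, ‖(Real.exp (-φ x / 2) : ℂ) * (η x * σ x) +
        (Real.exp (-ψ x / 2) : ℂ) * ∑ j, h j x * del j η x‖ ^ 2) +
      1 / 2 * ∑ j, ∑ l, ∫ x, ‖(Real.exp (-ψ x / 2) : ℂ) *
        (h l x * dbar j η x - h j x * dbar l η x)‖ ^ 2 := by
  obtain ⟨K, hK, hηK, hKD⟩ := exists_compact_between hη.hasCompactSupport hD hη.tsupport_subset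
  obtain ⟨φ', hφ', hφc, hφφ⟩ := exists_contDiff_eq_near hD hK hKD hφ
  obtain ⟨ψ', hψ', hψc, hψψ⟩ := exists_contDiff_eq_near hD hK hKD hψ
  have iK : interior K ⊆ K := interior_subset
  have key := weak_cutoff_global (D := interior K) isOpen_interior hφ' hψ' hφc hψc
    (fun x hx v => by
      rw [levi_congr (hφφ x (iK hx)), (hψψ x (iK hx)).eq_of_nhds]
      simp_rw [del_ofReal_congr (hψψ x (iK hx))]
      exact hL x (hKD (iK hx)) v) hw.memLp hσ (h := h)
    (fun θ hθ j l => by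
      have e : ∀ (l j : Fin d) (x : Cn d), (Real.exp ((φ' x - ψ' x) / 2) : ℂ) * h l x * dbar j θ x =
          (Real.exp ((φ x - ψ x) / 2) : ℂ) * h l x * dbar j θ x := fun l j x => by
        by_cases hx : x ∈ tsupport θ
        · have hx' := iK (hθ.tsupport_subset hx)
          rw [(hφφ x hx').eq_of_nhds, (hψψ x hx').eq_of_nhds]
        · rw [dbar_eq_zero_of_notMem hx, mul_zero, mul_zero]
      simp_rw [e]
      exact hw.closed θ (hθ.mono (iK.trans hKD)) j l)
    (fun θ hθ => by
      rw [← hw.adjoint θ (hθ.mono (iK.trans hKD))]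
      refine Finset.sum_congr rfl fun j _ => ?_
      congr 1; ext x
      by_cases hx : x ∈ tsupport θ
      · have hx' := iK (hθ.tsupport_subset hx)
        rw [(hφφ x hx').eq_of_nhds, (hψψ x hx').eq_of_nhds, del_ofReal_congr (hψψ x hx'),
          del_ofReal_congr (hφφ x hx')]
      · rw [del_eq_zero_of_notMem hx, image_eq_zero_of_notMem_tsupport hx]; simp)
    ⟨hη.contDiff, hη.hasCompactSupport, hηK⟩
  have E1 : ∀ x, (Real.exp (-φ' x / 2) : ℂ) * (η x * σ x) +
        (Real.exp (-ψ' x / 2) : ℂ) * ∑ j, h j x * del j η x = (Real.exp (-φ x / 2) : ℂ) * (η x * σ x) +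
        (Real.exp (-ψ x / 2) : ℂ) * ∑ j, h j x * del j η x := fun x => by
    by_cases hx : x ∈ tsupport η
    · have hx' := iK (hηK hx)
      rw [(hφφ x hx').eq_of_nhds, (hψψ x hx').eq_of_nhds]
    · simp [del_eq_zero_of_notMem hx, image_eq_zero_of_notMem_tsupport hx]
  have E2 : ∀ j l x, (Real.exp (-ψ' x / 2) : ℂ) * (h l x * dbar j η x - h j x * dbar l η x) =
      (Real.exp (-ψ x / 2) : ℂ) * (h l x * dbar j η x - h j x * dbar l η x) := fun j l x => by
    by_cases hx : x ∈ tsupport η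
    · have hx' := iK (hηK hx)
      rw [(hψψ x hx').eq_of_nhds]
    · simp [dbar_eq_zero_of_notMem hx]
  simp_rw [E1, E2] at key
  exact key

lemma norm_dbar_ofReal {η : Cn d → ℝ} {x : Cn d} (hη : DifferentiableAt ℝ η x) (j : Fin d) :
    ‖dbar j (fun y => (η y : ℂ)) x‖ = ‖del j (fun y => (η y : ℂ)) x‖ := by
  have h1 : DifferentiableAt ℝ (fun y => (η y : ℂ)) x :=
    (ofRealCLM.differentiableAt (x := η x)).comp x hη
  have := dbar_conj h1 j
  simp only [conj_ofReal] at this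
  rw [this, norm_conj]

lemma norm_add_sq_le_of_pos {a b : ℂ} {ε : ℝ} (hε : 0 < ε) :
    ‖a + b‖ ^ 2 ≤ (1 + ε) * ‖a‖ ^ 2 + (1 + ε⁻¹) * ‖b‖ ^ 2 := by
  have h1 : ‖a + b‖ ^ 2 ≤ (‖a‖ + ‖b‖) ^ 2 := by gcongr; exact norm_add_le _ _
  have h2 : 0 ≤ (ε * ‖a‖ - ‖b‖) ^ 2 * ε⁻¹ := by positivity
  have h3 : (ε * ‖a‖ - ‖b‖) ^ 2 * ε⁻¹ = ε * ‖a‖ ^ 2 - 2 * ‖a‖ * ‖b‖ + ε⁻¹ * ‖b‖ ^ 2 := by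
    field_simp; ring
  nlinarith

lemma norm_exp_neg_half_sq (t : ℝ) : ‖(Real.exp (-t / 2) : ℂ)‖ ^ 2 = Real.exp (-t) := by
  rw [Complex.norm_real, Real.norm_of_nonneg (Real.exp_pos _).le, ← Real.exp_nat_mul]
  congr 1; push_cast; ring

/-- Cutoff functions on `D` with gradient controlled by the weight `ψ`. -/
structure IsCutoffSeq (D : Set (Cn d)) (ψ : Cn d → ℝ) (η : ℕ → Cn d → ℝ) : Prop where
  contDiff : ∀ n, ContDiff ℝ ∞ (η n)
  hasCompactSupport : ∀ n, HasCompactSupport (η n)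
  tsupport_subset : ∀ n, tsupport (η n) ⊆ D
  mem_Icc : ∀ n x, η n x ∈ Icc (0 : ℝ) 1
  tendsto : ∀ x ∈ D, Tendsto (fun n => η n x) atTop (𝓝 1)
  grad : ∀ n, ∀ x ∈ D, ∑ j, ‖del j (fun y => (η n y : ℂ)) x‖ ^ 2 ≤
    (1 / ((n : ℝ) + 1)) ^ 2 * Real.exp (ψ x)

lemma weak_estimate_cutoff {D : Set (Cn d)} (hD : IsOpen D)
    {φ ψ : Cn d → ℝ} (hφ : ContDiffOn ℝ ∞ φ D) (hψ : ContDiffOn ℝ ∞ ψ D)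
    (hL : ∀ x ∈ D, ∀ v, 2 * (∑ j, ‖del j (fun y => (ψ y : ℂ)) x‖ ^ 2 + Real.exp (ψ x)) * ‖v‖ ^ 2
      ≤ levi φ x v)
    {h : Fin d → Cn d → ℂ} {σ : Cn d → ℂ} (hσ : MemLp σ 2) (hw : WeakPair D φ ψ h σ)
    (hi : Integrable (fun x => ‖σ x‖ ^ 2 * Real.exp (-φ x)))
    {η : ℕ → Cn d → ℝ} (hη : IsCutoffSeq D ψ η) (n : ℕ) {ε : ℝ} (hε : ε = 1 / ((n : ℝ) + 1)) :
    ∑ j, ∫ x, ‖(η n x : ℂ) * h j x‖ ^ 2 ≤ (1 + ε) * (∫ x, ‖σ x‖ ^ 2 * Real.exp (-φ x)) +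
      (ε + (1 + (d : ℝ) ^ 2) * ε ^ 2) * ∫ x, ∑ j, ‖h j x‖ ^ 2 := by
  have hε0 : 0 < ε := by rw [hε]; positivity
  have tη : IsTest D (fun x => (η n x : ℂ)) := by
    have := tsupport_comp_subset (g := fun t : ℝ => (t : ℂ)) (by simp) (η n)
    exact ⟨contDiff_ofReal_comp (hη.contDiff n),
      (hη.hasCompactSupport n).comp_left (g := fun t : ℝ => (t : ℂ)) (by simp),
      this.trans (hη.tsupport_subset n)⟩
  have key := weak_cutoff hD hφ hψ hL hσ hw tη
  have iH : Integrable (fun x => ∑ j, ‖h j x‖ ^ 2) := integrable_finsetSum _ fun j _ =>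
    (memLp_two_iff_integrable_sq_norm (hw.memLp j).1).1 (hw.memLp j)
  have gr : ∀ x, Real.exp (-ψ x) * ∑ j, ‖del j (fun y => (η n y : ℂ)) x‖ ^ 2 ≤ ε ^ 2 := fun x => by
    by_cases hx : x ∈ D
    · have := hη.grad n x hx
      rw [← hε] at this
      calc _ ≤ Real.exp (-ψ x) * (ε ^ 2 * Real.exp (ψ x)) := by gcongr
        _ = ε ^ 2 * (Real.exp (-ψ x) * Real.exp (ψ x)) := by ring
        _ = ε ^ 2 := by rw [← Real.exp_add]; simp
    · simp [del_eq_zero_of_notMem fun hx' => hx (tη.tsupport_subset hx')]; positivity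
  have grj : ∀ x j, Real.exp (-ψ x) * ‖dbar j (fun y => (η n y : ℂ)) x‖ ^ 2 ≤ ε ^ 2 := fun x j => by
    rw [norm_dbar_ofReal ((hη.contDiff n).differentiable (by simp) x)]
    refine le_trans ?_ (gr x)
    gcongr
    exact Finset.single_le_sum (f := fun j => ‖del j (fun y => (η n y : ℂ)) x‖ ^ 2)
      (fun _ _ => by positivity) (Finset.mem_univ j)
  have hj : ∀ x j, ‖h j x‖ ^ 2 ≤ ∑ j, ‖h j x‖ ^ 2 := fun x j =>
    Finset.single_le_sum (f := fun j => ‖h j x‖ ^ 2) (fun _ _ => by positivity) (Finset.mem_univ j)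
  have B1 : ∫ x, ‖(Real.exp (-φ x / 2) : ℂ) * ((η n x : ℂ) * σ x) +
        (Real.exp (-ψ x / 2) : ℂ) * ∑ j, h j x * del j (fun y => (η n y : ℂ)) x‖ ^ 2 ≤
      (1 + ε) * (∫ x, ‖σ x‖ ^ 2 * Real.exp (-φ x)) + (ε + ε ^ 2) * ∫ x, ∑ j, ‖h j x‖ ^ 2 := by
    rw [← integral_const_mul, ← integral_const_mul, ← integral_add (hi.const_mul _) (iH.const_mul _)]
    refine integral_mono_of_nonneg (Eventually.of_forall fun x => by positivity)
      ((hi.const_mul _).add (iH.const_mul _)) (Eventually.of_forall fun x => ?_)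
    refine (norm_add_sq_le_of_pos hε0).trans (add_le_add ?_ ?_)
    · rw [norm_mul, mul_pow, norm_exp_neg_half_sq, norm_mul, mul_pow]
      have h1 : ‖(η n x : ℂ)‖ ^ 2 ≤ 1 := by
        rw [Complex.norm_real, Real.norm_of_nonneg (hη.mem_Icc n x).1]
        exact pow_le_one₀ (hη.mem_Icc n x).1 (hη.mem_Icc n x).2
      have : Real.exp (-φ x) * (‖(η n x : ℂ)‖ ^ 2 * ‖σ x‖ ^ 2) ≤ Real.exp (-φ x) * (1 * ‖σ x‖ ^ 2) := by
        gcongr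
      refine mul_le_mul_of_nonneg_left ?_ (by positivity)
      linarith [mul_comm (Real.exp (-φ x)) (‖σ x‖ ^ 2)]
    · have cs : ‖∑ j, h j x * del j (fun y => (η n y : ℂ)) x‖ ^ 2 ≤
          (∑ j, ‖h j x‖ ^ 2) * ∑ j, ‖del j (fun y => (η n y : ℂ)) x‖ ^ 2 := by
        refine le_trans ?_ (Finset.sum_mul_sq_le_sq_mul_sq _ _ _)
        gcongr
        refine (norm_sum_le _ _).trans (le_of_eq ?_)
        simp
      rw [norm_mul, mul_pow, norm_exp_neg_half_sq]
      calc (1 + ε⁻¹) * (Real.exp (-ψ x) * ‖∑ j, h j x * del j (fun y => (η n y : ℂ)) x‖ ^ 2)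
          ≤ (1 + ε⁻¹) * (Real.exp (-ψ x) * ((∑ j, ‖h j x‖ ^ 2) *
            ∑ j, ‖del j (fun y => (η n y : ℂ)) x‖ ^ 2)) := by gcongr
        _ = (1 + ε⁻¹) * ((∑ j, ‖h j x‖ ^ 2) * (Real.exp (-ψ x) *
            ∑ j, ‖del j (fun y => (η n y : ℂ)) x‖ ^ 2)) := by ring
        _ ≤ (1 + ε⁻¹) * ((∑ j, ‖h j x‖ ^ 2) * ε ^ 2) := by
            have := gr x
            gcongr
        _ = (ε + ε ^ 2) * ∑ j, ‖h j x‖ ^ 2 := by field_simp; ring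
  have B2 : ∀ j l, ∫ x, ‖(Real.exp (-ψ x / 2) : ℂ) * (h l x * dbar j (fun y => (η n y : ℂ)) x -
      h j x * dbar l (fun y => (η n y : ℂ)) x)‖ ^ 2 ≤ 4 * ε ^ 2 * ∫ x, ∑ j, ‖h j x‖ ^ 2 := by
    intro j l
    rw [← integral_const_mul]
    refine integral_mono_of_nonneg (Eventually.of_forall fun x => by positivity)
      (iH.const_mul _) (Eventually.of_forall fun x => ?_)
    simp only
    rw [norm_mul, mul_pow, norm_exp_neg_half_sq]
    have h1 := norm_add_sq_le_of_pos (a := h l x * dbar j (fun y => (η n y : ℂ)) x)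
      (b := -(h j x * dbar l (fun y => (η n y : ℂ)) x)) one_pos
    rw [← sub_eq_add_neg, norm_neg, norm_mul, norm_mul, mul_pow, mul_pow] at h1
    have h2 := mul_le_mul (hj x l) (grj x j) (by positivity) (by positivity)
    have h3 := mul_le_mul (hj x j) (grj x l) (by positivity) (by positivity)
    have h4 := mul_le_mul_of_nonneg_left h1 (Real.exp_pos (-ψ x)).le
    norm_num at h4
    nlinarith
  have B3 : ∑ j, ∑ l, ∫ x, ‖(Real.exp (-ψ x / 2) : ℂ) * (h l x * dbar j (fun y => (η n y : ℂ)) x -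
      h j x * dbar l (fun y => (η n y : ℂ)) x)‖ ^ 2 ≤ (d : ℝ) ^ 2 * (4 * ε ^ 2 * ∫ x, ∑ j, ‖h j x‖ ^ 2) := by
    refine (Finset.sum_le_sum fun j _ => Finset.sum_le_sum fun l _ => B2 j l).trans (le_of_eq ?_)
    simp; ring
  nlinarith

theorem weak_estimate {D : Set (Cn d)} (hD : IsOpen D)
    {φ ψ : Cn d → ℝ} (hφ : ContDiffOn ℝ ∞ φ D) (hψ : ContDiffOn ℝ ∞ ψ D)
    (hL : ∀ x ∈ D, ∀ v, 2 * (∑ j, ‖del j (fun y => (ψ y : ℂ)) x‖ ^ 2 + Real.exp (ψ x)) * ‖v‖ ^ 2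
      ≤ levi φ x v)
    {h : Fin d → Cn d → ℂ} {σ : Cn d → ℂ} (hσ : MemLp σ 2) (hw : WeakPair D φ ψ h σ)
    (hi : Integrable (fun x => ‖σ x‖ ^ 2 * Real.exp (-φ x)))
    {η : ℕ → Cn d → ℝ} (hη : IsCutoffSeq D ψ η) :
    ∑ j, ∫ x in D, ‖h j x‖ ^ 2 ≤ ∫ x, ‖σ x‖ ^ 2 * Real.exp (-φ x) := by
  have tε : Tendsto (fun n : ℕ => 1 / ((n : ℝ) + 1)) atTop (𝓝 0) := tendsto_one_div_add_atTop_nhds_zero_nat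
  have tR := ((tε.const_add 1).mul_const (∫ x, ‖σ x‖ ^ 2 * Real.exp (-φ x))).add
    ((tε.add ((tε.pow 2).const_mul (1 + (d : ℝ) ^ 2))).mul_const (∫ x, ∑ j, ‖h j x‖ ^ 2))
  have tL : Tendsto (fun n => ∑ j, ∫ x, ‖(η n x : ℂ) * h j x‖ ^ 2) atTop
      (𝓝 (∑ j, ∫ x in D, ‖h j x‖ ^ 2)) := by
    refine tendsto_finsetSum _ fun j _ => ?_
    have ij := (memLp_two_iff_integrable_sq_norm (hw.memLp j).1).1 (hw.memLp j)
    have e : ∀ n, ∫ x, ‖(η n x : ℂ) * h j x‖ ^ 2 = ∫ x in D, ‖(η n x : ℂ) * h j x‖ ^ 2 := fun n => by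
      rw [setIntegral_eq_integral_of_forall_compl_eq_zero]
      intro x hx
      simp [image_eq_zero_of_notMem_tsupport fun hx' => hx (hη.tsupport_subset n hx')]
    simp_rw [e]
    refine tendsto_integral_of_dominated_convergence (fun x => ‖h j x‖ ^ 2) (fun n => ?_)
      ij.integrableOn (fun n => Eventually.of_forall fun x => ?_) ?_
    · exact (((continuous_ofReal.comp (hη.contDiff n).continuous).aestronglyMeasurable.mul
        (hw.memLp j).1).norm.pow 2).restrict
    · rw [Real.norm_of_nonneg (by positivity), norm_mul, mul_pow, Complex.norm_real,
        Real.norm_of_nonneg (hη.mem_Icc n x).1]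
      have := pow_le_one₀ (n := 2) (hη.mem_Icc n x).1 (hη.mem_Icc n x).2
      nlinarith [sq_nonneg ‖h j x‖]
    · filter_upwards [ae_restrict_mem hD.measurableSet] with x hx
      have h1 : Tendsto (fun n => (η n x : ℂ)) atTop (𝓝 ((1 : ℝ) : ℂ)) :=
        (continuous_ofReal.tendsto _).comp (hη.tendsto x hx)
      simpa using ((h1.mul_const (h j x)).norm).pow 2
  have := le_of_tendsto_of_tendsto' tL tR fun n =>
    weak_estimate_cutoff hD hφ hψ hL hσ hw hi hη n rfl
  simpa using this

end WeakEstimate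

end SCV

namespace SCV

open MeasureTheory Filter Topology
open scoped ContDiff ENNReal NNReal Convolution ComplexConjugate

section Duality

variable {H₁ H₂ : Type*} [NormedAddCommGroup H₁] [InnerProductSpace ℂ H₁] [CompleteSpace H₁]
  [NormedAddCommGroup H₂] [InnerProductSpace ℂ H₂]

lemma exists_dual_solution (S : Submodule ℂ (H₁ × H₂)) {a : H₂} {C : ℝ} (hC : 0 ≤ C)
    (h : ∀ p ∈ S, ‖inner ℂ a p.2‖ ≤ C * ‖p.1‖) :
    ∃ u : H₁, ‖u‖ ≤ C ∧ ∀ p ∈ S, inner ℂ u p.1 = inner ℂ a p.2 := by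
  let A : S →ₗ[ℂ] H₁ := (LinearMap.fst ℂ H₁ H₂).comp S.subtype
  let L : S →ₗ[ℂ] ℂ := ((innerSL ℂ a : H₂ →L[ℂ] ℂ) : H₂ →ₗ[ℂ] ℂ).comp
    ((LinearMap.snd ℂ H₁ H₂).comp S.subtype)
  have hL : ∀ p : S, L p = inner ℂ a (p : H₁ × H₂).2 := fun p => rfl
  have hA : ∀ p : S, A p = (p : H₁ × H₂).1 := fun p => rfl
  have hker : LinearMap.ker A ≤ LinearMap.ker L := fun p hp => by
    have h1 : (p : H₁ × H₂).1 = 0 := hp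
    have h2 := h p p.2
    rw [h1, norm_zero, mul_zero] at h2
    exact norm_le_zero_iff.1 h2
  let ℓ : LinearMap.range A →ₗ[ℂ] ℂ :=
    ((LinearMap.ker A).liftQ L hker).comp (A.quotKerEquivRange.symm : LinearMap.range A →ₗ[ℂ] _)
  have hℓ : ∀ (p : S), ℓ ⟨A p, LinearMap.mem_range_self A p⟩ = L p := fun p => by
    simp only [ℓ, LinearMap.comp_apply, LinearEquiv.coe_coe]
    have : A.quotKerEquivRange.symm ⟨A p, LinearMap.mem_range_self A p⟩ =
        (LinearMap.ker A).mkQ p := by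
      rw [LinearEquiv.symm_apply_eq]
      ext
      simp
    rw [this]; simp
  have hb : ∀ x, ‖ℓ x‖ ≤ C * ‖x‖ := by
    rintro ⟨_, p, rfl⟩
    rw [hℓ]
    exact h p p.2
  obtain ⟨g, hg, hgn⟩ := exists_extension_norm_eq _ (ℓ.mkContinuous C hb)
  refine ⟨(InnerProductSpace.toDual ℂ H₁).symm g, ?_, fun p hp => ?_⟩
  · rw [LinearIsometryEquiv.norm_map, hgn]
    exact LinearMap.mkContinuous_norm_le _ hC _
  · rw [InnerProductSpace.toDual_symm_apply]
    have := hg ⟨A ⟨p, hp⟩, LinearMap.mem_range_self A _⟩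
    rw [LinearMap.mkContinuous_apply, hℓ] at this
    exact this

end Duality

section TestFunctions

variable {d : ℕ} {D : Set (Cn d)}

lemma contDiff_mul_of_tsupport_subset (hD : IsOpen D) {E θ : Cn d → ℂ} (hE : ContDiffOn ℝ ∞ E D)
    (hθ : ContDiff ℝ ∞ θ) (hs : tsupport θ ⊆ D) : ContDiff ℝ ∞ (fun x => E x * θ x) := by
  rw [contDiff_iff_contDiffAt]
  intro x
  by_cases hx : x ∈ D
  · exact (hE.contDiffAt (hD.mem_nhds hx)).mul hθ.contDiffAt
  · have : (fun x => E x * θ x) =ᶠ[𝓝 x] fun _ => 0 := by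
      filter_upwards [(isClosed_tsupport θ).isOpen_compl.mem_nhds fun h => hx (hs h)] with y hy
      rw [image_eq_zero_of_notMem_tsupport hy, mul_zero]
    exact contDiffAt_const.congr_of_eventuallyEq this

lemma IsTest.mul_left (hD : IsOpen D) {E θ : Cn d → ℂ} (hE : ContDiffOn ℝ ∞ E D)
    (hθ : IsTest D θ) : IsTest D (fun x => E x * θ x) :=
  ⟨contDiff_mul_of_tsupport_subset hD hE hθ.1 hθ.3, hθ.2.mul_left,
    (tsupport_mul_subset_right (f := E) (g := θ)).trans hθ.3⟩

lemma IsTest.dbar {θ : Cn d → ℂ} (hθ : IsTest D θ) (j : Fin d) : IsTest D (dbar j θ) :=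
  ⟨contDiff_dbar hθ.1 j, hasCompactSupport_dbar hθ.2 j, (tsupport_dbar_subset θ j).trans hθ.3⟩

lemma IsTest.del {θ : Cn d → ℂ} (hθ : IsTest D θ) (j : Fin d) : IsTest D (del j θ) :=
  ⟨contDiff_del hθ.1 j, hasCompactSupport_del hθ.2 j, (tsupport_del_subset θ j).trans hθ.3⟩

lemma IsTest.conj {θ : Cn d → ℂ} (hθ : IsTest D θ) : IsTest D (fun x => conj (θ x)) :=
  ⟨conjCLE.contDiff.comp hθ.1, hθ.2.comp_left (g := fun z : ℂ => conj z) (by simp),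
    (tsupport_comp_subset (g := fun z : ℂ => conj z) (by simp) θ).trans hθ.3⟩

lemma IsTest.zero : IsTest D (fun _ => 0) :=
  ⟨contDiff_const, HasCompactSupport.zero, by simp [tsupport]⟩

lemma IsTest.add {θ κ : Cn d → ℂ} (hθ : IsTest D θ) (hκ : IsTest D κ) :
    IsTest D (fun x => θ x + κ x) :=
  ⟨hθ.1.add hκ.1, hθ.2.add hκ.2, (tsupport_add θ κ).trans (union_subset hθ.3 hκ.3)⟩

lemma IsTest.const_mul {θ : Cn d → ℂ} (c : ℂ) (hθ : IsTest D θ) : IsTest D (fun x => c * θ x) :=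
  ⟨contDiff_const.mul hθ.1, hθ.2.mul_left, (tsupport_mul_subset_right (f := fun _ => c)).trans hθ.3⟩

lemma IsTest.sum {ι : Type*} (s : Finset ι) {θ : ι → Cn d → ℂ} (hθ : ∀ i ∈ s, IsTest D (θ i)) :
    IsTest D (fun x => ∑ i ∈ s, θ i x) := by
  classical
  induction s using Finset.induction_on with
  | empty => simpa using IsTest.zero
  | insert i s hi ih =>
    simp only [Finset.sum_insert hi]
    exact (hθ i (by simp)).add (ih fun k hk => hθ k (by simp [hk]))

lemma IsTest.continuous {θ : Cn d → ℂ} (hθ : IsTest D θ) : Continuous θ := hθ.1.continuous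

lemma IsTest.memLp {θ : Cn d → ℂ} (hθ : IsTest D θ) : MemLp θ 2 :=
  hθ.1.continuous.memLp_of_hasCompactSupport hθ.2

lemma IsTest.differentiableAt {θ : Cn d → ℂ} (hθ : IsTest D θ) (x : Cn d) :
    DifferentiableAt ℝ θ x := hθ.1.differentiable (by simp) x

lemma IsTest.integrable_mul {θ f : Cn d → ℂ} (hθ : IsTest D θ) (hf : MemLp f 2) :
    Integrable (fun x => f x * θ x) := by
  simpa only [mul_comm] using integrable_mul_of_memLp hf hθ.continuous hθ.2

lemma IsTest.eq_zero {θ : Cn d → ℂ} (hθ : IsTest D θ) {x : Cn d} (hx : x ∉ D) : θ x = 0 :=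
  image_eq_zero_of_notMem_tsupport fun h => hx (hθ.3 h)

lemma contDiffOn_exp_ofReal {u : Cn d → ℝ} (hu : ContDiffOn ℝ ∞ u D) :
    ContDiffOn ℝ ∞ (fun x => (Real.exp (u x) : ℂ)) D :=
  ofRealCLM.contDiff.comp_contDiffOn hu.exp

lemma contDiffOn_del (hD : IsOpen D) {f : Cn d → ℂ} (hf : ContDiffOn ℝ ∞ f D) (j : Fin d) :
    ContDiffOn ℝ ∞ (del j f) D := by
  have h1 : ContDiffOn ℝ ∞ (fderiv ℝ f) D := hf.fderiv_of_isOpen hD (by simp)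
  exact contDiffOn_const.mul ((h1.clm_apply contDiffOn_const).sub
    (contDiffOn_const.mul (h1.clm_apply contDiffOn_const)))

lemma contDiffOn_dbar (hD : IsOpen D) {f : Cn d → ℂ} (hf : ContDiffOn ℝ ∞ f D) (j : Fin d) :
    ContDiffOn ℝ ∞ (dbar j f) D := by
  have h1 : ContDiffOn ℝ ∞ (fderiv ℝ f) D := hf.fderiv_of_isOpen hD (by simp)
  exact contDiffOn_const.mul ((h1.clm_apply contDiffOn_const).add
    (contDiffOn_const.mul (h1.clm_apply contDiffOn_const)))

lemma del_exp_mul {u : Cn d → ℝ} {f : Cn d → ℂ} {x : Cn d} (hu : DifferentiableAt ℝ u x)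
    (hf : DifferentiableAt ℝ f x) (j : Fin d) :
    del j (fun y => (Real.exp (u y) : ℂ) * f y) x =
      (Real.exp (u x) : ℂ) * (del j f x + f x * del j (fun y => (u y : ℂ)) x) := by
  have h0 : DifferentiableAt ℝ (fun y => (Real.exp (u y) : ℂ)) x :=
    (ofRealCLM.differentiableAt (x := Real.exp (u x))).comp x hu.exp
  rw [del_mul h0 hf]
  have h1 : ∀ v, fderiv ℝ (fun y => (Real.exp (u y) : ℂ)) x v =
      (Real.exp (u x) : ℂ) * fderiv ℝ (fun y => (u y : ℂ)) x v := fun v => by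
    rw [fderiv_ofReal_comp hu, fderiv_ofReal_comp hu.exp, fderiv_exp hu]
    simp
  simp only [del, h1]; ring

lemma del_ofReal_sub {u v : Cn d → ℝ} {x : Cn d} (hu : DifferentiableAt ℝ u x)
    (hv : DifferentiableAt ℝ v x) (j : Fin d) :
    del j (fun y => ((u y - v y : ℝ) : ℂ)) x =
      del j (fun y => (u y : ℂ)) x - del j (fun y => (v y : ℂ)) x := by
  simp only [del]
  rw [fderiv_ofReal_comp (hu.fun_sub hv), fderiv_ofReal_comp (hu.fun_sub hv),
    fderiv_ofReal_comp hu, fderiv_ofReal_comp hu, fderiv_ofReal_comp hv, fderiv_ofReal_comp hv,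
    fderiv_fun_sub hu hv, sub_apply, sub_apply]
  push_cast
  ring

lemma integral_dbar_mul_dbar_comm (hD : IsOpen D) {G θ : Cn d → ℂ} (hG : ContDiffOn ℝ ∞ G D)
    (hθ : IsTest D θ) (j l : Fin d) :
    ∫ x, dbar l G x * dbar j θ x = ∫ x, dbar j G x * dbar l θ x := by
  obtain ⟨G', hG', -, hGG⟩ := exists_contDiff_eq_near hD hθ.2 hθ.3 hG
  have e : ∀ j l x, dbar l G x * dbar j θ x = dbar j θ x * dbar l G' x := fun j l x => by
    by_cases hx : x ∈ tsupport θ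
    · rw [dbar_congr (hGG x hx), mul_comm]
    · rw [dbar_eq_zero_of_notMem hx]; simp
  simp_rw [e]
  rw [integral_mul_dbar (hθ.dbar j).1 hG' (hθ.dbar j).2,
    integral_mul_dbar (hθ.dbar l).1 hG' (hθ.dbar l).2]
  simp_rw [dbar_dbar_comm hθ.1 l j]

lemma integral_mul_dbar_test (hD : IsOpen D) {G θ : Cn d → ℂ} (hG : ContDiffOn ℝ ∞ G D)
    (hθ : IsTest D θ) (j : Fin d) :
    ∫ x, G x * dbar j θ x = -∫ x, dbar j G x * θ x := by
  obtain ⟨G', hG', -, hGG⟩ := exists_contDiff_eq_near hD hθ.2 hθ.3 hG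
  have e1 : ∀ x, G x * dbar j θ x = dbar j θ x * G' x := fun x => by
    by_cases hx : x ∈ tsupport θ
    · rw [(hGG x hx).eq_of_nhds, mul_comm]
    · rw [dbar_eq_zero_of_notMem hx]; simp
  have e2 : ∀ x, dbar j G x * θ x = θ x * dbar j G' x := fun x => by
    by_cases hx : x ∈ tsupport θ
    · rw [dbar_congr (hGG x hx), mul_comm]
    · rw [image_eq_zero_of_notMem_tsupport hx]; simp
  simp_rw [e1, e2]
  rw [integral_mul_dbar hθ.1 hG' hθ.2, neg_neg]

lemma inner_toLp_left {f : Cn d → ℂ} (hf : MemLp f 2) (u : Lp ℂ 2 (volume : Measure (Cn d))) :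
    inner ℂ (hf.toLp f) u = ∫ x, u x * conj (f x) := by
  rw [L2.inner_def]
  refine integral_congr_ae ?_
  filter_upwards [hf.coeFn_toLp] with x hx
  rw [hx]; rfl

lemma norm_toLp_sq {f : Cn d → ℂ} (hf : MemLp f 2) : ‖hf.toLp f‖ ^ 2 = ∫ x, ‖f x‖ ^ 2 := by
  rw [integral_norm_sq_eq hf, Lp.norm_toLp]

end TestFunctions

end SCV

namespace SCV

open MeasureTheory Filter Topology
open scoped ContDiff ENNReal NNReal Convolution ComplexConjugate

section Hormander

variable {d : ℕ} {D : Set (Cn d)}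

/-- The Hilbert space of `(0,1)`-forms with square integrable coefficients. -/
abbrev Forms (d : ℕ) := PiLp 2 (fun _ : Fin d => Lp ℂ 2 (volume : Measure (Cn d)))

lemma exists_closedForms (hD : IsOpen D) {E : Cn d → ℂ} (hE : ContDiffOn ℝ ∞ E D) :
    ∃ N : Submodule ℂ (Forms d), IsClosed (N : Set (Forms d)) ∧ ∀ h : Forms d, h ∈ N ↔
      ∀ θ, IsTest D θ → ∀ j l, ∫ x, E x * h l x * dbar j θ x = ∫ x, E x * h j x * dbar l θ x := by
  have key : ∀ θ, ∀ hθ : IsTest D θ, ∀ (j : Fin d) (u : Lp ℂ 2 (volume : Measure (Cn d))),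
      inner ℂ ((((hθ.dbar j).mul_left hD hE).conj).memLp.toLp _) u =
        ∫ x, E x * u x * dbar j θ x := fun θ hθ j u => by
    rw [inner_toLp_left]
    congr 1; ext x
    rw [conj_conj]; ring
  have hc : ∀ θ, ∀ hθ : IsTest D θ, ∀ j l : Fin d,
      Continuous fun h : Forms d => ∫ x, E x * h l x * dbar j θ x := fun θ hθ j l => by
    simp_rw [← key θ hθ]
    exact Continuous.inner continuous_const (by fun_prop)
  let C : Set (Forms d) := {h | ∀ θ, IsTest D θ → ∀ j l,
      ∫ x, E x * h l x * dbar j θ x = ∫ x, E x * h j x * dbar l θ x}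
  refine ⟨{
    carrier := C
    add_mem' := ?_
    zero_mem' := ?_
    smul_mem' := ?_ }, ?_, fun h => Iff.rfl⟩
  · intro f g hf hg θ hθ j l
    have h1 := hf θ hθ j l
    have h2 := hg θ hθ j l
    rw [← key θ hθ, ← key θ hθ] at h1 h2 ⊢
    simp only [PiLp.add_apply, inner_add_right, h1, h2]
  · intro θ hθ j l
    rw [← key θ hθ, ← key θ hθ]
    simp only [PiLp.zero_apply, inner_zero_right]
  · intro c f hf θ hθ j l
    have h1 := hf θ hθ j l
    rw [← key θ hθ, ← key θ hθ] at h1 ⊢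
    simp only [PiLp.smul_apply, inner_smul_right, h1]
  · have : ({h | ∀ θ, IsTest D θ → ∀ j l,
        ∫ x, E x * h l x * dbar j θ x = ∫ x, E x * h j x * dbar l θ x} : Set (Forms d)) =
        ⋂ θ, ⋂ _ : IsTest D θ, ⋂ j, ⋂ l, {h : Forms d |
          ∫ x, E x * h l x * dbar j θ x = ∫ x, E x * h j x * dbar l θ x} := by
      ext h; simp
    change IsClosed ({h | ∀ θ, IsTest D θ → ∀ j l,
        ∫ x, E x * h l x * dbar j θ x = ∫ x, E x * h j x * dbar l θ x} : Set (Forms d))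
    rw [this]
    exact isClosed_iInter fun θ => isClosed_iInter fun hθ => isClosed_iInter fun j =>
      isClosed_iInter fun l => isClosed_eq (hc θ hθ j l) (hc θ hθ l j)

/-- The formal adjoint of `∂̄` (up to sign and weight factors). -/
def divForm (φ ψ : Cn d → ℝ) (g : Fin d → Cn d → ℂ) (x : Cn d) : ℂ :=
  ∑ j, (del j (g j) x -
    (del j (fun y => (φ y : ℂ)) x - del j (fun y => (ψ y : ℂ)) x) * g j x)

variable {φ ψ : Cn d → ℝ}

lemma contDiffOn_del_sub (hD : IsOpen D) (hφ : ContDiffOn ℝ ∞ φ D) (hψ : ContDiffOn ℝ ∞ ψ D)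
    (j : Fin d) : ContDiffOn ℝ ∞
      (fun x => del j (fun y => (φ y : ℂ)) x - del j (fun y => (ψ y : ℂ)) x) D :=
  (contDiffOn_del hD (ofRealCLM.contDiff.comp_contDiffOn hφ) j).sub
    (contDiffOn_del hD (ofRealCLM.contDiff.comp_contDiffOn hψ) j)

lemma IsTest.sub {θ κ : Cn d → ℂ} (hθ : IsTest D θ) (hκ : IsTest D κ) :
    IsTest D (fun x => θ x - κ x) := by
  simpa [sub_eq_add_neg] using hθ.add (hκ.const_mul (-1))

lemma isTest_divForm (hD : IsOpen D) (hφ : ContDiffOn ℝ ∞ φ D) (hψ : ContDiffOn ℝ ∞ ψ D)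
    {g : Fin d → Cn d → ℂ} (hg : ∀ j, IsTest D (g j)) : IsTest D (divForm φ ψ g) :=
  IsTest.sum _ fun j _ => ((hg j).del j).sub ((hg j).mul_left hD (contDiffOn_del_sub hD hφ hψ j))

lemma IsTest.integrable {θ : Cn d → ℂ} (hθ : IsTest D θ) : Integrable θ :=
  hθ.continuous.integrable_of_hasCompactSupport hθ.2

lemma sum_integral_mul_del_add (hD : IsOpen D) (hφ : ContDiffOn ℝ ∞ φ D)
    (hψ : ContDiffOn ℝ ∞ ψ D) {g : Fin d → Cn d → ℂ} (hg : ∀ j, IsTest D (g j)) {θ : Cn d → ℂ}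
    (hθ : IsTest D θ) :
    ∑ j, ∫ x, g j x * (del j θ x +
      θ x * (del j (fun y => (φ y : ℂ)) x - del j (fun y => (ψ y : ℂ)) x)) =
      -∫ x, divForm φ ψ g x * θ x := by
  have hc := contDiffOn_del_sub hD hφ hψ
  have i1 : ∀ j, Integrable (fun x => del j (g j) x * θ x) := fun j =>
    (hθ.mul_left hD ((hg j).del j).1.contDiffOn).integrable
  have i1' : ∀ j, Integrable (fun x => g j x * del j θ x) := fun j =>
    ((hθ.del j).mul_left hD (hg j).1.contDiffOn).integrable
  have i2 : ∀ j, Integrable (fun x => (del j (fun y => (φ y : ℂ)) x -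
      del j (fun y => (ψ y : ℂ)) x) * g j x * θ x) := fun j =>
    (hθ.mul_left hD ((hg j).mul_left hD (hc j)).1.contDiffOn).integrable
  have i3 : ∀ j, Integrable (fun x => (del j (g j) x -
      (del j (fun y => (φ y : ℂ)) x - del j (fun y => (ψ y : ℂ)) x) * g j x) * θ x) := fun j => by
    refine ((i1 j).sub (i2 j)).congr (Eventually.of_forall fun x => ?_)
    simp only [Pi.sub_apply]; ring
  simp only [divForm, Finset.sum_mul]
  rw [integral_finsetSum _ fun j _ => i3 j, ← Finset.sum_neg_distrib]
  refine Finset.sum_congr rfl fun j _ => ?_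
  have e1 : ∫ x, (del j (g j) x - (del j (fun y => (φ y : ℂ)) x -
      del j (fun y => (ψ y : ℂ)) x) * g j x) * θ x = (∫ x, del j (g j) x * θ x) -
      ∫ x, (del j (fun y => (φ y : ℂ)) x - del j (fun y => (ψ y : ℂ)) x) * g j x * θ x := by
    rw [← integral_sub (i1 j) (i2 j)]
    congr 1; ext x; ring
  have e2 : ∫ x, g j x * (del j θ x +
      θ x * (del j (fun y => (φ y : ℂ)) x - del j (fun y => (ψ y : ℂ)) x)) =
      (∫ x, g j x * del j θ x) +
      ∫ x, (del j (fun y => (φ y : ℂ)) x - del j (fun y => (ψ y : ℂ)) x) * g j x * θ x := by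
    rw [← integral_add (i1' j) (i2 j)]
    congr 1; ext x; ring
  rw [e1, e2, integral_mul_del (hg j).1 hθ.1 (hg j).2]
  ring

lemma contDiffOn_half_sub (hφ : ContDiffOn ℝ ∞ φ D) (hψ : ContDiffOn ℝ ∞ ψ D) :
    ContDiffOn ℝ ∞ (fun x => (Real.exp ((φ x - ψ x) / 2) : ℂ)) D :=
  contDiffOn_exp_ofReal ((hφ.sub hψ).div_const 2)

lemma exp_half_mul (t : ℝ) : (Real.exp (t / 2) : ℂ) * (Real.exp (-t / 2) : ℂ) = 1 := by
  rw [← ofReal_mul, ← Real.exp_add]; simp [neg_div]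

lemma exp_half_mul_self (t : ℝ) : (Real.exp (-t / 2) : ℂ) * (Real.exp t : ℂ) =
    (Real.exp (t / 2) : ℂ) := by
  rw [← ofReal_mul, ← Real.exp_add]; congr 2; ring

lemma memLp_weighted (hD : IsOpen D) (hφ : ContDiffOn ℝ ∞ φ D) (hψ : ContDiffOn ℝ ∞ ψ D)
    {g : Cn d → ℂ} (hg : IsTest D g) :
    MemLp (fun x => (Real.exp (-(φ x - ψ x) / 2) : ℂ) * g x) 2 :=
  (hg.mul_left hD (contDiffOn_exp_ofReal
    (u := fun x => -(φ x - ψ x) / 2) ((hφ.sub hψ).neg.div_const 2))).memLp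

/-- The form with coefficients `e^{-(φ-ψ)/2} g j`, as an element of the Hilbert space. -/
def weightedForm (hD : IsOpen D) (hφ : ContDiffOn ℝ ∞ φ D) (hψ : ContDiffOn ℝ ∞ ψ D)
    {g : Fin d → Cn d → ℂ} (hg : ∀ j, IsTest D (g j)) : Forms d :=
  WithLp.toLp 2 fun j => (memLp_weighted hD hφ hψ (hg j)).toLp _

lemma weightedForm_ae (hD : IsOpen D) (hφ : ContDiffOn ℝ ∞ φ D) (hψ : ContDiffOn ℝ ∞ ψ D)
    {g : Fin d → Cn d → ℂ} (hg : ∀ j, IsTest D (g j)) (j : Fin d) :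
    (weightedForm hD hφ hψ hg j : Cn d → ℂ) =ᵐ[volume]
      fun x => (Real.exp (-(φ x - ψ x) / 2) : ℂ) * g j x :=
  (memLp_weighted hD hφ hψ (hg j)).coeFn_toLp

lemma integral_mul_weightedForm (hD : IsOpen D) (hφ : ContDiffOn ℝ ∞ φ D)
    (hψ : ContDiffOn ℝ ∞ ψ D) {g : Fin d → Cn d → ℂ} (hg : ∀ j, IsTest D (g j)) (j : Fin d)
    (κ : Cn d → ℂ) :
    ∫ x, (Real.exp ((φ x - ψ x) / 2) : ℂ) * weightedForm hD hφ hψ hg j x * κ x =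
      ∫ x, g j x * κ x := by
  refine integral_congr_ae ?_
  filter_upwards [weightedForm_ae hD hφ hψ hg j] with x hx
  rw [hx, ← mul_assoc, exp_half_mul, one_mul]

lemma inner_weightedForm (hD : IsOpen D) (hφ : ContDiffOn ℝ ∞ φ D)
    (hψ : ContDiffOn ℝ ∞ ψ D) {g : Fin d → Cn d → ℂ} (hg : ∀ j, IsTest D (g j)) (h : Forms d) :
    inner ℂ (weightedForm hD hφ hψ hg) h =
      ∑ j, ∫ x, h j x * conj ((Real.exp (-(φ x - ψ x) / 2) : ℂ) * g j x) := by
  rw [PiLp.inner_apply]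
  exact Finset.sum_congr rfl fun j _ => inner_toLp_left (memLp_weighted hD hφ hψ (hg j)) _

lemma dbar_exp_mul_conj {θ : Cn d → ℂ} {u : Cn d → ℝ} {x : Cn d} (hu : DifferentiableAt ℝ u x)
    (hθ : DifferentiableAt ℝ θ x) (j : Fin d) :
    dbar j (fun y => (Real.exp (u y) : ℂ) * conj (θ y)) x =
      (Real.exp (u x) : ℂ) * conj (del j θ x + θ x * del j (fun y => (u y : ℂ)) x) := by
  have h0 : DifferentiableAt ℝ (fun y => (Real.exp (u y) : ℂ)) x :=
    (ofRealCLM.differentiableAt (x := Real.exp (u x))).comp x hu.exp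
  have := dbar_conj (h0.fun_mul hθ) j
  rw [del_exp_mul hu hθ] at this
  simpa only [map_mul, conj_ofReal] using this

/-- Projecting a test form to the closed forms yields a weak pair with the same divergence. -/
lemma exists_weakPair (hD : IsOpen D) (hφ : ContDiffOn ℝ ∞ φ D) (hψ : ContDiffOn ℝ ∞ ψ D)
    {g : Fin d → Cn d → ℂ} (hg : ∀ j, IsTest D (g j)) :
    ∃ h : Forms d, WeakPair D φ ψ (fun j => h j) (divForm φ ψ g) ∧
      ∀ (α : Fin d → Cn d → ℂ) (hα : ∀ j, IsTest D (α j)),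
        (∀ θ, IsTest D θ → ∀ j l, ∫ x, α l x * dbar j θ x = ∫ x, α j x * dbar l θ x) →
        inner ℂ (weightedForm hD hφ hψ hα) (weightedForm hD hφ hψ hg) =
          inner ℂ (weightedForm hD hφ hψ hα) h := by
  obtain ⟨N, hN, hmem⟩ := exists_closedForms hD (contDiffOn_half_sub hφ hψ)
  have : CompleteSpace N := hN.completeSpace_coe
  have key : ∀ (α : Fin d → Cn d → ℂ) (hα : ∀ j, IsTest D (α j)),
        (∀ θ, IsTest D θ → ∀ j l, ∫ x, α l x * dbar j θ x = ∫ x, α j x * dbar l θ x) →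
        inner ℂ (weightedForm hD hφ hψ hα) (weightedForm hD hφ hψ hg) =
          inner ℂ (weightedForm hD hφ hψ hα) (N.starProjection (weightedForm hD hφ hψ hg)) := by
    intro α hα hcl
    have hin : weightedForm hD hφ hψ hα ∈ N := (hmem _).2 fun θ hθ j l => by
      rw [integral_mul_weightedForm, integral_mul_weightedForm]
      exact hcl θ hθ j l
    have := Submodule.starProjection_inner_eq_zero (weightedForm hD hφ hψ hg) _ hin
    rw [inner_sub_left, sub_eq_zero] at this
    rw [← inner_conj_symm, this, inner_conj_symm]
  refine ⟨N.starProjection (weightedForm hD hφ hψ hg), ⟨fun j => Lp.memLp _,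
    (hmem _).1 (Submodule.starProjection_apply_mem _ _), fun θ hθ => ?_⟩, key⟩
  rw [← sum_integral_mul_del_add hD hφ hψ hg hθ]
  have hβ : IsTest D (fun y => (Real.exp (φ y - ψ y) : ℂ) * conj (θ y)) :=
    hθ.conj.mul_left hD (contDiffOn_exp_ofReal (hφ.sub hψ))
  have k := key (fun j => dbar j fun y => (Real.exp (φ y - ψ y) : ℂ) * conj (θ y))
    (fun j => hβ.dbar j) (fun κ hκ j l => integral_dbar_mul_dbar_comm hD hβ.1.contDiffOn hκ j l)
  rw [inner_weightedForm, inner_weightedForm] at k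
  have e : ∀ j x, conj ((Real.exp (-(φ x - ψ x) / 2) : ℂ) *
      dbar j (fun y => (Real.exp (φ y - ψ y) : ℂ) * conj (θ y)) x) =
      (Real.exp ((φ x - ψ x) / 2) : ℂ) * (del j θ x +
        θ x * (del j (fun y => (φ y : ℂ)) x - del j (fun y => (ψ y : ℂ)) x)) := fun j x => by
    by_cases hx : x ∈ D
    · have d1 := (hφ.contDiffAt (hD.mem_nhds hx)).differentiableAt (by simp)
      have d2 := (hψ.contDiffAt (hD.mem_nhds hx)).differentiableAt (by simp)
      rw [dbar_exp_mul_conj (d1.fun_sub d2) (hθ.differentiableAt x), ← mul_assoc,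
        exp_half_mul_self, del_ofReal_sub d1 d2, map_mul, conj_ofReal, conj_conj]
    · rw [(hβ.dbar j).eq_zero hx, (hθ.del j).eq_zero hx, hθ.eq_zero hx]; simp
  simp_rw [e] at k
  calc _ = _ := Finset.sum_congr rfl fun j _ => by congr 1; ext x; ring
    _ = _ := k.symm
    _ = _ := Finset.sum_congr rfl fun j _ => by
      rw [← integral_mul_weightedForm hD hφ hψ hg]
      congr 1; ext x; ring

end Hormander

end SCV

namespace SCV

open MeasureTheory Filter Topology
open scoped ContDiff ENNReal NNReal Convolution ComplexConjugate

section HormanderTheorem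

variable {d : ℕ} {D : Set (Cn d)} {φ ψ : Cn d → ℝ}

lemma del_add {f g : Cn d → ℂ} {x : Cn d} (hf : DifferentiableAt ℝ f x)
    (hg : DifferentiableAt ℝ g x) (j : Fin d) :
    del j (fun y => f y + g y) x = del j f x + del j g x := by
  simp only [del, fderiv_fun_add hf hg, add_apply]
  ring

lemma del_const_mul {f : Cn d → ℂ} {x : Cn d} (hf : DifferentiableAt ℝ f x) (c : ℂ) (j : Fin d) :
    del j (fun y => c * f y) x = c * del j f x := by
  simp only [del, fderiv_const_mul hf, smul_apply, smul_eq_mul]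
  ring

lemma isTest_ofReal {χ : Cn d → ℝ} (hχ : ContDiff ℝ ∞ χ) (hχc : HasCompactSupport χ)
    (hχD : tsupport χ ⊆ D) : IsTest D (fun x => (χ x : ℂ)) :=
  ⟨contDiff_ofReal_comp hχ, hχc.comp_left (g := fun t : ℝ => (t : ℂ)) (by simp),
    (tsupport_comp_subset (g := fun t : ℝ => (t : ℂ)) (by simp) χ).trans hχD⟩

/-- The graph of the weighted adjoint of `∂̄` on test forms. -/
def adjointGraph (D : Set (Cn d)) (φ ψ : Cn d → ℝ) :
    Submodule ℂ (Lp ℂ 2 (volume : Measure (Cn d)) × Forms d) where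
  carrier := {p | ∃ g : Fin d → Cn d → ℂ, (∀ j, IsTest D (g j)) ∧
    (p.1 =ᵐ[volume] fun x => -((Real.exp (-φ x / 2) : ℂ) * divForm φ ψ g x)) ∧
    ∀ j, p.2 j =ᵐ[volume] fun x => (Real.exp (-(φ x - ψ x) / 2) : ℂ) * g j x}
  add_mem' := by
    rintro p q ⟨g, hg, h1, h2⟩ ⟨g', hg', h1', h2'⟩
    refine ⟨fun j x => g j x + g' j x, fun j => (hg j).add (hg' j), ?_, fun j => ?_⟩
    · filter_upwards [Lp.coeFn_add p.1 q.1, h1, h1'] with x e1 e2 e3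
      rw [Prod.fst_add, e1, Pi.add_apply, e2, e3]
      have : divForm φ ψ (fun j x => g j x + g' j x) x = divForm φ ψ g x + divForm φ ψ g' x := by
        simp only [divForm, ← Finset.sum_add_distrib]
        refine Finset.sum_congr rfl fun j _ => ?_
        rw [del_add ((hg j).differentiableAt x) ((hg' j).differentiableAt x)]
        ring
      rw [this]; ring
    · filter_upwards [Lp.coeFn_add (p.2 j) (q.2 j), h2 j, h2' j] with x e1 e2 e3
      rw [Prod.snd_add, PiLp.add_apply, e1, Pi.add_apply, e2, e3]; ring
  zero_mem' := by
    refine ⟨fun j _ => 0, fun j => IsTest.zero, ?_, fun j => ?_⟩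
    · filter_upwards [Lp.coeFn_zero ℂ 2 (volume : Measure (Cn d))] with x e1
      rw [Prod.fst_zero, e1]
      simp [divForm, del]
    · filter_upwards [Lp.coeFn_zero ℂ 2 (volume : Measure (Cn d))] with x e1
      rw [Prod.snd_zero, PiLp.zero_apply, e1]
      simp
  smul_mem' := by
    rintro c p ⟨g, hg, h1, h2⟩
    refine ⟨fun j x => c * g j x, fun j => (hg j).const_mul c, ?_, fun j => ?_⟩
    · filter_upwards [Lp.coeFn_smul c p.1, h1] with x e1 e2
      rw [Prod.smul_fst, e1, Pi.smul_apply, e2]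
      have : divForm φ ψ (fun j x => c * g j x) x = c * divForm φ ψ g x := by
        simp only [divForm, Finset.mul_sum]
        refine Finset.sum_congr rfl fun j _ => ?_
        rw [del_const_mul ((hg j).differentiableAt x)]
        ring
      rw [this, smul_eq_mul]; ring
    · filter_upwards [Lp.coeFn_smul c (p.2 j), h2 j] with x e1 e2
      rw [Prod.smul_snd, PiLp.smul_apply, e1, Pi.smul_apply, e2, smul_eq_mul]; ring

lemma norm_inner_weightedForm_le (hD : IsOpen D) (hφ : ContDiffOn ℝ ∞ φ D)
    (hψ : ContDiffOn ℝ ∞ ψ D) {α : Fin d → Cn d → ℂ} (hα : ∀ j, IsTest D (α j)) (h : Forms d) :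
    ‖inner ℂ (weightedForm hD hφ hψ hα) h‖ ≤
      ‖weightedForm hD hφ hψ hα‖ * √(∑ j, ∫ x in D, ‖h j x‖ ^ 2) := by
  have hm : ∀ j, MemLp (D.indicator (h j : Cn d → ℂ)) 2 := fun j =>
    (Lp.memLp (h j)).indicator hD.measurableSet
  let h' : Forms d := WithLp.toLp 2 fun j => (hm j).toLp _
  have e : inner ℂ (weightedForm hD hφ hψ hα) h = inner ℂ (weightedForm hD hφ hψ hα) h' := by
    rw [inner_weightedForm, inner_weightedForm]
    refine Finset.sum_congr rfl fun j _ => integral_congr_ae ?_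
    filter_upwards [(hm j).coeFn_toLp] with x hx
    change _ = ((hm j).toLp _ : Cn d → ℂ) x * _
    rw [hx]
    by_cases hxD : x ∈ D
    · rw [indicator_of_mem hxD]
    · simp [(hα j).eq_zero hxD]
  rw [e]
  refine (norm_inner_le_norm _ _).trans (le_of_eq ?_)
  congr 1
  rw [PiLp.norm_eq_of_L2]
  congr 1
  refine Finset.sum_congr rfl fun j _ => ?_
  rw [norm_toLp_sq, ← integral_indicator hD.measurableSet]
  congr 1; ext x
  by_cases hxD : x ∈ D <;> simp [hxD]

lemma norm_weightedForm_sq (hD : IsOpen D) (hφ : ContDiffOn ℝ ∞ φ D)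
    (hψ : ContDiffOn ℝ ∞ ψ D) {α : Fin d → Cn d → ℂ} (hα : ∀ j, IsTest D (α j)) :
    ‖weightedForm hD hφ hψ hα‖ ^ 2 =
      ∫ x in D, (∑ j, ‖α j x‖ ^ 2) * Real.exp (-(φ x - ψ x)) := by
  rw [PiLp.norm_sq_eq_of_L2]
  have hi : ∀ j, Integrable (fun x => ‖α j x‖ ^ 2 * Real.exp (-(φ x - ψ x))) := fun j => by
    have := (memLp_weighted hD hφ hψ (hα j)).integrable_norm_pow (by norm_num)
    refine this.congr (Eventually.of_forall fun x => ?_)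
    simp only [norm_mul, mul_pow]
    rw [norm_exp_neg_half_sq, mul_comm]
  have e : ∀ j, ‖weightedForm hD hφ hψ hα j‖ ^ 2 =
      ∫ x in D, ‖α j x‖ ^ 2 * Real.exp (-(φ x - ψ x)) := fun j => by
    refine (norm_toLp_sq (memLp_weighted hD hφ hψ (hα j))).trans ?_
    rw [setIntegral_eq_integral_of_forall_compl_eq_zero
      (fun x hx => by simp [(hα j).eq_zero hx])]
    congr 1; ext x
    rw [norm_mul, mul_pow, norm_exp_neg_half_sq, mul_comm]
  simp_rw [e, Finset.sum_mul]
  rw [integral_finsetSum _ fun j _ => (hi j).integrableOn]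

lemma norm_inner_le_of_mem_adjointGraph (hD : IsOpen D) (hφ : ContDiffOn ℝ ∞ φ D)
    (hψ : ContDiffOn ℝ ∞ ψ D)
    (hL : ∀ x ∈ D, ∀ v, 2 * (∑ j, ‖del j (fun y => (ψ y : ℂ)) x‖ ^ 2 + Real.exp (ψ x)) * ‖v‖ ^ 2
      ≤ levi φ x v) {η : ℕ → Cn d → ℝ} (hη : IsCutoffSeq D ψ η)
    {α : Fin d → Cn d → ℂ} (hα : ∀ j, IsTest D (α j))
    (hcl : ∀ θ, IsTest D θ → ∀ j l, ∫ x, α l x * dbar j θ x = ∫ x, α j x * dbar l θ x)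
    {p : Lp ℂ 2 (volume : Measure (Cn d)) × Forms d} (hp : p ∈ adjointGraph D φ ψ) :
    ‖inner ℂ (weightedForm hD hφ hψ hα) p.2‖ ≤ ‖weightedForm hD hφ hψ hα‖ * ‖p.1‖ := by
  obtain ⟨g, hg, h1, h2⟩ := hp
  have hp2 : p.2 = weightedForm hD hφ hψ hg := by
    ext j : 1
    exact Lp.ext ((h2 j).trans (weightedForm_ae hD hφ hψ hg j).symm)
  obtain ⟨h, hw, hh⟩ := exists_weakPair hD hφ hψ hg
  have hσ := isTest_divForm hD hφ hψ hg
  have hτ : IsTest D (fun x => (Real.exp (-φ x / 2) : ℂ) * divForm φ ψ g x) :=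
    hσ.mul_left hD (contDiffOn_exp_ofReal (hφ.neg.div_const 2))
  have e : ∀ x, ‖divForm φ ψ g x‖ ^ 2 * Real.exp (-φ x) =
      ‖(Real.exp (-φ x / 2) : ℂ) * divForm φ ψ g x‖ ^ 2 := fun x => by
    rw [norm_mul, mul_pow, norm_exp_neg_half_sq, mul_comm]
  have hi : Integrable (fun x => ‖divForm φ ψ g x‖ ^ 2 * Real.exp (-φ x)) := by
    simp_rw [e]
    exact hτ.memLp.integrable_norm_pow (by norm_num)
  have hest := weak_estimate hD hφ hψ hL hσ.memLp hw hi hη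
  have hn : ‖p.1‖ ^ 2 = ∫ x, ‖divForm φ ψ g x‖ ^ 2 * Real.exp (-φ x) := by
    simp_rw [e]
    rw [← norm_toLp_sq hτ.memLp, ← norm_neg (hτ.memLp.toLp _)]
    congr 2
    refine Lp.ext (h1.trans ?_)
    filter_upwards [Lp.coeFn_neg (hτ.memLp.toLp _), hτ.memLp.coeFn_toLp] with x e1 e2
    rw [e1, Pi.neg_apply, e2]
  rw [hp2, hh α hα hcl]
  refine (norm_inner_weightedForm_le hD hφ hψ hα h).trans ?_
  gcongr
  exact Real.sqrt_le_iff.2 ⟨norm_nonneg _, hest.trans hn.ge⟩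

/-- Hörmander's `L²` theorem in the three weight form: a smooth function with compactly supported
`∂̄` can be corrected to a holomorphic one, with an estimate. -/
theorem hormander (hD : IsOpen D) (hφ : ContDiffOn ℝ ∞ φ D) (hψ : ContDiffOn ℝ ∞ ψ D)
    (hL : ∀ x ∈ D, ∀ v, 2 * (∑ j, ‖del j (fun y => (ψ y : ℂ)) x‖ ^ 2 + Real.exp (ψ x)) * ‖v‖ ^ 2
      ≤ levi φ x v) {η : ℕ → Cn d → ℝ} (hη : IsCutoffSeq D ψ η)
    {G : Cn d → ℂ} (hG : ContDiffOn ℝ ∞ G D) {C : Set (Cn d)} (hC : IsCompact C) (hCD : C ⊆ D)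
    (hGC : ∀ x ∈ D \ C, ∀ j, dbar j G x = 0) :
    ∃ F : Cn d → ℂ, DifferentiableOn ℂ F D ∧
      IntegrableOn (fun x => ‖F x - G x‖ ^ 2 * Real.exp (-(φ x - 2 * ψ x))) D ∧
      ∫ x in D, ‖F x - G x‖ ^ 2 * Real.exp (-(φ x - 2 * ψ x)) ≤
        ∫ x in D, (∑ j, ‖dbar j G x‖ ^ 2) * Real.exp (-(φ x - ψ x)) := by
  obtain ⟨χ, hχ, hχc, hχD, hχ1, -⟩ := exists_cutoff hD hC hCD
  have tχ : IsTest D (fun x => (χ x : ℂ)) := isTest_ofReal hχ hχc hχD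
  let α : Fin d → Cn d → ℂ := fun j x => dbar j G x * χ x
  have hα : ∀ j, IsTest D (α j) := fun j => tχ.mul_left hD (contDiffOn_dbar hD hG j)
  have hαG : ∀ j, ∀ x ∈ D, α j x = dbar j G x := fun j x hx => by
    by_cases hxC : x ∈ C
    · simp [α, (hχ1 x hxC).self_of_nhds]
    · simp [α, hGC x ⟨hx, hxC⟩ j]
  have hαθ : ∀ θ, IsTest D θ → ∀ j, ∫ x, α j x * θ x = ∫ x, dbar j G x * θ x :=
    fun θ hθ j => by
      congr 1; ext x
      by_cases hx : x ∈ D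
      · rw [hαG j x hx]
      · simp [hθ.eq_zero hx]
  have hcl : ∀ θ, IsTest D θ → ∀ j l, ∫ x, α l x * dbar j θ x = ∫ x, α j x * dbar l θ x :=
    fun θ hθ j l => by
      rw [hαθ _ (hθ.dbar j), hαθ _ (hθ.dbar l), integral_dbar_mul_dbar_comm hD hG hθ]
  obtain ⟨u, hu, hua⟩ := exists_dual_solution (adjointGraph D φ ψ) (norm_nonneg _)
    fun p hp => norm_inner_le_of_mem_adjointGraph hD hφ hψ hL hη hα hcl hp
  have hE : ContDiffOn ℝ ∞ (fun x => (Real.exp (φ x / 2 - ψ x) : ℂ)) D :=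
    contDiffOn_exp_ofReal ((hφ.div_const 2).sub hψ)
  have weak : ∀ θ, IsTest D θ → ∀ j, ∫ x, u x * ((Real.exp (φ x / 2 - ψ x) : ℂ) * dbar j θ x) =
      ∫ x, G x * dbar j θ x := fun θ hθ j => by
    have hβ : IsTest D (fun y => (Real.exp (φ y - ψ y) : ℂ) * conj (θ y)) :=
      hθ.conj.mul_left hD (contDiffOn_exp_ofReal (hφ.sub hψ))
    let g : Fin d → Cn d → ℂ := Pi.single j fun y => (Real.exp (φ y - ψ y) : ℂ) * conj (θ y)
    have hg : ∀ k, IsTest D (g k) := fun k => by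
      by_cases hk : k = j
      · subst hk; simpa [g] using hβ
      · simp only [g, Pi.single_eq_of_ne hk]
        exact IsTest.zero
    have hdiv : ∀ x, divForm φ ψ g x = (Real.exp (φ x - ψ x) : ℂ) * conj (dbar j θ x) :=
      fun x => by
        rw [divForm, Finset.sum_eq_single j]
        · by_cases hx : x ∈ D
          · have d1 := (hφ.contDiffAt (hD.mem_nhds hx)).differentiableAt (by simp)
            have d2 := (hψ.contDiffAt (hD.mem_nhds hx)).differentiableAt (by simp)
            simp only [g, Pi.single_eq_same]
            rw [del_exp_mul (d1.fun_sub d2) (hθ.conj.differentiableAt x),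
              del_conj (hθ.differentiableAt x), del_ofReal_sub d1 d2]
            ring
          · rw [((hg j).del j).eq_zero hx, (hg j).eq_zero hx, (hθ.dbar j).eq_zero hx]; simp
        · intro k _ hk
          simp [g, hk, del]
        · simp
    have hσ := isTest_divForm hD hφ hψ hg
    have hτ : IsTest D (fun x => (Real.exp (-φ x / 2) : ℂ) * divForm φ ψ g x) :=
      hσ.mul_left hD (contDiffOn_exp_ofReal (hφ.neg.div_const 2))
    have hmem : (-(hτ.memLp.toLp _), weightedForm hD hφ hψ hg) ∈ adjointGraph D φ ψ := by
      refine ⟨g, hg, ?_, weightedForm_ae hD hφ hψ hg⟩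
      filter_upwards [Lp.coeFn_neg (hτ.memLp.toLp _), hτ.memLp.coeFn_toLp] with x e1 e2
      rw [e1, Pi.neg_apply, e2]
    have k := congrArg conj (hua _ hmem)
    rw [inner_conj_symm, inner_conj_symm, inner_neg_left, inner_toLp_left, inner_weightedForm,
      Finset.sum_eq_single j] at k
    rotate_left
    · intro k _ hk; simp [g, hk]
    · simp
    have k2 : ∫ x, weightedForm hD hφ hψ hα j x *
        conj ((Real.exp (-(φ x - ψ x) / 2) : ℂ) * g j x) = ∫ x, α j x * θ x := by
      rw [← integral_mul_weightedForm hD hφ hψ hα]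
      congr 1; ext x
      simp only [g, Pi.single_eq_same]
      rw [← mul_assoc, exp_half_mul_self, map_mul, conj_ofReal, conj_conj]
      ring
    have k1 : ∫ x, u x * conj ((Real.exp (-φ x / 2) : ℂ) * divForm φ ψ g x) =
        ∫ x, u x * ((Real.exp (φ x / 2 - ψ x) : ℂ) * dbar j θ x) := by
      congr 1; ext x
      rw [hdiv, ← mul_assoc (Real.exp (-φ x / 2) : ℂ), ← ofReal_mul, ← Real.exp_add, map_mul,
        conj_ofReal, conj_conj]
      rw [show -φ x / 2 + (φ x - ψ x) = φ x / 2 - ψ x by ring]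
    rw [k1, k2, hαθ θ hθ] at k
    rw [integral_mul_dbar_test hD hG hθ, ← k, neg_neg]
  have hv : ∀ K ⊆ D, IsCompact K →
      MemLp (fun x => G x - (Real.exp (φ x / 2 - ψ x) : ℂ) * u x) 2 (volume.restrict K) := by
    intro K hKD hK
    obtain ⟨κ, hκ, hκc, hκD, hκ1, -⟩ := exists_cutoff hD hK hKD
    have tκ : IsTest D (fun x => (κ x : ℂ)) := isTest_ofReal hκ hκc hκD
    have t1 := tκ.mul_left hD hG
    have t2 := tκ.mul_left hD hE
    have := t1.memLp.sub (memLp_mul_of_hasCompactSupport (Lp.memLp u) t2.continuous t2.2)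
    refine (this.restrict K).ae_eq (ae_restrict_of_forall_mem hK.measurableSet fun x hx => ?_)
    simp [(hκ1 x hx).self_of_nhds]
  have hw : ∀ θ, ContDiff ℝ ∞ θ → HasCompactSupport θ → tsupport θ ⊆ D → ∀ j,
      ∫ x, (G x - (Real.exp (φ x / 2 - ψ x) : ℂ) * u x) * dbar j θ x = 0 := by
    intro θ h1 h2 h3 j
    have hθ : IsTest D θ := ⟨h1, h2, h3⟩
    have i1 : Integrable (fun x => G x * dbar j θ x) := ((hθ.dbar j).mul_left hD hG).integrable
    have i2 : Integrable (fun x => u x * ((Real.exp (φ x / 2 - ψ x) : ℂ) * dbar j θ x)) :=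
      ((hθ.dbar j).mul_left hD hE).integrable_mul (Lp.memLp u)
    rw [← sub_eq_zero.2 (weak θ hθ j).symm, ← integral_sub i1 i2]
    congr 1; ext x; ring
  obtain ⟨F, hF, hFv⟩ := exists_holomorphic_ae_eq hD hv hw
  have e : ∀ᵐ x ∂(volume.restrict D),
      ‖F x - G x‖ ^ 2 * Real.exp (-(φ x - 2 * ψ x)) = ‖u x‖ ^ 2 := by
    filter_upwards [hFv] with x hx
    rw [← hx, sub_sub_cancel_left, norm_neg, norm_mul, norm_real, Real.norm_eq_abs,
      Real.abs_exp, mul_pow, ← Real.exp_nat_mul, mul_right_comm, ← Real.exp_add]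
    rw [show ((2 : ℕ) : ℝ) * (φ x / 2 - ψ x) + -(φ x - 2 * ψ x) = 0 by push_cast; ring]
    simp
  have hui : Integrable (fun x => ‖u x‖ ^ 2) :=
    (Lp.memLp u).integrable_norm_pow (by norm_num)
  refine ⟨F, hF, hui.integrableOn.congr (e.mono fun x hx => hx.symm), ?_⟩
  rw [integral_congr_ae e]
  calc ∫ x in D, ‖u x‖ ^ 2 ≤ ∫ x, ‖u x‖ ^ 2 :=
        setIntegral_le_integral hui (Eventually.of_forall fun x => by positivity)
    _ = ‖u‖ ^ 2 := by rw [integral_norm_sq_eq (Lp.memLp u), Lp.norm_def]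
    _ ≤ ‖weightedForm hD hφ hψ hα‖ ^ 2 := by gcongr
    _ = ∫ x in D, (∑ j, ‖α j x‖ ^ 2) * Real.exp (-(φ x - ψ x)) := norm_weightedForm_sq ..
    _ = _ := setIntegral_congr_fun hD.measurableSet fun x hx => by simp only [hαG _ x hx]

end HormanderTheorem

end SCV

namespace SCV

open MeasureTheory Filter Topology
open scoped ContDiff ENNReal NNReal Convolution ComplexConjugate

section Levi

variable {d : ℕ}

lemma fderiv_fderiv_comp {h : ℝ → ℝ} {s : Cn d → ℝ} {x : Cn d} (hh : ContDiffAt ℝ 2 h (s x))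
    (hs : ContDiffAt ℝ 2 s x) (v : Cn d) :
    fderiv ℝ (fun y => fderiv ℝ (fun z => h (s z)) y v) x v =
      deriv h (s x) * fderiv ℝ (fun y => fderiv ℝ s y v) x v +
        deriv (deriv h) (s x) * fderiv ℝ s x v ^ 2 := by
  have hs1 : ∀ᶠ y in 𝓝 x, DifferentiableAt ℝ s y :=
    (hs.eventually (by simp)).mono fun y hy => hy.differentiableAt (by norm_num)
  have hh1 : ∀ᶠ y in 𝓝 x, DifferentiableAt ℝ h (s y) :=
    hs.continuousAt.eventually ((hh.eventually (by simp)).mono fun y hy =>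
      hy.differentiableAt (by norm_num))
  have e : (fun y => fderiv ℝ (fun z => h (s z)) y v) =ᶠ[𝓝 x]
      fun y => deriv h (s y) * fderiv ℝ s y v := by
    filter_upwards [hs1, hh1] with y h1 h2
    have := (h2.hasDerivAt.comp_hasFDerivAt y h1.hasFDerivAt).fderiv
    change fderiv ℝ (h ∘ s) y v = _
    rw [this]; simp
  rw [e.fderiv_eq]
  have d1 : DifferentiableAt ℝ (fun y => fderiv ℝ s y v) x :=
    ((hs.fderiv_right (m := 1) (by norm_num)).differentiableAt (by norm_num)).clm_apply
      (differentiableAt_const v)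
  have d2 : DifferentiableAt ℝ (deriv h) (s x) := by
    have := (hh.fderiv_right (m := 1) (by norm_num)).differentiableAt (by norm_num)
    exact this.clm_apply (differentiableAt_const 1)
  have d3 : HasFDerivAt (fun y => deriv h (s y)) (deriv (deriv h) (s x) • fderiv ℝ s x) x :=
    d2.hasDerivAt.comp_hasFDerivAt x hs1.self_of_nhds.hasFDerivAt
  rw [fderiv_fun_mul d3.differentiableAt d1, d3.fderiv]
  simp only [add_apply, smul_apply, smul_eq_mul]
  ring

lemma levi_comp {h : ℝ → ℝ} {s : Cn d → ℝ} {x : Cn d} (hh : ContDiffAt ℝ 2 h (s x))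
    (hs : ContDiffAt ℝ 2 s x) (v : Cn d) :
    levi (fun z => h (s z)) x v = deriv h (s x) * levi s x v +
      (1 / 4) * (deriv (deriv h) (s x) * (fderiv ℝ s x v ^ 2 + fderiv ℝ s x (I • v) ^ 2)) := by
  simp only [levi, fderiv_fderiv_comp hh hs]
  ring

lemma levi_add {f g : Cn d → ℝ} {x : Cn d} (hf : ContDiffAt ℝ 2 f x)
    (hg : ContDiffAt ℝ 2 g x) (v : Cn d) :
    levi (fun z => f z + g z) x v = levi f x v + levi g x v := by
  have key : ∀ v, fderiv ℝ (fun y => fderiv ℝ (fun z => f z + g z) y v) x v =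
      fderiv ℝ (fun y => fderiv ℝ f y v) x v + fderiv ℝ (fun y => fderiv ℝ g y v) x v := by
    intro v
    have hf1 : ∀ᶠ y in 𝓝 x, DifferentiableAt ℝ f y :=
      (hf.eventually (by simp)).mono fun y hy => hy.differentiableAt (by norm_num)
    have hg1 : ∀ᶠ y in 𝓝 x, DifferentiableAt ℝ g y :=
      (hg.eventually (by simp)).mono fun y hy => hy.differentiableAt (by norm_num)
    have e : (fun y => fderiv ℝ (fun z => f z + g z) y v) =ᶠ[𝓝 x]
        fun y => fderiv ℝ f y v + fderiv ℝ g y v := by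
      filter_upwards [hf1, hg1] with y h1 h2
      rw [fderiv_fun_add h1 h2, add_apply]
    have d1 : ∀ f : Cn d → ℝ, ContDiffAt ℝ 2 f x → DifferentiableAt ℝ (fun y => fderiv ℝ f y v) x :=
      fun f hf => ((hf.fderiv_right (m := 1) (by norm_num)).differentiableAt (by norm_num)).clm_apply
        (differentiableAt_const v)
    rw [e.fderiv_eq, fderiv_fun_add (d1 f hf) (d1 g hg), add_apply]
  simp only [levi, key]
  ring

end Levi

section Exhaustion

variable {d : ℕ} {D : Set (Cn d)} {s : Cn d → ℝ}

/-- A smooth strictly plurisubharmonic exhaustion function whose gradient is controlled. -/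
structure IsExhaustion (D : Set (Cn d)) (s : Cn d → ℝ) : Prop where
  contDiffOn : ContDiffOn ℝ ∞ s D
  levi_ge : ∀ x ∈ D, ∀ v, ‖v‖ ^ 2 ≤ levi s x v
  compact : ∀ c, IsCompact {x | x ∈ D ∧ s x ≤ c}
  grad : ∃ C, ∀ x ∈ D, ‖fderiv ℝ s x‖ ≤ C * Real.exp (s x)

lemma IsExhaustion.exists_lower_bound (hs : IsExhaustion D s) : ∃ m, ∀ x ∈ D, m ≤ s x := by
  obtain ⟨m, hm⟩ := (hs.compact 0).bddBelow_image (hs.contDiffOn.continuousOn.mono fun x hx => hx.1)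
  refine ⟨min m 0, fun x hx => ?_⟩
  rcases le_or_gt (s x) 0 with h | h
  · exact (min_le_left _ _).trans (hm ⟨x, ⟨hx, h⟩, rfl⟩)
  · exact (min_le_right _ _).trans h.le

/-- Cutting off along the sublevel sets of the exhaustion. -/
lemma IsExhaustion.cutoff (hD : IsOpen D) (hs : IsExhaustion D s) {ρ : ℝ → ℝ}
    (hρ : ContDiff ℝ ∞ ρ) {c : ℝ} (hc : ∀ t, c ≤ t → ρ t = 0) :
    ContDiff ℝ ∞ (D.indicator fun x => ρ (s x)) ∧
    HasCompactSupport (D.indicator fun x => ρ (s x)) ∧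
    tsupport (D.indicator fun x => ρ (s x)) ⊆ {x | x ∈ D ∧ s x ≤ c} := by
  have h1 : Function.support (D.indicator fun x => ρ (s x)) ⊆ {x | x ∈ D ∧ s x ≤ c} := by
    intro x hx
    rw [Function.mem_support] at hx
    by_cases hxD : x ∈ D
    · refine ⟨hxD, ?_⟩
      by_contra h
      rw [indicator_of_mem hxD] at hx
      exact hx (hc _ (not_le.1 h).le)
    · exact absurd (indicator_of_notMem hxD _) hx
  have h2 := closure_minimal h1 (hs.compact c).isClosed
  refine ⟨contDiff_iff_contDiffAt.2 fun x => ?_, (hs.compact c).of_isClosed_subset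
    (isClosed_tsupport _) h2, h2⟩
  by_cases hx : x ∈ D
  · have : (D.indicator fun x => ρ (s x)) =ᶠ[𝓝 x] fun x => ρ (s x) := by
      filter_upwards [hD.mem_nhds hx] with y hy using indicator_of_mem hy _
    exact ((hρ.contDiffAt).comp x (hs.contDiffOn.contDiffAt (hD.mem_nhds hx))).congr_of_eventuallyEq
      this
  · have : (D.indicator fun x => ρ (s x)) =ᶠ[𝓝 x] fun _ => 0 := by
      filter_upwards [(hs.compact c).isClosed.isOpen_compl.mem_nhds fun h => hx h.1] with y hy
      by_contra h
      exact hy (h1 h)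
    exact contDiffAt_const.congr_of_eventuallyEq this

lemma norm_del_ofReal_le {f : Cn d → ℝ} {x : Cn d} (hf : DifferentiableAt ℝ f x) (j : Fin d) :
    ‖del j (fun y => (f y : ℂ)) x‖ ≤ ‖fderiv ℝ f x‖ := by
  have hn : ‖(ee j : Cn d)‖ = 1 := by simp [ee]
  have hn' : ‖(I • ee j : Cn d)‖ = 1 := by rw [norm_smul, hn]; simp
  rw [del, fderiv_ofReal_comp hf, fderiv_ofReal_comp hf]
  have h1 := (fderiv ℝ f x).le_opNorm (ee j)
  have h0 : ‖(1 / 2 : ℂ)‖ = 1 / 2 := by norm_num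
  have h2 := (fderiv ℝ f x).le_opNorm (I • ee j)
  rw [hn, mul_one] at h1
  rw [hn', mul_one] at h2
  calc _ ≤ ‖(1 / 2 : ℂ)‖ * (‖((fderiv ℝ f x (ee j) : ℝ) : ℂ)‖ +
        ‖I * ((fderiv ℝ f x (I • ee j) : ℝ) : ℂ)‖) := by
        rw [norm_mul]; gcongr; exact norm_sub_le _ _
    _ ≤ (1 / 2) * (‖fderiv ℝ f x‖ + ‖fderiv ℝ f x‖) := by
        rw [norm_mul, norm_I, one_mul, norm_real, norm_real, h0]
        gcongr
    _ = _ := by ring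

/-- A fixed smooth step function together with a bound for its derivative. -/
lemma exists_smooth_step : ∃ θ : ℝ → ℝ, ContDiff ℝ ∞ θ ∧ (∀ t, θ t ∈ Icc (0 : ℝ) 1) ∧
    (∀ t ≤ 1, θ t = 1) ∧ (∀ t, 2 ≤ t → θ t = 0) ∧ ∃ C, ∀ t, |deriv θ t| ≤ C := by
  have h1 : ContDiff ℝ ∞ (fun t : ℝ => Real.smoothTransition (2 - t)) :=
    Real.smoothTransition.contDiff.comp (contDiff_const.sub contDiff_id)
  refine ⟨_, h1, fun t => ⟨Real.smoothTransition.nonneg _, Real.smoothTransition.le_one _⟩,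
    fun t ht => Real.smoothTransition.one_of_one_le (by linarith),
    fun t ht => Real.smoothTransition.zero_of_nonpos (by linarith), ?_⟩
  have hc : Continuous (deriv fun t : ℝ => Real.smoothTransition (2 - t)) :=
    h1.continuous_deriv (by simp)
  obtain ⟨C, hC⟩ := (isCompact_Icc (a := (1 : ℝ)) (b := 2)).exists_bound_of_continuousOn
    hc.continuousOn
  refine ⟨max C 0, fun t => ?_⟩
  by_cases h : t ∈ Icc (1 : ℝ) 2
  · exact (hC t h).trans (le_max_left _ _)
  · have : deriv (fun t : ℝ => Real.smoothTransition (2 - t)) t = 0 := by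
      rw [mem_Icc, not_and_or, not_le, not_le] at h
      rcases h with h | h
      · have : (fun t : ℝ => Real.smoothTransition (2 - t)) =ᶠ[𝓝 t] fun _ => 1 := by
          filter_upwards [Iio_mem_nhds h] with y hy
          exact Real.smoothTransition.one_of_one_le (by linarith [mem_Iio.1 hy])
        rw [this.deriv_eq, deriv_const]
      · have : (fun t : ℝ => Real.smoothTransition (2 - t)) =ᶠ[𝓝 t] fun _ => 0 := by
          filter_upwards [Ioi_mem_nhds h] with y hy
          exact Real.smoothTransition.zero_of_nonpos (by linarith [mem_Ioi.1 hy])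
        rw [this.deriv_eq, deriv_const]
    rw [this, abs_zero]; exact le_max_right _ _

lemma IsExhaustion.exists_cutoffSeq (hD : IsOpen D) (hs : IsExhaustion D s) :
    ∃ (C : ℝ) (η : ℕ → Cn d → ℝ), IsCutoffSeq D (fun x => 2 * s x + C) η := by
  obtain ⟨θ, hθ, hθ01, hθ1, hθ0, T, hT⟩ := exists_smooth_step
  obtain ⟨B, hB⟩ := hs.grad
  have hρ : ∀ n : ℕ, ContDiff ℝ ∞ (fun t : ℝ => θ (t / (n + 1))) := fun n =>
    hθ.comp (contDiff_id.div_const _)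
  have hρ0 : ∀ n : ℕ, ∀ t : ℝ, 2 * ((n : ℝ) + 1) ≤ t → θ (t / (n + 1)) = 0 := fun n t ht =>
    hθ0 _ (by rwa [le_div_iff₀ (by positivity)])
  refine ⟨Real.log (d * (T * B) ^ 2 + 1), fun n => D.indicator fun x => θ (s x / (n + 1)),
    fun n => (hs.cutoff hD (hρ n) (hρ0 n)).1, fun n => (hs.cutoff hD (hρ n) (hρ0 n)).2.1,
    fun n => (hs.cutoff hD (hρ n) (hρ0 n)).2.2.trans fun x hx => hx.1, fun n x => ?_,
    fun x hx => ?_, fun n x hx => ?_⟩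
  · by_cases hx : x ∈ D
    · rw [indicator_of_mem hx]; exact hθ01 _
    · rw [indicator_of_notMem hx]; simp
  · refine tendsto_const_nhds.congr' ?_
    filter_upwards [eventually_ge_atTop ⌈s x⌉₊] with n hn
    rw [indicator_of_mem hx, hθ1]
    rw [div_le_one (by positivity)]
    exact (Nat.le_ceil _).trans (by exact_mod_cast hn.trans (Nat.le_succ n))
  · have hds := (hs.contDiffOn.contDiffAt (hD.mem_nhds hx)).differentiableAt (by simp)
    have e : (D.indicator fun x => θ (s x / (n + 1))) =ᶠ[𝓝 x] fun x => θ (s x / (n + 1)) := by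
      filter_upwards [hD.mem_nhds hx] with y hy using indicator_of_mem hy _
    have hf : HasFDerivAt (D.indicator fun x => θ (s x / (n + 1)))
        ((deriv θ (s x / (n + 1)) * (1 / (n + 1))) • fderiv ℝ s x) x := by
      refine HasFDerivAt.congr_of_eventuallyEq ?_ e
      have h1 : HasDerivAt θ (deriv θ (s x / (n + 1))) (s x / (n + 1)) :=
        (hθ.differentiable (by simp) _).hasDerivAt
      have h2 : HasDerivAt (fun t : ℝ => θ (t / (n + 1)))
          (deriv θ (s x / (n + 1)) * (1 / (n + 1))) (s x) :=
        h1.comp (s x) ((hasDerivAt_id (s x)).div_const _)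
      exact h2.comp_hasFDerivAt x hds.hasFDerivAt
    have hn : ‖fderiv ℝ (D.indicator fun x => θ (s x / (n + 1))) x‖ ≤
        1 / (n + 1) * (T * B * Real.exp (s x)) := by
      rw [hf.fderiv, norm_smul, Real.norm_eq_abs, abs_mul, abs_of_pos (a := 1 / ((n : ℝ) + 1))
        (by positivity)]
      have hT0 : 0 ≤ T := (abs_nonneg _).trans (hT 0)
      calc |deriv θ (s x / (n + 1))| * (1 / (n + 1)) * ‖fderiv ℝ s x‖
          ≤ T * (1 / (n + 1)) * (B * Real.exp (s x)) := by
            gcongr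
            · exact hT _
            · exact hB x hx
        _ = _ := by ring
    calc _ ≤ ∑ j : Fin d, (1 / ((n : ℝ) + 1) * (T * B * Real.exp (s x))) ^ 2 := by
          refine Finset.sum_le_sum fun j _ => ?_
          gcongr
          exact (norm_del_ofReal_le hf.differentiableAt j).trans hn
      _ = (1 / ((n : ℝ) + 1)) ^ 2 * (d * (T * B) ^ 2 * Real.exp (2 * s x)) := by
          rw [Finset.sum_const, Finset.card_univ, Fintype.card_fin, nsmul_eq_mul, two_mul,
            Real.exp_add]
          ring
      _ ≤ _ := by
          rw [Real.exp_add, Real.exp_log (by positivity)]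
          refine mul_le_mul_of_nonneg_left ?_ (by positivity)
          rw [mul_comm]
          exact mul_le_mul_of_nonneg_left (by linarith) (Real.exp_nonneg _)

end Exhaustion

end SCV

namespace SCV

open MeasureTheory Filter Topology
open scoped ContDiff ENNReal NNReal Convolution ComplexConjugate

section Weights

variable {d : ℕ} {D : Set (Cn d)} {s : Cn d → ℝ}

lemma IsExhaustion.exists_weights (hD : IsOpen D) (hs : IsExhaustion D s) :
    ∃ w₁ w₂ : Cn d → ℝ, ContinuousOn w₁ D ∧ ContinuousOn w₂ D ∧
      ∀ p : Cn d → ℝ, ContDiffOn ℝ ∞ p D → (∀ x ∈ D, ∀ v, 0 ≤ levi p x v) →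
      ∀ G : Cn d → ℂ, ContDiffOn ℝ ∞ G D → ∀ C, IsCompact C → C ⊆ D →
      (∀ x ∈ D \ C, ∀ j, dbar j G x = 0) →
      ∃ F : Cn d → ℂ, DifferentiableOn ℂ F D ∧
        IntegrableOn (fun x => ‖F x - G x‖ ^ 2 * Real.exp (-p x - w₁ x)) D ∧
        ∫ x in D, ‖F x - G x‖ ^ 2 * Real.exp (-p x - w₁ x) ≤
          ∫ x in D, (∑ j, ‖dbar j G x‖ ^ 2) * Real.exp (-p x - w₂ x) := by
  obtain ⟨c, η, hη⟩ := hs.exists_cutoffSeq hD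
  obtain ⟨m, hm⟩ := hs.exists_lower_bound
  obtain ⟨A, hA⟩ := hs.grad
  set K : ℝ := 2 * (4 * d * A ^ 2 + Real.exp c) with hK
  have hK0 : 0 ≤ K := by positivity
  set B : ℝ := K * Real.exp (-m) with hB
  have hB0 : 0 ≤ B := by positivity
  have hsc := hs.contDiffOn.continuousOn
  have hψ : ContDiffOn ℝ ∞ (fun x => 2 * s x + c) D :=
    (contDiffOn_const.mul hs.contDiffOn).add contDiffOn_const
  have hh : ContDiff ℝ ∞ (fun t : ℝ => B * Real.exp (3 * t)) :=
    contDiff_const.mul (contDiff_const.mul contDiff_id).exp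
  have hd1 : deriv (fun t : ℝ => B * Real.exp (3 * t)) = fun t => 3 * B * Real.exp (3 * t) := by
    ext t
    have : HasDerivAt (fun t : ℝ => B * Real.exp (3 * t)) (B * (Real.exp (3 * t) * (3 * 1))) t :=
      (((hasDerivAt_id t).const_mul 3).exp).const_mul B
    rw [this.deriv]; ring
  have hd2 : ∀ t, deriv (deriv (fun t : ℝ => B * Real.exp (3 * t))) t =
      9 * B * Real.exp (3 * t) := by
    intro t
    rw [hd1]
    have : HasDerivAt (fun t : ℝ => 3 * B * Real.exp (3 * t))
        (3 * B * (Real.exp (3 * t) * (3 * 1))) t :=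
      (((hasDerivAt_id t).const_mul 3).exp).const_mul (3 * B)
    rw [this.deriv]; ring
  have hφ0 : ContDiffOn ℝ ∞ (fun x => B * Real.exp (3 * s x)) D := hh.comp_contDiffOn hs.contDiffOn
  refine ⟨fun x => B * Real.exp (3 * s x) - 2 * (2 * s x + c),
    fun x => B * Real.exp (3 * s x) - (2 * s x + c), ?_, ?_, fun p hp hpl G hG C hC hCD hGC => ?_⟩
  · exact hφ0.continuousOn.sub (continuousOn_const.mul hψ.continuousOn)
  · exact hφ0.continuousOn.sub hψ.continuousOn
  have hφ : ContDiffOn ℝ ∞ (fun x => B * Real.exp (3 * s x) + p x) D := hφ0.add hp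
  have hL : ∀ x ∈ D, ∀ v, 2 * (∑ j, ‖del j (fun y => ((2 * s y + c : ℝ) : ℂ)) x‖ ^ 2 +
      Real.exp (2 * s x + c)) * ‖v‖ ^ 2 ≤ levi (fun x => B * Real.exp (3 * s x) + p x) x v := by
    intro x hx v
    have hsx := hs.contDiffOn.contDiffAt (hD.mem_nhds hx)
    have hds : DifferentiableAt ℝ s x := hsx.differentiableAt (by simp)
    have h2 : (2 : WithTop ℕ∞) ≤ ((⊤ : ℕ∞) : WithTop ℕ∞) := two_le_infty
    rw [levi_add ((hφ0.contDiffAt (hD.mem_nhds hx)).of_le h2)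
      ((hp.contDiffAt (hD.mem_nhds hx)).of_le h2),
      levi_comp (h := fun t : ℝ => B * Real.exp (3 * t)) (hh.contDiffAt.of_le h2) (hsx.of_le h2),
      hd2, hd1]
    have hf : fderiv ℝ (fun x => 2 * s x + c) x = (2 : ℝ) • fderiv ℝ s x := by
      rw [fderiv_add_const, fderiv_const_mul hds]
    have h1 : ∑ j, ‖del j (fun y => ((2 * s y + c : ℝ) : ℂ)) x‖ ^ 2 ≤
        4 * d * A ^ 2 * Real.exp (2 * s x) := by
      calc _ ≤ ∑ j : Fin d, (2 * (A * Real.exp (s x))) ^ 2 := by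
            refine Finset.sum_le_sum fun j _ => ?_
            gcongr
            refine (norm_del_ofReal_le ((hds.const_mul 2).add_const c) j).trans ?_
            rw [hf, norm_smul, Real.norm_ofNat]
            gcongr
            exact hA x hx
        _ = _ := by
            rw [Finset.sum_const, Finset.card_univ, Fintype.card_fin, nsmul_eq_mul, two_mul (s x),
              Real.exp_add]
            ring
    have h3 : 2 * (∑ j, ‖del j (fun y => ((2 * s y + c : ℝ) : ℂ)) x‖ ^ 2 +
        Real.exp (2 * s x + c)) ≤ 3 * B * Real.exp (3 * s x) := by
      have e1 : K * Real.exp (2 * s x) ≤ B * Real.exp (3 * s x) := by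
        rw [hB, mul_assoc K, ← Real.exp_add]
        refine mul_le_mul_of_nonneg_left (Real.exp_le_exp.2 ?_) hK0
        linarith [hm x hx]
      have e2 : 0 ≤ B * Real.exp (3 * s x) := by positivity
      rw [Real.exp_add (2 * s x)]
      have e3 : K * Real.exp (2 * s x) = 2 * (4 * d * A ^ 2 * Real.exp (2 * s x) +
        Real.exp (2 * s x) * Real.exp c) := by rw [hK]; ring
      linarith
    have h4 := hs.levi_ge x hx v
    have h5 := hpl x hx v
    have h6 : 3 * B * Real.exp (3 * s x) * ‖v‖ ^ 2 ≤ 3 * B * Real.exp (3 * s x) * levi s x v := by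
      gcongr
    have h7 : 0 ≤ (1 / 4 : ℝ) * (9 * B * Real.exp (3 * s x) *
        (fderiv ℝ s x v ^ 2 + fderiv ℝ s x (I • v) ^ 2)) := by positivity
    have h8 := mul_le_mul_of_nonneg_right h3 (sq_nonneg ‖v‖)
    linarith
  obtain ⟨F, hF, hi, hle⟩ := hormander hD hφ hψ hL hη hG hC hCD hGC
  have e1 : ∀ x, -p x - (B * Real.exp (3 * s x) - 2 * (2 * s x + c)) =
      -(B * Real.exp (3 * s x) + p x - 2 * (2 * s x + c)) := fun x => by ring
  have e2 : ∀ x, -p x - (B * Real.exp (3 * s x) - (2 * s x + c)) =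
      -(B * Real.exp (3 * s x) + p x - (2 * s x + c)) := fun x => by ring
  simp only [e1, e2]
  exact ⟨F, hF, hi, hle⟩

lemma exists_norm_sq_le_setIntegral (d : ℕ) {δ : ℝ} (hδ : 0 < δ) :
    ∃ B : ℝ, 0 ≤ B ∧ ∀ (H : Cn d → ℂ) (z : Cn d), DifferentiableOn ℂ H (ball z (2 * δ)) →
      ‖H z‖ ^ 2 ≤ B * ∫ x in ball z δ, ‖H x‖ ^ 2 := by
  obtain ⟨B, hB⟩ := (mol_hasCompactSupport (d := d) hδ).exists_bound_of_continuous
    (mol_contDiff δ).continuous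
  have hB0 : 0 ≤ B := (norm_nonneg _).trans (hB 0)
  refine ⟨B, hB0, fun H z hH => ?_⟩
  have hcb : closedBall z δ ⊆ ball z (2 * δ) := closedBall_subset_ball (by linarith)
  have hInt : IntegrableOn (fun x => ‖H x‖ ^ 2) (ball z δ) :=
    (((hH.continuousOn.mono hcb).norm.pow 2).integrableOn_compact
      (isCompact_closedBall z δ)).mono_set ball_subset_closedBall
  have hmv := mol_meanValue isOpen_ball (f := fun x => H x ^ 2) (hH.pow 2) hδ hcb
  have e : ∀ t, ‖mol δ t • H (z - t) ^ 2‖ ≤ B * (ball z δ).indicator (fun x => ‖H x‖ ^ 2) (z - t) := by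
    intro t
    by_cases ht : ‖t‖ < δ
    · have : z - t ∈ ball z δ := by simpa using ht
      rw [indicator_of_mem this, norm_smul, norm_pow]
      gcongr
      exact hB t
    · have h1 : z - t ∉ ball z δ := by simpa using ht
      rw [mol_eq_zero hδ (not_lt.1 ht), indicator_of_notMem h1]
      simp
  have hi : Integrable (fun t => B * (ball z δ).indicator (fun x => ‖H x‖ ^ 2) (z - t)) :=
    (((integrable_indicator_iff isOpen_ball.measurableSet).2 hInt).comp_sub_left z).const_mul B
  calc ‖H z‖ ^ 2 = ‖∫ t, mol δ t • H (z - t) ^ 2‖ := by rw [hmv, norm_pow]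
    _ ≤ ∫ t, B * (ball z δ).indicator (fun x => ‖H x‖ ^ 2) (z - t) :=
        norm_integral_le_of_norm_le hi (Eventually.of_forall e)
    _ = B * ∫ x in ball z δ, ‖H x‖ ^ 2 := by
        rw [integral_const_mul, integral_sub_left_eq_self
          (fun t => (ball z δ).indicator (fun x => ‖H x‖ ^ 2) t) volume z,
          integral_indicator isOpen_ball.measurableSet]

/-- Holomorphic correction with pointwise bounds governed by an arbitrary plurisubharmonic
weight. -/
theorem IsExhaustion.exists_correction (hD : IsOpen D) (hs : IsExhaustion D s) {L C : Set (Cn d)}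
    (hL : IsCompact L) (hLD : L ⊆ D) (hC : IsCompact C) (hCD : C ⊆ D) {δ : ℝ} (hδ : 0 < δ) :
    ∃ A : ℝ, 0 < A ∧ ∀ (p : Cn d → ℝ) (G : Cn d → ℂ) (M : ℝ), 0 ≤ M → ContDiffOn ℝ ∞ p D →
      (∀ x ∈ D, ∀ v, 0 ≤ levi p x v) → ContDiffOn ℝ ∞ G D →
      (∀ x ∈ D \ C, ∀ j, dbar j G x = 0) →
      (∀ x ∈ C, (∑ j, ‖dbar j G x‖ ^ 2) * Real.exp (-p x) ≤ M) →
      ∃ F : Cn d → ℂ, DifferentiableOn ℂ F D ∧ ∀ z ∈ L, ∀ m : ℝ,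
        DifferentiableOn ℂ G (ball z δ) → (∀ x ∈ ball z δ, p x ≤ m) →
        ‖F z - G z‖ ^ 2 ≤ A * M * Real.exp m := by
  obtain ⟨w₁, w₂, hw₁, hw₂, key⟩ := hs.exists_weights hD
  obtain ⟨ε, hε, hεD⟩ := hL.exists_cthickening_subset_open hD hLD
  set r := min ε (δ / 2) / 2 with hr
  have hr0 : 0 < r := by positivity
  have hrε : 2 * r ≤ ε := by rw [hr]; linarith [min_le_left ε (δ / 2)]
  have hrδ : 2 * r ≤ δ := by rw [hr]; linarith [min_le_right ε (δ / 2)]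
  obtain ⟨B, hB0, hB⟩ := exists_norm_sq_le_setIntegral d hr0
  have hLε : IsCompact (cthickening ε L) := hL.cthickening
  obtain ⟨W₁, hW₁⟩ := hLε.bddAbove_image (hw₁.mono hεD)
  obtain ⟨W₂, hW₂⟩ := hC.bddBelow_image (hw₂.mono hCD)
  have hVol : 0 ≤ volume.real C := measureReal_nonneg
  refine ⟨B * Real.exp W₁ * (Real.exp (-W₂) * volume.real C) + 1, by positivity,
    fun p G M hM0 hp hpl hG hGC hM => ?_⟩
  obtain ⟨F, hF, hi, hle⟩ := key p hp hpl G hG C hC hCD hGC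
  refine ⟨F, hF, fun z hz m hGz hpz => ?_⟩
  have hballD : ball z (2 * r) ⊆ D := fun x hx => hεD
    (closedBall_subset_cthickening hz ε (ball_subset_closedBall (ball_subset_ball hrε hx)))
  have hrr : ball z r ⊆ ball z (2 * r) := ball_subset_ball (by linarith)
  have hM' : ∫ x in D, (∑ j, ‖dbar j G x‖ ^ 2) * Real.exp (-p x - w₂ x) ≤
      M * Real.exp (-W₂) * volume.real C := by
    have e1 : ∫ x in D, (∑ j, ‖dbar j G x‖ ^ 2) * Real.exp (-p x - w₂ x) =
        ∫ x in C, (∑ j, ‖dbar j G x‖ ^ 2) * Real.exp (-p x - w₂ x) :=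
      setIntegral_eq_of_subset_of_forall_sdiff_eq_zero hD.measurableSet hCD
        fun x hx => by simp [hGC x hx]
    rw [e1]
    have hfin : volume C < ⊤ := hC.measure_lt_top
    have hb : ∀ x ∈ C, ‖(∑ j, ‖dbar j G x‖ ^ 2) * Real.exp (-p x - w₂ x)‖ ≤
        M * Real.exp (-W₂) := fun x hx => by
      rw [Real.norm_of_nonneg (by positivity), sub_eq_add_neg, Real.exp_add, ← mul_assoc]
      gcongr
      · exact hM x hx
      · exact hW₂ ⟨x, hx, rfl⟩
    exact (Real.le_norm_self _).trans (norm_setIntegral_le_of_norm_le_const hfin hb)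
  have hH : DifferentiableOn ℂ (fun x => F x - G x) (ball z (2 * r)) :=
    (hF.mono hballD).sub (hGz.mono (ball_subset_ball hrδ))
  have h1 := hB _ z hH
  have hcb : closedBall z r ⊆ ball z (2 * r) := closedBall_subset_ball (by linarith)
  have hInt : IntegrableOn (fun x => ‖F x - G x‖ ^ 2) (ball z r) :=
    (((hH.continuousOn.mono hcb).norm.pow 2).integrableOn_compact
      (isCompact_closedBall z r)).mono_set ball_subset_closedBall
  have h2 : ∫ x in ball z r, ‖F x - G x‖ ^ 2 ≤ Real.exp m * Real.exp W₁ *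
      ∫ x in D, ‖F x - G x‖ ^ 2 * Real.exp (-p x - w₁ x) := by
    rw [← integral_const_mul]
    refine (setIntegral_mono_on hInt ((hi.mono_set (hrr.trans hballD)).const_mul _)
      isOpen_ball.measurableSet fun x hx => ?_).trans
      (setIntegral_mono_set (hi.const_mul _) (ae_of_all _ fun x => by positivity)
        (hrr.trans hballD).eventuallyLE)
    have hx1 : p x ≤ m := hpz x (ball_subset_ball hrδ (hrr hx))
    have hx2 : w₁ x ≤ W₁ := hW₁ ⟨x, closedBall_subset_cthickening hz ε
      (ball_subset_closedBall (ball_subset_ball hrε (hrr hx))), rfl⟩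
    have : 1 ≤ Real.exp m * Real.exp W₁ * Real.exp (-p x - w₁ x) := by
      rw [← Real.exp_add, ← Real.exp_add]
      exact Real.one_le_exp (by linarith)
    nlinarith [sq_nonneg ‖F x - G x‖]
  calc ‖F z - G z‖ ^ 2 ≤ B * ∫ x in ball z r, ‖F x - G x‖ ^ 2 := h1
    _ ≤ B * (Real.exp m * Real.exp W₁ * (M * Real.exp (-W₂) * volume.real C)) := by
        gcongr
        exact h2.trans (by gcongr; exact hle.trans hM')
    _ = B * Real.exp W₁ * (Real.exp (-W₂) * volume.real C) * M * Real.exp m := by ring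
    _ ≤ _ := by
        have : 0 ≤ M * Real.exp m := by positivity
        linarith

end Weights

end SCV

namespace SCV

open MeasureTheory Filter Topology
open scoped ContDiff ENNReal NNReal Convolution ComplexConjugate

section LeviPolynomial

variable {d : ℕ}

lemma taylor_lower_bound {s : Cn d → ℝ} {a : Cn d} (hs : ContDiffAt ℝ 2 s a) {ε : ℝ}
    (hε : 0 < ε) : ∀ᶠ z in 𝓝 a, s a + fderiv ℝ s a (z - a) +
      (1 / 2) * fderiv ℝ (fderiv ℝ s) a (z - a) (z - a) - ε * ‖z - a‖ ^ 2 ≤ s z := by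
  have h1 : HasFDerivAt (fderiv ℝ s) (fderiv ℝ (fderiv ℝ s) a) a :=
    ((hs.fderiv_right (m := 1) (by norm_num)).differentiableAt (by norm_num)).hasFDerivAt
  have h2 : ∀ᶠ y in 𝓝 a, DifferentiableAt ℝ s y :=
    (hs.eventually (by simp)).mono fun y hy => hy.differentiableAt (by norm_num)
  have h3 := h1.isLittleO.def (c := 2 * ε) (by positivity)
  obtain ⟨r, hr, hrb⟩ := Metric.eventually_nhds_iff_ball.1 (h2.and h3)
  filter_upwards [ball_mem_nhds a hr] with z hz
  set w := z - a with hw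
  set H := fderiv ℝ (fderiv ℝ s) a
  have hmem : ∀ t ∈ Icc (0 : ℝ) 1, a + t • w ∈ ball a r := fun t ht => by
    rw [mem_ball_iff_norm, add_sub_cancel_left, norm_smul, Real.norm_of_nonneg ht.1]
    rw [mem_ball_iff_norm] at hz
    nlinarith [norm_nonneg w, ht.2]
  let g : ℝ → ℝ := fun t => s (a + t • w) - t * fderiv ℝ s a w - t ^ 2 / 2 * H w w +
    t ^ 2 * (ε * ‖w‖ ^ 2)
  have hg : ∀ t ∈ Icc (0 : ℝ) 1, HasDerivAt g (fderiv ℝ s (a + t • w) w - fderiv ℝ s a w -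
      t * H w w + 2 * t * (ε * ‖w‖ ^ 2)) t := fun t ht => by
    have e1 : HasDerivAt (fun t : ℝ => a + t • w) w t := by
      simpa using ((hasDerivAt_id t).smul_const w).const_add a
    have e2 := (hrb _ (hmem t ht)).1.hasFDerivAt.comp_hasDerivAt t e1
    have e3 : HasDerivAt (fun t : ℝ => t ^ 2) (2 * t) t := by simpa using hasDerivAt_pow 2 t
    have := ((e2.sub ((hasDerivAt_id t).mul_const (fderiv ℝ s a w))).sub
      ((e3.div_const 2).mul_const (H w w))).add (e3.mul_const (ε * ‖w‖ ^ 2))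
    refine this.congr_deriv ?_
    ring
  have hmono : MonotoneOn g (Icc 0 1) := by
    refine monotoneOn_of_hasDerivWithinAt_nonneg (convex_Icc 0 1)
      (fun t ht => (hg t ht).continuousAt.continuousWithinAt)
      (fun t ht => (hg t (interior_subset ht)).hasDerivWithinAt) fun t ht => ?_
    have ht' := interior_subset ht
    have := (hrb _ (hmem t ht')).2
    rw [add_sub_cancel_left, map_smul, norm_smul, Real.norm_of_nonneg ht'.1] at this
    have h4 := (le_abs_self _).trans (ContinuousLinearMap.le_of_opNorm_le _ this (-w))
    simp only [sub_apply, smul_apply, map_neg, norm_neg, smul_eq_mul] at h4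
    nlinarith
  have := hmono (left_mem_Icc.2 zero_le_one) (right_mem_Icc.2 zero_le_one) zero_le_one
  simp only [g, zero_smul, add_zero, one_smul, hw, add_sub_cancel] at this
  linarith

/-- The Levi polynomial: a holomorphic polynomial peaking, relative to a strictly
plurisubharmonic function, at a given point. -/
lemma exists_leviPolynomial {s : Cn d → ℝ} {a : Cn d} (hs : ContDiffAt ℝ 2 s a)
    (hl : ∀ v, ‖v‖ ^ 2 ≤ levi s a v) :
    ∃ P : Cn d → ℂ, Differentiable ℂ P ∧ P a = 0 ∧
      ∀ᶠ z in 𝓝 a, (P z).re ≤ s z - s a - (1 / 2) * ‖z - a‖ ^ 2 := by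
  set H := fderiv ℝ (fderiv ℝ s) a with hH
  set A := fderiv ℝ s a with hA
  let Q : Cn d → ℂ := fun w => ((A w : ℝ) : ℂ) - I * ((A (I • w) : ℝ) : ℂ) +
    (1 / 4) * (((H w w : ℝ) : ℂ) - ((H (I • w) (I • w) : ℝ) : ℂ) -
      I * (((H w (I • w) : ℝ) : ℂ) + ((H (I • w) w : ℝ) : ℂ)))
  have hQ : Differentiable ℂ Q := by
    intro w
    have hq : ∀ (S T : Cn d →L[ℝ] Cn d), HasFDerivAt (fun w => ((H (S w) (T w) : ℝ) : ℂ))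
        (ofRealCLM.comp ((H (S w)).comp T + (H.flip (T w)).comp S)) w := fun S T => by
      refine ofRealCLM.hasFDerivAt.comp w ?_
      refine ((H.comp S).hasFDerivAt.clm_apply T.hasFDerivAt).congr_fderiv ?_
      ext v; simp
    have ha : ∀ (S : Cn d →L[ℝ] Cn d), HasFDerivAt (fun w => ((A (S w) : ℝ) : ℂ))
        (ofRealCLM.comp (A.comp S)) w := fun S => (ofRealCLM.comp (A.comp S)).hasFDerivAt
    let J : Cn d →L[ℝ] Cn d := (I • ContinuousLinearMap.id ℂ (Cn d)).restrictScalars ℝ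
    let K : Cn d →L[ℝ] Cn d := ContinuousLinearMap.id ℝ (Cn d)
    have hd := ((ha K).sub ((ha J).const_mul I)).add (((((hq K K).sub (hq J J)).sub
      (((hq K J).add (hq J K)).const_mul I))).const_mul (1 / 4))
    have hJ : ∀ v, J v = I • v := fun v => rfl
    have hK : ∀ v, K v = v := fun v => rfl
    have hd' : HasFDerivAt Q _ w := hd
    refine differentiableAt_of_dbar_eq_zero hd'.differentiableAt fun j => ?_
    rw [dbar, hd'.fderiv]
    have hII : I • (I • (ee j : Cn d)) = -ee j := by rw [smul_smul, I_mul_I, neg_one_smul]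
    simp only [add_apply, sub_apply, smul_apply, ContinuousLinearMap.comp_apply, hJ, hK,
      ofRealCLM_apply, ContinuousLinearMap.flip_apply, smul_eq_mul, hII, map_neg]
    push_cast
    ring_nf
    simp only [I_sq]
    ring
  refine ⟨fun z => Q (z - a), hQ.comp (differentiable_id.sub_const a), by simp [Q], ?_⟩
  filter_upwards [taylor_lower_bound hs (ε := 1 / 2) (by norm_num)] with z hz
  have h1 := hl (z - a)
  rw [levi_eq hs] at h1
  rw [← hH] at h1 hz
  have h2 : (Q (z - a)).re = A (z - a) + (1 / 4) * (H (z - a) (z - a) -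
      H (I • (z - a)) (I • (z - a))) := by
    simp [Q]
  rw [h2]
  linarith

end LeviPolynomial

end SCV

namespace SCV

open MeasureTheory Filter Topology
open scoped ContDiff ENNReal NNReal Convolution ComplexConjugate

section Separation

variable {d : ℕ} {D : Set (Cn d)} {s : Cn d → ℝ}

lemma levi_const_mul_sub {s : Cn d → ℝ} {x : Cn d} (hs : ContDiffAt ℝ 2 s x) (t c : ℝ) (v : Cn d) :
    levi (fun z => t * (s z - c)) x v = t * levi s x v := by
  have h1 : deriv (fun y : ℝ => t * (y - c)) = fun _ => t := by
    funext y
    simp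
  have h := levi_comp (h := fun y => t * (y - c)) (s := s) (x := x)
    (by fun_prop) hs v
  rw [h, h1]
  simp

lemma IsExhaustion.contDiffAt (hD : IsOpen D) (hs : IsExhaustion D s) {x : Cn d} (hx : x ∈ D) :
    ContDiffAt ℝ 2 s x :=
  (hs.contDiffOn.contDiffAt (hD.mem_nhds hx)).of_le two_le_infty

lemma IsExhaustion.isOpen_lt (hD : IsOpen D) (hs : IsExhaustion D s) (c : ℝ) :
    IsOpen {x | x ∈ D ∧ s x < c} :=
  hs.contDiffOn.continuousOn.isOpen_inter_preimage hD isOpen_Iio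

lemma exists_exp_neg_mul_lt {B κ η : ℝ} (hκ : 0 < κ) (hη : 0 < η) :
    ∃ t : ℝ, 0 < t ∧ B * Real.exp (-(t * κ)) < η := by
  have h : Tendsto (fun t : ℝ => B * Real.exp (-(t * κ))) atTop (𝓝 (B * 0)) :=
    (Real.tendsto_exp_neg_atTop_nhds_zero.comp (tendsto_id.atTop_mul_const hκ)).const_mul B
  rw [mul_zero] at h
  obtain ⟨t, ht, ht'⟩ := ((h.eventually (gt_mem_nhds hη)).and (eventually_gt_atTop 0)).exists
  exact ⟨t, ht', ht⟩

/-- Sublevel sets of an exhaustion function are separated from points outside them by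
global holomorphic functions. -/
theorem IsExhaustion.exists_separating (hD : IsOpen D) (hs : IsExhaustion D s) {a : Cn d}
    (ha : a ∈ D) {L : Set (Cn d)} (hL : IsCompact L) (hLa : ∀ x ∈ L, x ∈ D ∧ s x < s a) :
    ∃ F : Cn d → ℂ, DifferentiableOn ℂ F D ∧ ‖F a - 1‖ < 1 / 4 ∧ ∀ x ∈ L, ‖F x‖ < 1 / 4 := by
  obtain ⟨P, hP, hPa, hPle⟩ := exists_leviPolynomial (hs.contDiffAt hD ha) (hs.levi_ge a ha)
  have haL : a ∉ L := fun h => lt_irrefl _ (hLa a h).2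
  obtain ⟨R, hR, hRb⟩ := Metric.eventually_nhds_iff_ball.1
    (hPle.and ((hD.eventually_mem ha).and (hL.isClosed.isOpen_compl.eventually_mem haL)))
  set r := R / 4 with hr
  have hr0 : 0 < r := by positivity
  have hsa : ∀ᶠ x in 𝓝 a, s x < s a + r ^ 2 / 8 :=
    (hs.contDiffAt hD ha).continuousAt.eventually (gt_mem_nhds (by linarith [pow_pos hr0 2]))
  obtain ⟨δ₂, hδ₂, hδ₂b⟩ := Metric.eventually_nhds_iff_ball.1 hsa
  obtain ⟨δ₁, hδ₁, hδ₁b⟩ := hL.exists_thickening_subset_open (hs.isOpen_lt hD (s a)) hLa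
  obtain ⟨δ, hδ, h1, h2, h3⟩ : ∃ δ > 0, δ ≤ r ∧ δ ≤ δ₁ ∧ δ ≤ δ₂ :=
    ⟨min r (min δ₁ δ₂), by positivity, min_le_left _ _, (min_le_right _ _).trans (min_le_left _ _),
      (min_le_right _ _).trans (min_le_right _ _)⟩
  obtain ⟨χ, hχ, hχc, hχs, hχ1, hχI⟩ := exists_cutoff (isOpen_ball (x := a) (ε := 2 * r))
    (isCompact_closedBall a r) (closedBall_subset_ball (by linarith))
  have hball : ball a (2 * r) ⊆ ball a R := ball_subset_ball (by linarith)
  set C := tsupport χ \ ball a r with hC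
  have hCc : IsCompact C := hχc.isCompact.diff isOpen_ball
  have hCD : C ⊆ D := fun x hx => (hRb x (hball (hχs hx.1))).2.1
  obtain ⟨A, hA, hcor⟩ := hs.exists_correction hD (hL.insert a)
    (insert_subset ha fun x hx => (hLa x hx).1) hCc hCD hδ
  set β : Cn d → ℝ := fun x => ∑ j, ‖dbar j (fun y => (χ y : ℂ)) x‖ ^ 2 with hβ
  have hβc : Continuous β := continuous_finsetSum _ fun j _ =>
    ((contDiff_dbar (contDiff_ofReal_comp hχ) j).continuous.norm.pow 2)
  obtain ⟨B, hB⟩ := hCc.exists_bound_of_continuousOn hβc.continuousOn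
  set B' := max B 0
  have hB' : ∀ x ∈ C, β x ≤ B' := fun x hx => ((le_abs_self _).trans (hB x hx)).trans (le_max_left _ _)
  have hB0 : 0 ≤ B' := le_max_right _ _
  obtain ⟨t, ht, htA⟩ := exists_exp_neg_mul_lt (B := A * B') (κ := r ^ 2 / 2) (η := 1 / 16)
    (by positivity) (by norm_num)
  let E : Cn d → ℂ := fun x => cexp (t * P x)
  have hE : Differentiable ℂ E := (hP.const_mul _).cexp
  have hEc : ContDiff ℝ ∞ E := contDiffOn_univ.1 (contDiffOn_of_holomorphic isOpen_univ
    hE.differentiableOn)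
  let G : Cn d → ℂ := fun x => (χ x : ℂ) * E x
  have hGc : ContDiff ℝ ∞ G := (contDiff_ofReal_comp hχ).mul hEc
  have hdG : ∀ x j, dbar j G x = dbar j (fun y => (χ y : ℂ)) x * E x := fun x j => by
    rw [dbar_mul ((contDiff_ofReal_comp hχ).differentiable (by simp) x)
      (hEc.differentiable (by simp) x), dbar_eq_zero_of_differentiableAt (hE x), mul_zero, add_zero]
  have hnearOne : ∀ x ∈ ball a r, G =ᶠ[𝓝 x] E := fun x hx => by
    filter_upwards [hχ1 x (ball_subset_closedBall hx)] with y hy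
    simp [G, hy]
  have hGzero : ∀ x ∉ tsupport χ, G =ᶠ[𝓝 x] fun _ => 0 := fun x hx => by
    filter_upwards [notMem_tsupport_iff_eventuallyEq.1 hx] with y hy
    simp [G, hy]
  obtain ⟨F, hF, hFG⟩ := hcor (fun x => 2 * t * (s x - s a)) G (B' * Real.exp (-(t * r ^ 2)))
    (by positivity) (contDiffOn_const.mul (hs.contDiffOn.sub contDiffOn_const))
    (fun x hx v => by
      rw [levi_const_mul_sub (hs.contDiffAt hD hx)]
      exact mul_nonneg (by positivity) ((sq_nonneg _).trans (hs.levi_ge x hx v)))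
    hGc.contDiffOn
    (fun x hx j => by
      by_cases hxr : x ∈ ball a r
      · rw [dbar_congr (hnearOne x hxr), dbar_eq_zero_of_differentiableAt (hE x)]
      · have hxt : x ∉ tsupport χ := fun h => hx.2 ⟨h, hxr⟩
        rw [dbar_congr (hGzero x hxt), dbar_eq_zero_of_differentiableAt (differentiableAt_const 0)])
    (fun x hx => by
      have e1 : ∑ j, ‖dbar j G x‖ ^ 2 = β x * Real.exp (2 * t * (P x).re) := by
        simp only [hdG, norm_mul, mul_pow, hβ, Finset.sum_mul]
        refine Finset.sum_congr rfl fun j _ => ?_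
        have : ‖E x‖ ^ 2 = Real.exp (2 * t * (P x).re) := by
          simp only [E, norm_exp, ← Real.exp_nat_mul]
          congr 1
          simp
          ring
        rw [this]
      rw [e1, mul_assoc, ← Real.exp_add]
      refine mul_le_mul (hB' x hx) (Real.exp_le_exp.2 ?_) (Real.exp_pos _).le hB0
      have h4 := (hRb x (hball (hχs hx.1))).1
      have h5 : r ≤ ‖x - a‖ := by
        have := hx.2
        rwa [mem_ball_iff_norm, not_lt] at this
      have h6 : r ^ 2 ≤ ‖x - a‖ ^ 2 := by gcongr
      nlinarith)
  have hexp : Real.exp (-(t * r ^ 2)) * Real.exp (t * r ^ 2 / 4) ≤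
      Real.exp (-(t * (r ^ 2 / 2))) := by
    rw [← Real.exp_add]
    exact Real.exp_le_exp.2 (by nlinarith [mul_pos ht (pow_pos hr0 2)])
  have hsmall : A * (B' * Real.exp (-(t * r ^ 2))) * Real.exp (t * r ^ 2 / 4) < 1 / 16 := by
    refine lt_of_le_of_lt ?_ htA
    calc _ = A * B' * (Real.exp (-(t * r ^ 2)) * Real.exp (t * r ^ 2 / 4)) := by ring
      _ ≤ _ := by gcongr
  refine ⟨F, hF, ?_, fun x hx => ?_⟩
  · have hGa : G a = 1 := by
      rw [(hnearOne a (mem_ball_self hr0)).self_of_nhds]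
      simp [E, hPa]
    have h4 := hFG a (mem_insert _ _) (t * r ^ 2 / 4)
      (fun x hx => (((hnearOne x (ball_subset_ball h1 hx)).differentiableAt_iff).2
        (hE x)).differentiableWithinAt)
      (fun x hx => by
        have := hδ₂b x (ball_subset_ball h3 hx)
        nlinarith)
    rw [hGa] at h4
    nlinarith [norm_nonneg (F a - 1)]
  · have hxz : ∀ y ∈ ball x δ, y ∉ tsupport χ := fun y hy hyt => by
      have e1 := hχs hyt
      rw [mem_ball] at hy e1
      have e2 : x ∈ ball a R := by
        rw [mem_ball]
        have := dist_triangle x y a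
        rw [dist_comm x y] at this
        linarith
      exact (hRb x e2).2.2 hx
    have hGx : G x = 0 := (hGzero x (hxz x (mem_ball_self hδ))).self_of_nhds
    have h4 := hFG x (mem_insert_of_mem _ hx) (t * r ^ 2 / 4)
      (fun y hy => (((hGzero y (hxz y hy)).differentiableAt_iff).2
        (differentiableAt_const 0)).differentiableWithinAt)
      (fun y hy => by
        have := (hδ₁b (mem_thickening_iff.2 ⟨x, hx, (mem_ball.1 hy).trans_le h2⟩)).2
        have e3 : 0 ≤ t * r ^ 2 / 4 := by positivity
        nlinarith)
    rw [hGx, sub_zero] at h4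
    nlinarith [norm_nonneg (F x)]

/-- A compact set `L` is enclosed by a shell cut out by `m` holomorphic functions which are
small on `L`, at least one of which is large at each point of the shell. -/
def HasShell (D : Set (Cn d)) (m : ℕ) (L : Set (Cn d)) : Prop :=
  ∃ (q : Fin m → Cn d → ℂ) (P : Set (Cn d)), (∀ i, DifferentiableOn ℂ (q i) D) ∧ IsOpen P ∧
    L ⊆ P ∧ IsCompact (closure P) ∧ closure P ⊆ D ∧ (∀ i, ∀ x ∈ L, ‖q i x‖ < 1) ∧
    ∀ z ∈ frontier P, ∃ i, 1 < ‖q i z‖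

lemma HasShell.succ {m : ℕ} {L : Set (Cn d)} (h : HasShell D m L) : HasShell D (m + 1) L := by
  obtain ⟨q, P, hq, hP, hLP, hPc, hPD, hqL, hqP⟩ := h
  refine ⟨Fin.cons (fun _ => 0) q, P, fun i => ?_, hP, hLP, hPc, hPD, fun i x hx => ?_,
    fun z hz => ?_⟩
  · induction i using Fin.cases with
    | zero => exact differentiableOn_const 0
    | succ i => exact hq i
  · induction i using Fin.cases with
    | zero => simp
    | succ i => exact hqL i x hx
  · obtain ⟨i, hi⟩ := hqP z hz
    exact ⟨i.succ, hi⟩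

lemma HasShell.mono {m k : ℕ} {L : Set (Cn d)} (h : HasShell D m L) (hmk : m ≤ k) :
    HasShell D k L := by
  induction k, hmk using Nat.le_induction with
  | base => exact h
  | succ k _ ih => exact ih.succ

lemma IsExhaustion.exists_hasShell (hD : IsOpen D) (hs : IsExhaustion D s) {L : Set (Cn d)}
    (hL : IsCompact L) (hLD : L ⊆ D) : ∃ m, HasShell D m L := by
  obtain ⟨c, hc⟩ := hL.exists_bound_of_continuousOn (hs.contDiffOn.continuousOn.mono hLD)
  set P := {x | x ∈ D ∧ s x < c + 1} with hPdef
  have hP : IsOpen P := hs.isOpen_lt hD _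
  have hcl : closure P ⊆ {x | x ∈ D ∧ s x ≤ c + 1} :=
    closure_minimal (fun x hx => ⟨hx.1, hx.2.le⟩) (hs.compact (c + 1)).isClosed
  have hLP : ∀ x ∈ L, s x < c + 1 := fun x hx => by
    have := (le_abs_self _).trans (hc x hx)
    linarith
  have hPc : IsCompact (closure P) := (hs.compact (c + 1)).of_isClosed_subset isClosed_closure hcl
  have hfr : ∀ a ∈ frontier P, a ∈ D ∧ s a = c + 1 := fun a ha => by
    rw [hP.frontier_eq] at ha
    have h1 := hcl ha.1
    exact ⟨h1.1, le_antisymm h1.2 (not_lt.1 fun h => ha.2 ⟨h1.1, h⟩)⟩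
  choose! F hF hFa hFL using fun (a : Cn d) (ha : a ∈ frontier P) =>
    hs.exists_separating hD (hfr a ha).1 hL
      (fun x hx => ⟨hLD hx, (hLP x hx).trans_eq (hfr a ha).2.symm⟩)
  have hFc : IsCompact (frontier P) := hPc.of_isClosed_subset isClosed_frontier
    frontier_subset_closure
  have hnear : ∀ a ∈ frontier P, {x | 1 < ‖2 * F a x‖} ∈ 𝓝 a := fun a ha => by
    have h1 : ContinuousAt (F a) a := ((hF a ha).differentiableAt
      (hD.mem_nhds (hfr a ha).1)).continuousAt
    refine (continuousAt_const.mul h1).norm.eventually (lt_mem_nhds ?_)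
    have h2 := norm_sub_norm_le 1 (F a a)
    rw [norm_sub_rev] at h2
    have h3 := hFa a ha
    rw [norm_one] at h2
    change 1 < ‖2 * F a a‖
    rw [norm_mul, Complex.norm_ofNat]
    linarith
  obtain ⟨t, ht, htc⟩ := hFc.elim_nhds_subcover _ hnear
  refine ⟨t.card, fun i x => 2 * F (t.equivFin.symm i) x, P, fun i => ?_, hP,
    fun x hx => ⟨hLD hx, hLP x hx⟩, hPc, fun x hx => (hcl hx).1, fun i x hx => ?_, fun z hz => ?_⟩
  · exact (hF _ (ht _ (t.equivFin.symm i).2)).const_mul 2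
  · have := hFL _ (ht _ (t.equivFin.symm i).2) x hx
    simp only [norm_mul, Complex.norm_ofNat]
    linarith
  · obtain ⟨a, ha, haz⟩ := mem_iUnion₂.1 (htc hz)
    exact ⟨t.equivFin ⟨a, ha⟩, by simpa using haz⟩

end Separation

end SCV

namespace SCV

open MeasureTheory Filter Topology
open scoped ContDiff ENNReal NNReal Convolution ComplexConjugate

section Exhaustion

variable {d : ℕ} {D : Set (Cn d)}

lemma fderiv_norm_sq (x v : Cn d) : fderiv ℝ (fun z : Cn d => ‖z‖ ^ 2) x v = 2 * inner ℝ x v := by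
  have := (hasStrictFDerivAt_norm_sq x).hasFDerivAt.fderiv
  rw [this]
  simp [two_mul]

lemma levi_norm_sq (x v : Cn d) : levi (fun z : Cn d => ‖z‖ ^ 2) x v = ‖v‖ ^ 2 := by
  have h : ∀ w : Cn d, fderiv ℝ (fun y : Cn d => 2 * inner ℝ y w) x w = 2 * ‖w‖ ^ 2 := fun w => by
    have h1 : HasFDerivAt (fun y : Cn d => 2 * inner ℝ y w)
        ((2 : ℝ) • (innerSL ℝ w : Cn d →L[ℝ] ℝ)) x := by
      have := (innerSL ℝ w : Cn d →L[ℝ] ℝ).hasFDerivAt (x := x) |>.const_mul 2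
      simpa [real_inner_comm] using this
    rw [h1.fderiv]
    simp
  simp only [levi, fderiv_norm_sq, h, norm_smul, norm_I, one_mul]
  ring

/-- Near a compact strongly pseudoconvex level set, the Levi form of the defining function is
positive up to a multiple of the squared complex gradient. -/
lemma exists_levi_pos_near {U K : Set (Cn d)} (hU : IsOpen U) {r : Cn d → ℝ}
    (hr : ContDiffOn ℝ ∞ r U) (hK : IsCompact K) (hKU : K ⊆ U)
    (hlevi : ∀ x ∈ K, ∀ v, v ≠ 0 → fderiv ℝ r x v = 0 → fderiv ℝ r x (I • v) = 0 →
      0 < levi r x v) :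
    ∃ (k : ℕ) (V : Set (Cn d)), IsOpen V ∧ K ⊆ V ∧ V ⊆ U ∧ ∀ x ∈ V, ∀ v,
      0 ≤ levi r x v + k * (fderiv ℝ r x v ^ 2 + fderiv ℝ r x (I • v) ^ 2) := by
  have hrat : ∀ x ∈ U, ContDiffAt ℝ 2 r x := fun x hx =>
    (hr.contDiffAt (hU.mem_nhds hx)).of_le two_le_infty
  have h1 : ContinuousOn (fderiv ℝ r) U := (hr.fderiv_of_isOpen hU (m := ∞) (by simp)).continuousOn
  have h2 : ContinuousOn (fderiv ℝ (fderiv ℝ r)) U :=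
    ((hr.fderiv_of_isOpen hU (m := ∞) (by simp)).fderiv_of_isOpen hU (m := ∞) (by simp)).continuousOn
  let N : Cn d × Cn d → ℝ := fun z => fderiv ℝ r z.1 z.2 ^ 2 + fderiv ℝ r z.1 (I • z.2) ^ 2
  let g : Cn d × Cn d → ℝ := fun z => 1 / 4 * (fderiv ℝ (fderiv ℝ r) z.1 z.2 z.2 +
      fderiv ℝ (fderiv ℝ r) z.1 (I • z.2) (I • z.2))
  have hf1 : ContinuousOn (fun z : Cn d × Cn d => fderiv ℝ r z.1) (U ×ˢ univ) :=
    h1.comp continuousOn_fst fun z hz => hz.1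
  have hf2 : ContinuousOn (fun z : Cn d × Cn d => fderiv ℝ (fderiv ℝ r) z.1) (U ×ˢ univ) :=
    h2.comp continuousOn_fst fun z hz => hz.1
  have hI : Continuous fun z : Cn d × Cn d => I • z.2 := continuous_snd.const_smul I
  have hN : ContinuousOn N (U ×ˢ univ) :=
    ((hf1.clm_apply continuousOn_snd).pow 2).add ((hf1.clm_apply hI.continuousOn).pow 2)
  have hg : ContinuousOn g (U ×ˢ univ) := continuousOn_const.mul
    (((hf2.clm_apply continuousOn_snd).clm_apply continuousOn_snd).add
      ((hf2.clm_apply hI.continuousOn).clm_apply hI.continuousOn))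
  have hN0 : ∀ z, 0 ≤ N z := fun z => by positivity
  let W : ℕ → Set (Cn d × Cn d) := fun k => (U ×ˢ univ) ∩ (fun z => g z + k * N z) ⁻¹' Ioi 0
  have hW : ∀ k, IsOpen (W k) := fun k =>
    (hg.add (continuousOn_const.mul hN)).isOpen_inter_preimage (hU.prod isOpen_univ) isOpen_Ioi
  have hWmono : Monotone W := fun k l hkl z hz => ⟨hz.1, by
    have e1 : (0 : ℝ) < g z + k * N z := hz.2
    have e2 : (k : ℝ) ≤ l := by exact_mod_cast hkl
    change (0 : ℝ) < g z + l * N z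
    nlinarith [hN0 z]⟩
  have hcov : K ×ˢ sphere (0 : Cn d) 1 ⊆ ⋃ k, W k := fun z hz => by
    have hz2 : z.2 ≠ 0 := ne_zero_of_mem_unit_sphere ⟨z.2, hz.2⟩
    have hgl : levi r z.1 z.2 = g z := levi_eq (hrat _ (hKU hz.1)) _
    rcases (hN0 z).eq_or_lt with h | h
    · have e1 : fderiv ℝ r z.1 z.2 = 0 := by
        nlinarith [sq_nonneg (fderiv ℝ r z.1 z.2), sq_nonneg (fderiv ℝ r z.1 (I • z.2))]
      have e2 : fderiv ℝ r z.1 (I • z.2) = 0 := by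
        nlinarith [sq_nonneg (fderiv ℝ r z.1 z.2), sq_nonneg (fderiv ℝ r z.1 (I • z.2))]
      refine mem_iUnion.2 ⟨0, ⟨⟨hKU hz.1, mem_univ _⟩, ?_⟩⟩
      have := hlevi z.1 hz.1 z.2 hz2 e1 e2
      simpa [hgl] using this
    · obtain ⟨k, hk⟩ := exists_nat_gt (-g z / N z)
      refine mem_iUnion.2 ⟨k, ⟨⟨hKU hz.1, mem_univ _⟩, ?_⟩⟩
      rw [div_lt_iff₀ h] at hk
      change (0 : ℝ) < g z + k * N z
      linarith
  obtain ⟨k, hk⟩ := (hK.prod (isCompact_sphere (0 : Cn d) 1)).elim_directed_cover W hW hcov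
    hWmono.directed_le
  obtain ⟨V, V', hV, -, hKV, hSV', hVV'⟩ :=
    generalized_tube_lemma hK (isCompact_sphere (0 : Cn d) 1) (hW k) hk
  refine ⟨k, V ∩ U, hV.inter hU, subset_inter hKV hKU, inter_subset_right, fun x hx v => ?_⟩
  rw [levi_eq (hrat x hx.2)]
  by_cases hv : v = 0
  · simp [hv]
  have hv0 : 0 < ‖v‖ := norm_pos_iff.2 hv
  set w := ((‖v‖⁻¹ : ℝ)) • v with hw
  have hwS : w ∈ sphere (0 : Cn d) 1 := by
    rw [mem_sphere_zero_iff_norm, hw, norm_smul, norm_inv, norm_norm, inv_mul_cancel₀ hv0.ne']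
  have hvw : v = ‖v‖ • w := by rw [hw, smul_smul, mul_inv_cancel₀ hv0.ne', one_smul]
  have hpos : 0 < g (x, w) + k * N (x, w) := (hVV' (mk_mem_prod hx.1 (hSV' hwS))).2
  rw [hvw, smul_comm I ‖v‖ w]
  simp only [map_smul, smul_apply, smul_eq_mul]
  have := mul_nonneg (sq_nonneg ‖v‖) hpos.le
  simp only [g, N] at this
  linarith

lemma deriv_neg_log_neg : deriv (fun t : ℝ => -Real.log (-t)) = fun t => -t⁻¹ := by
  funext t
  simp [Real.log_neg_eq_log]

lemma levi_neg_log_neg {r : Cn d → ℝ} {x : Cn d} (hr : ContDiffAt ℝ 2 r x) (hx : r x < 0)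
    (v : Cn d) : levi (fun z => -Real.log (-r z)) x v = (-r x)⁻¹ * (levi r x v +
      (4 * -r x)⁻¹ * (fderiv ℝ r x v ^ 2 + fderiv ℝ r x (I • v) ^ 2)) := by
  have h : ContDiffAt ℝ 2 (fun t : ℝ => -Real.log (-t)) (r x) := by
    have : -(r x) ≠ 0 := by linarith
    exact (contDiffAt_id.neg.log this).neg
  rw [levi_comp h hr, deriv_neg_log_neg]
  have h2 : deriv (fun t : ℝ => -t⁻¹) (r x) = (r x ^ 2)⁻¹ := by
    simp [deriv_inv]
  rw [h2]
  have := hx.ne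
  field_simp
  ring

/-- A bounded strongly pseudoconvex domain carries a smooth strictly plurisubharmonic exhaustion
function with controlled gradient. -/
theorem exists_isExhaustion (hD : IsOpen D) (hDb : IsBounded D) {U : Set (Cn d)} (hU : IsOpen U)
    (hDU : frontier D ⊆ U) {r : Cn d → ℝ} (hr : ContDiffOn ℝ ∞ r U)
    (hrD : D ∩ U = {x ∈ U | r x < 0})
    (hlevi : ∀ x ∈ frontier D, ∀ v, v ≠ 0 → fderiv ℝ r x v = 0 → fderiv ℝ r x (I • v) = 0 →
      0 < levi r x v) : ∃ s, IsExhaustion D s := by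
  have hfc : IsCompact (frontier D) :=
    (isCompact_of_isClosed_isBounded isClosed_closure hDb.closure).of_isClosed_subset
      isClosed_frontier frontier_subset_closure
  have hrcont : ∀ x ∈ U, ContinuousAt r x := fun x hx =>
    (hr.contDiffAt (hU.mem_nhds hx)).continuousAt
  have hneg : ∀ x ∈ D, x ∈ U → r x < 0 := fun x hx hxU => (hrD.subset ⟨hx, hxU⟩).2
  have hrzero : ∀ x ∈ frontier D, r x = 0 := fun x hx => by
    have hxU := hDU hx
    refine le_antisymm ?_ (not_lt.1 fun h => ?_)
    · by_contra! h
      have h1 := ((hrcont x hxU).eventually (lt_mem_nhds h)).and (hU.mem_nhds hxU)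
      obtain ⟨y, ⟨hy1, hy2⟩, hyD⟩ := mem_closure_iff_nhds.1 hx.1 _ h1
      exact lt_asymm hy1 (hneg y hyD hy2)
    · have : x ∈ D := (hrD.superset ⟨hxU, h⟩).1
      rw [hD.frontier_eq] at hx
      exact hx.2 this
  obtain ⟨k, V₀, hV₀, hfV₀, hV₀U, hpos₀⟩ := exists_levi_pos_near hU hr hfc hDU hlevi
  set V := V₀ ∩ (U ∩ r ⁻¹' Ioi (-(4 * (k + 1 : ℝ))⁻¹)) with hVdef
  have hV : IsOpen V := hV₀.inter (hr.continuousOn.isOpen_inter_preimage hU isOpen_Ioi)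
  have hfV : frontier D ⊆ V := fun x hx => ⟨hfV₀ hx, hDU hx, by
    rw [mem_preimage, hrzero x hx, mem_Ioi, neg_lt_zero]; positivity⟩
  have hVU : V ⊆ U := inter_subset_left.trans hV₀U
  set φ : Cn d → ℝ := fun x => -Real.log (-r x) with hφ
  have hφc : ContDiffOn ℝ ∞ φ (D ∩ U) := fun x hx =>
    (((hr.contDiffAt (hU.mem_nhds hx.2)).neg.log
      (by have := hneg x hx.1 hx.2; simp only [ne_eq]; linarith)).neg).contDiffWithinAt
  have hφlevi : ∀ x ∈ D ∩ V, ∀ v, 0 ≤ levi φ x v := fun x hx v => by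
    have hx0 := hneg x hx.1 (hVU hx.2)
    rw [levi_neg_log_neg ((hr.contDiffAt (hU.mem_nhds (hVU hx.2))).of_le two_le_infty) hx0]
    have h1 := hpos₀ x hx.2.1 v
    have h2 : -(4 * (k + 1 : ℝ))⁻¹ < r x := hx.2.2.2
    have h3 : (k : ℝ) ≤ (4 * -r x)⁻¹ := by
      have h5 : 0 < 4 * -r x := by linarith
      have h6 : (4 * (k + 1 : ℝ)) * (4 * (k + 1 : ℝ))⁻¹ = 1 := mul_inv_cancel₀ (by positivity)
      have h7 : (0 : ℝ) < 4 * (k + 1 : ℝ) := by positivity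
      rw [← one_div, le_div_iff₀ h5]
      nlinarith
    have h4 : 0 ≤ fderiv ℝ r x v ^ 2 + fderiv ℝ r x (I • v) ^ 2 := by positivity
    refine mul_nonneg (inv_nonneg.2 (by linarith)) ?_
    nlinarith
  obtain ⟨χ, hχ, hχc, hχs, hχ1, hχI⟩ := exists_cutoff hV hfc hfV
  set s₀ : Cn d → ℝ := fun x => χ x * φ x with hs₀
  have hs₀c : ContDiffOn ℝ ∞ s₀ D := fun x hx => by
    by_cases hxt : x ∈ tsupport χ
    · have hxU : x ∈ D ∩ U := ⟨hx, hVU (hχs hxt)⟩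
      exact (hχ.contDiffAt.mul (hφc.contDiffAt ((hD.inter hU).mem_nhds hxU))).contDiffWithinAt
    · refine (contDiffAt_const (c := (0 : ℝ)).congr_of_eventuallyEq ?_).contDiffWithinAt
      filter_upwards [notMem_tsupport_iff_eventuallyEq.1 hxt] with y hy
      simp [hs₀, hy]
  set W := interior {x | χ x = 1} with hW
  have hW1 : ∀ x ∈ W, χ x = 1 := fun x hx => by
    have : x ∈ {x | χ x = 1} := interior_subset hx
    exact this
  have hfW : frontier D ⊆ W := fun x hx => mem_interior_iff_mem_nhds.2 (hχ1 x hx)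
  have hWt : W ⊆ tsupport χ := fun x hx => subset_tsupport _ (by
    have : χ x = 1 := hW1 x hx
    simp [this])
  have hWs : ∀ x ∈ W, s₀ =ᶠ[𝓝 x] φ := fun x hx => by
    filter_upwards [isOpen_interior.mem_nhds hx] with y hy
    have : χ y = 1 := hW1 y hy
    simp [hs₀, this]
  set K₀ := closure D \ W with hK₀
  have hK₀c : IsCompact K₀ :=
    (isCompact_of_isClosed_isBounded isClosed_closure hDb.closure).diff isOpen_interior
  have hK₀D : K₀ ⊆ D := fun x hx => by
    by_contra h
    exact hx.2 (hfW (by rw [hD.frontier_eq]; exact ⟨hx.1, h⟩))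
  have hd1 : ContDiffOn ℝ ∞ (fderiv ℝ s₀) D := hs₀c.fderiv_of_isOpen hD (by simp)
  have hd2 : ContDiffOn ℝ ∞ (fderiv ℝ (fderiv ℝ s₀)) D := hd1.fderiv_of_isOpen hD (by simp)
  obtain ⟨B₂, hB₂⟩ := hK₀c.exists_bound_of_continuousOn (f := fderiv ℝ (fderiv ℝ s₀)) (hd2.continuousOn.mono hK₀D)
  obtain ⟨B₁, hB₁⟩ := hK₀c.exists_bound_of_continuousOn (f := fderiv ℝ s₀) (hd1.continuousOn.mono hK₀D)
  obtain ⟨B₀, hB₀⟩ := hK₀c.exists_bound_of_continuousOn (hs₀c.continuousOn.mono hK₀D)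
  obtain ⟨C₁, hC₁⟩ := hχc.isCompact.exists_bound_of_continuousOn
    (f := fderiv ℝ r) ((hr.fderiv_of_isOpen hU (m := ∞) (by simp)).continuousOn.mono (hχs.trans hVU))
  obtain ⟨C₀, hC₀⟩ := hχc.isCompact.exists_bound_of_continuousOn
    (hr.continuousOn.mono (hχs.trans hVU))
  set A := max B₂ 0 + 1 with hA
  have hA1 : 1 ≤ A := by simp [hA]
  have hq : ContDiff ℝ ∞ (fun z : Cn d => A * (‖z‖ ^ 2 - 0)) :=
    contDiff_const.mul ((contDiff_norm_sq ℝ).sub contDiff_const)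
  have hs0ball : ∀ x ∈ D, s₀ x ≤ s₀ x + A * (‖x‖ ^ 2 - 0) := fun x hx => by
    have : 0 ≤ A * (‖x‖ ^ 2 - 0) := by rw [sub_zero]; positivity
    linarith
  have hWexp : ∀ x ∈ D, x ∈ W → Real.exp (-s₀ x) = -r x := fun x hx hxW => by
    rw [(hWs x hxW).self_of_nhds, hφ, neg_neg, Real.exp_log]
    linarith [hneg x hx (hVU (hχs (hWt hxW)))]
  have hC1 : ∃ C, 0 ≤ C ∧ ∀ x ∈ D, 1 ≤ C * Real.exp (s₀ x) := by
    refine ⟨max C₀ (Real.exp B₀), le_max_of_le_right (Real.exp_pos _).le, fun x hx => ?_⟩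
    have key : Real.exp (-s₀ x) ≤ max C₀ (Real.exp B₀) := by
      by_cases hxW : x ∈ W
      · rw [hWexp x hx hxW]
        exact ((neg_le_abs _).trans (hC₀ x (hWt hxW))).trans (le_max_left _ _)
      · have := (neg_le_abs _).trans (hB₀ x ⟨subset_closure hx, hxW⟩)
        exact (Real.exp_le_exp.2 this).trans (le_max_right _ _)
    rwa [Real.exp_neg, inv_le_iff_one_le_mul₀ (Real.exp_pos _)] at key
  obtain ⟨C₂, hC₂0, hC₂⟩ := hC1
  have hC2 : ∀ x ∈ D, ‖fderiv ℝ s₀ x‖ ≤ (max C₁ 0 + max B₁ 0 * C₂) * Real.exp (s₀ x) := by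
    intro x hx
    have e0 : 0 ≤ max C₁ 0 := le_max_right _ _
    have e1 : 0 ≤ max B₁ 0 := le_max_right _ _
    by_cases hxW : x ∈ W
    · have hxU : x ∈ U := hVU (hχs (hWt hxW))
      have hr0 := hneg x hx hxU
      have h1 : HasFDerivAt φ (-((-r x)⁻¹ • -fderiv ℝ r x)) x :=
        (((hr.contDiffAt (hU.mem_nhds hxU)).differentiableAt (by simp)).hasFDerivAt.neg.log
          (by simp only [Pi.neg_apply]; linarith)).neg
      have h2 : Real.exp (s₀ x) = (-r x)⁻¹ := by rw [← hWexp x hx hxW, Real.exp_neg, inv_inv]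
      have h3 : 0 < (-r x)⁻¹ := h2 ▸ Real.exp_pos _
      rw [(hWs x hxW).fderiv_eq, h1.fderiv, smul_neg, neg_neg, norm_smul, h2,
        Real.norm_of_nonneg h3.le, mul_comm]
      refine mul_le_mul_of_nonneg_right ?_ h3.le
      have h4 := (hC₁ x (hWt hxW)).trans (le_max_left _ 0)
      nlinarith [mul_nonneg e1 hC₂0]
    · have h1 := (hB₁ x ⟨subset_closure hx, hxW⟩).trans (le_max_left _ 0)
      have h2 := hC₂ x hx
      nlinarith [Real.exp_pos (s₀ x), mul_nonneg e0 (Real.exp_pos (s₀ x)).le]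
  refine ⟨fun z => s₀ z + A * (‖z‖ ^ 2 - 0), hs₀c.add hq.contDiffOn, fun x hx v => ?_, fun c => ?_, ?_⟩
  · have h1 : ContDiffAt ℝ 2 s₀ x := (hs₀c.contDiffAt (hD.mem_nhds hx)).of_le two_le_infty
    rw [levi_add h1 (hq.contDiffAt.of_le two_le_infty),
      levi_const_mul_sub (contDiff_norm_sq ℝ).contDiffAt, levi_norm_sq]
    by_cases hxW : x ∈ W
    · rw [levi_congr (hWs x hxW)]
      have := hφlevi x ⟨hx, hχs (hWt hxW)⟩ v
      nlinarith [sq_nonneg ‖v‖]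
    · have h2 := hB₂ x ⟨subset_closure hx, hxW⟩
      have h3 : ∀ w : Cn d, -(max B₂ 0 * ‖w‖ ^ 2) ≤ fderiv ℝ (fderiv ℝ s₀) x w w := fun w => by
        have := ((neg_abs_le _).trans' (neg_le_neg ((fderiv ℝ (fderiv ℝ s₀) x).le_opNorm₂ w w)))
        have h4 := h2.trans (le_max_left _ 0)
        nlinarith [sq_nonneg ‖w‖]
      have h4 := h3 v
      have h5 := h3 (I • v)
      rw [norm_smul, norm_I, one_mul] at h5
      rw [levi_eq h1]
      nlinarith [sq_nonneg ‖v‖, mul_nonneg (le_max_right B₂ 0) (sq_nonneg ‖v‖)]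
  · refine isCompact_of_isClosed_isBounded (isClosed_of_closure_subset fun x hx => ?_)
      (hDb.subset fun x hx => hx.1)
    have hxD : x ∈ closure D := closure_mono (fun x hx => hx.1) hx
    have hxD' : x ∈ D := by
      by_contra h
      have hxf : x ∈ frontier D := by rw [hD.frontier_eq]; exact ⟨hxD, h⟩
      have h1 : ∀ᶠ y in 𝓝 x, -Real.exp (-c) < r y :=
        (hrcont x (hDU hxf)).eventually (lt_mem_nhds (by
          rw [hrzero x hxf]
          exact neg_lt_zero.2 (Real.exp_pos _)))
      obtain ⟨y, ⟨hy1, hy2⟩, hyD, hyc⟩ := mem_closure_iff_nhds.1 hx _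
        (h1.and (isOpen_interior.mem_nhds (hfW hxf)))
      have h2 := hWexp y hyD hy2
      have h3 := Real.exp_le_exp.2 (neg_le_neg ((hs0ball y hyD).trans hyc))
      linarith
    refine ⟨hxD', ?_⟩
    by_contra! h
    have h1 : ContinuousAt (fun z => s₀ z + A * (‖z‖ ^ 2 - 0)) x :=
      (hs₀c.contDiffAt (hD.mem_nhds hxD')).continuousAt.add hq.continuous.continuousAt
    obtain ⟨y, hy, hyD, hyc⟩ := mem_closure_iff_nhds.1 hx _ (h1.eventually (lt_mem_nhds h))
    exact absurd hyc (not_le.2 hy)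
  · obtain ⟨C₃, hC₃⟩ := (isCompact_of_isClosed_isBounded isClosed_closure
      hDb.closure).exists_bound_of_continuousOn (f := fderiv ℝ (fun z : Cn d => A * (‖z‖ ^ 2 - 0)))
      (hq.continuous_fderiv (by simp)).continuousOn
    refine ⟨max C₁ 0 + max B₁ 0 * C₂ + max C₃ 0 * C₂, fun x hx => ?_⟩
    rw [fderiv_fun_add ((hs₀c.contDiffAt (hD.mem_nhds hx)).differentiableAt (by simp))
      (hq.differentiable (by simp) x)]
    refine (norm_add_le _ _).trans ?_
    have e1 := hC2 x hx
    have e2 := (hC₃ x (subset_closure hx)).trans (le_max_left _ 0)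
    have e3 := hC₂ x hx
    have e4 : 0 ≤ max C₃ 0 := le_max_right _ _
    have e5 : 0 ≤ max C₁ 0 + max B₁ 0 * C₂ + max C₃ 0 * C₂ := by positivity
    calc _ ≤ (max C₁ 0 + max B₁ 0 * C₂ + max C₃ 0 * C₂) * Real.exp (s₀ x) := by nlinarith
      _ ≤ _ := mul_le_mul_of_nonneg_left (Real.exp_le_exp.2 (hs0ball x hx)) e5

end Exhaustion

end SCV

namespace SCV

open MeasureTheory Filter Topology
open scoped ContDiff ENNReal NNReal Convolution ComplexConjugate

section RegularValues

variable {X Y : Type*} [NormedAddCommGroup X] [NormedSpace ℝ X] [FiniteDimensional ℝ X]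
  [NormedAddCommGroup Y] [NormedSpace ℝ Y]

/-- If `dim X ≤ dim Y`, every nonempty open subset of `Y` contains a value at all of whose
preimages the derivative is injective. -/
lemma exists_injective_fderiv_of_eq [FiniteDimensional ℝ Y]
    (hXY : Module.finrank ℝ X ≤ Module.finrank ℝ Y)
    {Ω : Set X} (hΩ : IsOpen Ω) {Ψ : X → Y} (hΨ : DifferentiableOn ℝ Ψ Ω) {O : Set Y}
    (hO : IsOpen O) (hOn : O.Nonempty) :
    ∃ a ∈ O, ∀ x ∈ Ω, Ψ x = a → Function.Injective (fderiv ℝ Ψ x) := by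
  obtain ⟨π, hπ⟩ : ∃ π : Y →L[ℝ] X, Function.Surjective π := by
    obtain ⟨ι, hι⟩ := lift_rank_le_iff_exists_linearMap.1
      (show Cardinal.lift.{_} (Module.rank ℝ X) ≤ Cardinal.lift.{_} (Module.rank ℝ Y) by
        rw [← Module.finrank_eq_rank, ← Module.finrank_eq_rank, Cardinal.lift_natCast,
          Cardinal.lift_natCast]
        exact_mod_cast hXY)
    obtain ⟨p, hp⟩ := ι.exists_leftInverse_of_injective (LinearMap.ker_eq_bot.2 hι)
    exact ⟨LinearMap.toContinuousLinearMap p, fun x => ⟨ι x, by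
      simpa using LinearMap.congr_fun hp x⟩⟩
  borelize X
  let Z : Set X := {x ∈ Ω | ¬ Function.Injective (fderiv ℝ Ψ x)}
  have hnull : (Measure.addHaar : Measure X) ((fun x => π (Ψ x)) '' Z) = 0 := by
    refine addHaar_image_eq_zero_of_det_fderivWithin_eq_zero _
      (f' := fun x => π.comp (fderiv ℝ Ψ x)) (fun x hx => ?_) (fun x hx => ?_)
    · exact (π.hasFDerivAt.comp x
        (hΨ.differentiableAt (hΩ.mem_nhds hx.1)).hasFDerivAt).hasFDerivWithinAt
    · by_contra hdet
      refine hx.2 fun v w hvw => ?_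
      have hu : IsUnit (LinearMap.det (π.comp (fderiv ℝ Ψ x) : X →ₗ[ℝ] X)) := isUnit_iff_ne_zero.2 hdet
      refine ((LinearMap.isUnit_iff_isUnit_det _).2 hu |> (Module.End.isUnit_iff _).1).1 ?_
      simp [hvw]
  have hopen : IsOpen (π '' O) := π.isOpenMap hπ O hO
  have hpos : (Measure.addHaar : Measure X) (π '' O) ≠ 0 := (hopen.measure_pos _ (hOn.image π)).ne'
  obtain ⟨y, ⟨a, ha, rfl⟩, hy⟩ : ∃ y ∈ π '' O, y ∉ (fun x => π (Ψ x)) '' Z := by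
    by_contra! h
    exact hpos (measure_mono_null h hnull)
  refine ⟨a, ha, fun x hx hxa => ?_⟩
  by_contra hi
  exact hy ⟨x, ⟨hx, hi⟩, by simp [hxa]⟩

/-- Preimages of a point along which the derivative is injective are countable. -/
lemma countable_of_injective_fderiv {S : Set X} {Ψ : X → Y} {c : Y}
    (hS : ∀ x ∈ S, Ψ x = c ∧ DifferentiableAt ℝ Ψ x ∧ Function.Injective (fderiv ℝ Ψ x)) :
    S.Countable := by
  have hdis : DiscreteTopology S := by
    rw [discreteTopology_subtype_iff]
    intro x hx
    obtain ⟨K, -, hK⟩ := (fderiv ℝ Ψ x : X →ₗ[ℝ] Y).exists_antilipschitzWith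
      (LinearMap.ker_eq_bot.2 (hS x hx).2.2)
    have h := (hS x hx).2.1.hasFDerivAt.eventually_ne (c := c) ⟨K, hK⟩
    rw [← compl_compl S, ← mem_iff_inf_principal_compl]
    filter_upwards [h] with y hy hyS using hy (hS y hyS).1
  have := FiniteDimensional.proper ℝ X
  exact countable_of_Lindelof_of_discrete (X := S)

end RegularValues

section LinearPerturbation

variable {d m N : ℕ}

/-- The vector of `ℂ^d` with leading entries `v`, with `k`-th entry `1` and vanishing entries
beyond the `k`-th. -/
def lastOne (k : Fin d) (v : Cn N) : Cn d :=
  WithLp.toLp 2 fun i => if i = k then 1 else if h : i < k ∧ i.val < N then v ⟨i, h.2⟩ else 0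

lemma lastOne_self (k : Fin d) (v : Cn N) : lastOne k v k = 1 := by simp [lastOne]

lemma lastOne_of_lt {k i : Fin d} (h : k < i) (v : Cn N) : lastOne k v i = 0 := by
  simp [lastOne, h.ne', not_lt.2 h.le]

lemma contDiff_lastOne (k : Fin d) : ContDiff ℝ ∞ (lastOne k : Cn N → Cn d) := by
  refine (contDiff_piLp 2).2 fun i => ?_
  by_cases h : i = k
  · simp only [lastOne, h, if_true]
    exact contDiff_const
  by_cases h' : i < k ∧ i.val < N
  · simp only [lastOne, h, h', if_false, dite_true, and_self]
    exact (contDiff_piLp_apply (p := 2))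
  · simp only [lastOne, h, h', if_false, dite_false]
    exact contDiff_const

lemma exists_eq_smul_lastOne (hN : d ≤ N + 1) {w : Cn d} (hw : w ≠ 0) :
    ∃ (k : Fin d) (c : ℂ) (v : Cn N), c ≠ 0 ∧ w = c • lastOne k v := by
  classical
  have hne : (Finset.univ.filter fun i => w i ≠ 0).Nonempty := by
    by_contra h
    rw [Finset.not_nonempty_iff_eq_empty, Finset.filter_eq_empty_iff] at h
    exact hw (PiLp.ext fun i => by simpa using h (Finset.mem_univ i))
  set k := (Finset.univ.filter fun i => w i ≠ 0).max' hne
  have hk : w k ≠ 0 := (Finset.mem_filter.1 (Finset.max'_mem _ hne)).2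
  have hmax : ∀ i, k < i → w i = 0 := fun i hi => by
    by_contra h
    exact absurd (Finset.le_max' _ i (by simp [h])) (not_le.2 hi)
  refine ⟨k, w k, WithLp.toLp 2 fun i : Fin N => if h : i.val < d then w ⟨i, h⟩ / w k else 0, hk,
    PiLp.ext fun i => ?_⟩
  rcases lt_trichotomy i k with h | h | h
  · have hiN : i.val < N := by have := k.2; have : i.val < k.val := h; omega
    simp [lastOne, h.ne, h, hiN, mul_div_cancel₀ _ hk]
  · simp [lastOne, h]
  · simp [lastOne_of_lt h, hmax i h]

/-- A small linear perturbation making the incidence maps of all kernel directions regular. -/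
lemma exists_linear_regular (hm : d + N ≤ m) {Ω : Set (Cn d)} (hΩ : IsOpen Ω) {R : Cn d → Cn m}
    (hR : ContDiffOn ℝ ∞ R Ω) {η : ℝ} (hη : 0 < η) :
    ∃ A : Cn d →L[ℂ] Cn m, ‖A‖ < η ∧ ∀ k : Fin d, ∀ x ∈ Ω ×ˢ (univ : Set (Cn N)),
      fderiv ℝ R x.1 (lastOne k x.2) + A (lastOne k x.2) = 0 →
      Function.Injective (fderiv ℝ (fun x : Cn d × Cn N =>
        fderiv ℝ R x.1 (lastOne k x.2) + A (lastOne k x.2)) x) := by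
  suffices H : ∀ l : ℕ, ∃ A : Cn d →L[ℂ] Cn m, ‖A‖ < η ∧ ∀ k : Fin d, k.val < l →
      ∀ x ∈ Ω ×ˢ (univ : Set (Cn N)),
      fderiv ℝ R x.1 (lastOne k x.2) + A (lastOne k x.2) = 0 →
      Function.Injective (fderiv ℝ (fun x : Cn d × Cn N =>
        fderiv ℝ R x.1 (lastOne k x.2) + A (lastOne k x.2)) x) by
    obtain ⟨A, hA, hA'⟩ := H d
    exact ⟨A, hA, fun k => hA' k k.2⟩
  intro l
  induction l with
  | zero => exact ⟨0, by simpa using hη, fun k hk => absurd hk (by omega)⟩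
  | succ l ih =>
    obtain ⟨A, hA, hAl⟩ := ih
    by_cases hl : l < d
    swap
    · exact ⟨A, hA, fun k hk => hAl k (by omega)⟩
    set k₀ : Fin d := ⟨l, hl⟩
    have hfd : ContDiffOn ℝ ∞ (fderiv ℝ R) Ω := hR.fderiv_of_isOpen hΩ (by simp)
    have hlo : ContDiff ℝ ∞ (fun x : Cn d × Cn N => (lastOne k₀ x.2 : Cn d)) :=
      (contDiff_lastOne k₀).comp contDiff_snd
    have hsm : ContDiffOn ℝ ∞ (fun x : Cn d × Cn N =>
        fderiv ℝ R x.1 (lastOne k₀ x.2) + A (lastOne k₀ x.2)) (Ω ×ˢ univ) :=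
      ((hfd.comp contDiffOn_fst fun x hx => hx.1).clm_apply hlo.contDiffOn).add
        ((A.restrictScalars ℝ).contDiff.comp hlo).contDiffOn
    have hdim : Module.finrank ℝ (Cn d × Cn N) ≤ Module.finrank ℝ (Cn m) := by
      rw [Module.finrank_prod, finrank_real_of_complex, finrank_real_of_complex,
        finrank_real_of_complex, finrank_euclideanSpace_fin, finrank_euclideanSpace_fin,
        finrank_euclideanSpace_fin]
      omega
    obtain ⟨b, hb, hbreg⟩ := exists_injective_fderiv_of_eq hdim (hΩ.prod isOpen_univ)
      (hsm.differentiableOn (by simp)) (isOpen_ball (x := (0 : Cn m)) (ε := η - ‖A‖))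
      ⟨0, mem_ball_self (by linarith)⟩
    set A' : Cn d →L[ℂ] Cn m := A - (EuclideanSpace.proj k₀ : Cn d →L[ℂ] ℂ).smulRight b with hA'
    have hA'v : ∀ w, A' w = A w - w k₀ • b := fun w => rfl
    refine ⟨A', ?_, fun k hk => ?_⟩
    · have h1 : ‖(EuclideanSpace.proj k₀ : Cn d →L[ℂ] ℂ).smulRight b‖ ≤ ‖b‖ := by
        refine ContinuousLinearMap.opNorm_le_bound _ (norm_nonneg _) fun w => ?_
        rw [ContinuousLinearMap.smulRight_apply, norm_smul, mul_comm]
        exact mul_le_mul_of_nonneg_left (PiLp.norm_apply_le w k₀) (norm_nonneg _)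
      have h2 := norm_sub_le A ((EuclideanSpace.proj k₀ : Cn d →L[ℂ] ℂ).smulRight b)
      rw [mem_ball_zero_iff] at hb
      linarith
    · rcases Nat.lt_succ_iff_lt_or_eq.1 hk with hk | hk
      · have he : ∀ v : Cn N, A' (lastOne k v) = A (lastOne k v) := fun v => by
          rw [hA'v, lastOne_of_lt (show k < k₀ from hk), zero_smul, sub_zero]
        simpa only [he] using hAl k hk
      · obtain rfl : k = k₀ := Fin.ext hk
        have he : ∀ v : Cn N, A' (lastOne k₀ v) = A (lastOne k₀ v) - b := fun v => by
          rw [hA'v, lastOne_self, one_smul]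
        intro x hx hx0
        simp only [he, ← add_sub_assoc, fderiv_sub_const] at hx0 ⊢
        exact hbreg x hx (sub_eq_zero.1 hx0)

lemma contDiffOn_of_holomorphic_vector {Ω : Set (Cn d)} (hΩ : IsOpen Ω) {R : Cn d → Cn m}
    (hR : DifferentiableOn ℂ R Ω) : ContDiffOn ℝ ∞ R Ω :=
  (contDiffOn_piLp 2).2 fun i =>
    contDiffOn_of_holomorphic hΩ (differentiableOn_euclidean.1 hR i)

lemma exists_lastOne_eq_zero (hN : d ≤ N + 1) {R : Cn d → Cn m} {z : Cn d}
    (hR : DifferentiableAt ℂ R z) {A : Cn d →L[ℂ] Cn m}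
    (hz : ¬ Function.Injective (fderiv ℂ R z + A)) :
    ∃ (k : Fin d) (v : Cn N), fderiv ℝ R z (lastOne k v) + A (lastOne k v) = 0 := by
  rw [injective_iff_map_eq_zero] at hz
  push Not at hz
  obtain ⟨w, hw0, hw⟩ := hz
  obtain ⟨k, c, v, hc, rfl⟩ := exists_eq_smul_lastOne hN hw
  refine ⟨k, v, ?_⟩
  rw [(hR.hasFDerivAt.restrictScalars ℝ).fderiv]
  rw [map_smul, smul_eq_zero] at hw0
  exact hw0.resolve_left hc

/-- A holomorphic map into a space of at least twice the dimension becomes an immersion after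
adding a suitable small linear map. -/
theorem exists_injective_perturbation (hm : 2 * d ≤ m) {Ω : Set (Cn d)} (hΩ : IsOpen Ω)
    {R : Cn d → Cn m} (hR : DifferentiableOn ℂ R Ω) {η : ℝ} (hη : 0 < η) :
    ∃ A : Cn d →L[ℂ] Cn m, ‖A‖ < η ∧ ∀ z ∈ Ω, Function.Injective (fderiv ℂ R z + A) := by
  have hRc := contDiffOn_of_holomorphic_vector hΩ hR
  obtain ⟨A, hA, hreg⟩ := exists_linear_regular (N := d) (by omega) hΩ hRc hη
  refine ⟨A, hA, fun z hz => ?_⟩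
  by_contra hinj
  obtain ⟨k, v, hkv⟩ := exists_lastOne_eq_zero (N := d) (by omega)
    (hR.differentiableAt (hΩ.mem_nhds hz)) hinj
  have hi := hreg k (z, v) ⟨hz, mem_univ _⟩ hkv
  set Ψ : Cn d × Cn d → Cn m := fun x => fderiv ℝ R x.1 (lastOne k x.2) + A (lastOne k x.2)
    with hΨ
  have hconst : ∀ t : ℝ, Ψ ((z, v) + t • ((0 : Cn d), (ee k : Cn d))) = Ψ (z, v) := fun t => by
    have : (lastOne k (v + t • (ee k : Cn d)) : Cn d) = lastOne k v := by
      refine PiLp.ext fun i => ?_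
      by_cases h : i = k
      · simp [lastOne, h]
      · simp [lastOne, h, ee]
    simp [hΨ, this]
  have hd : DifferentiableAt ℝ Ψ (z, v) := by
    by_contra h
    rw [fderiv_zero_of_not_differentiableAt h] at hi
    have := @hi (0, ee k) 0 rfl
    simp [ee] at this
  have h1 : HasDerivAt (fun t : ℝ => (z, v) + t • ((0 : Cn d), (ee k : Cn d)))
      ((0 : Cn d), (ee k : Cn d)) 0 := by
    simpa using ((hasDerivAt_id (0 : ℝ)).smul_const ((0 : Cn d), (ee k : Cn d))).const_add (z, v)
  have h2 := HasFDerivAt.comp_hasDerivAt (0 : ℝ)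
    (show HasFDerivAt Ψ (fderiv ℝ Ψ (z, v)) ((z, v) + (0 : ℝ) • ((0 : Cn d), (ee k : Cn d))) by
      simpa using hd.hasFDerivAt) h1
  have h3 : fderiv ℝ Ψ (z, v) ((0 : Cn d), (ee k : Cn d)) = 0 := by
    refine h2.unique ?_
    have : (Ψ ∘ fun t : ℝ => (z, v) + t • ((0 : Cn d), (ee k : Cn d))) = fun _ => Ψ (z, v) :=
      funext hconst
    rw [this]
    exact hasDerivAt_const _ _
  have := @hi (0, ee k) 0 (by rw [h3, map_zero])
  simp [ee] at this

/-- In codimension at least `d - 1`, the fibres of a holomorphic map become countable after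
adding a suitable small linear map. -/
theorem exists_countable_fibres (hm : 2 * d ≤ m + 1) {Ω : Set (Cn d)} (hΩ : IsOpen Ω)
    {R : Cn d → Cn m} (hR : DifferentiableOn ℂ R Ω) {η : ℝ} (hη : 0 < η) :
    ∃ A : Cn d →L[ℂ] Cn m, ‖A‖ < η ∧ ∀ w, {z ∈ Ω | R z + A z = w}.Countable := by
  rcases Nat.eq_zero_or_pos d with rfl | hd
  · exact ⟨0, by simpa using hη, fun w => Set.Subsingleton.countable
      fun x _ y _ => Subsingleton.elim x y⟩
  have hRc := contDiffOn_of_holomorphic_vector hΩ hR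
  obtain ⟨A, hA, hreg⟩ := exists_linear_regular (N := d - 1) (by omega) hΩ hRc hη
  refine ⟨A, hA, fun w => ?_⟩
  have hdiff : ∀ z ∈ Ω, DifferentiableAt ℂ R z := fun z hz => hR.differentiableAt (hΩ.mem_nhds hz)
  have hexc : {z ∈ Ω | ¬ Function.Injective (fderiv ℂ R z + A)}.Countable := by
    have hk : ∀ k : Fin d, {x ∈ Ω ×ˢ (univ : Set (Cn (d - 1))) |
        fderiv ℝ R x.1 (lastOne k x.2) + A (lastOne k x.2) = 0}.Countable := fun k => by
      refine countable_of_injective_fderiv (c := 0) (Ψ := fun x : Cn d × Cn (d - 1) =>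
        fderiv ℝ R x.1 (lastOne k x.2) + A (lastOne k x.2)) fun x hx =>
          ⟨hx.2, ?_, hreg k x hx.1 hx.2⟩
      have hlo : ContDiff ℝ ∞ (fun x : Cn d × Cn (d - 1) => (lastOne k x.2 : Cn d)) :=
        (contDiff_lastOne k).comp contDiff_snd
      have hfd : ContDiffOn ℝ ∞ (fderiv ℝ R) Ω := hRc.fderiv_of_isOpen hΩ (by simp)
      have hsm : ContDiffOn ℝ ∞ (fun x : Cn d × Cn (d - 1) =>
          fderiv ℝ R x.1 (lastOne k x.2) + A (lastOne k x.2)) (Ω ×ˢ univ) :=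
        ((hfd.comp contDiffOn_fst fun x hx => hx.1).clm_apply hlo.contDiffOn).add
          ((A.restrictScalars ℝ).contDiff.comp hlo).contDiffOn
      exact (hsm.contDiffAt ((hΩ.prod isOpen_univ).mem_nhds hx.1)).differentiableAt (by simp)
    refine ((countable_iUnion hk).image Prod.fst).mono fun z hz => ?_
    obtain ⟨k, v, hkv⟩ := exists_lastOne_eq_zero (N := d - 1) (by omega) (hdiff z hz.1) hz.2
    exact ⟨(z, v), mem_iUnion.2 ⟨k, ⟨hz.1, mem_univ _⟩, hkv⟩, rfl⟩
  have hreg' : {z ∈ Ω | R z + A z = w ∧ Function.Injective (fderiv ℂ R z + A)}.Countable := by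
    refine countable_of_injective_fderiv (c := w) (Ψ := fun z => R z + A z) fun z hz => ?_
    have h := ((hdiff z hz.1).hasFDerivAt.add A.hasFDerivAt).restrictScalars ℝ
    refine ⟨hz.2.1, h.differentiableAt, ?_⟩
    change Function.Injective (fderiv ℝ (R + ⇑A) z)
    rw [h.fderiv]
    exact hz.2.2
  refine (hexc.union hreg').mono fun z hz => ?_
  by_cases h : Function.Injective (fderiv ℂ R z + A)
  · exact Or.inr ⟨hz.1, hz.2, h⟩
  · exact Or.inl ⟨hz.1, h⟩

end LinearPerturbation

end SCV

namespace SCV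

open MeasureTheory Filter Topology
open scoped ContDiff ENNReal NNReal Convolution ComplexConjugate

section ShellReduction

variable {d m : ℕ} {D L : Set (Cn d)}

/-- The functions defining a shell can be perturbed so that their ratios have countable fibres. -/
lemma HasShell.exists_countable (hD : IsOpen D) (hm : 2 * d ≤ m + 1) (hL : IsCompact L)
    (h : HasShell D (m + 1) L) :
    ∃ (q : Fin (m + 1) → Cn d → ℂ) (P : Set (Cn d)) (c : ℝ), (∀ i, DifferentiableOn ℂ (q i) D) ∧
      IsOpen P ∧ L ⊆ P ∧ IsCompact (closure P) ∧ closure P ⊆ D ∧ 0 < c ∧ c < 1 ∧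
      (∀ i, ∀ x ∈ L, ‖q i x‖ ≤ c) ∧ (∀ z ∈ frontier P, ∃ i, 1 < ‖q i z‖) ∧
      ∀ w : Fin m → ℂ, {z ∈ D | q 0 z ≠ 0 ∧ ∀ j : Fin m, q j.succ z = w j * q 0 z}.Countable := by
  obtain ⟨q, P, hq, hP, hLP, hPc, hPD, hqL, hqP⟩ := h
  have hqc : ContinuousOn (fun z i => q i z) D := continuousOn_pi.2 fun i => (hq i).continuousOn
  have hLD : L ⊆ D := hLP.trans (subset_closure.trans hPD)
  have hFc : IsCompact (frontier P) := hPc.of_isClosed_subset isClosed_frontier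
    frontier_subset_closure
  have hFD : frontier P ⊆ D := frontier_subset_closure.trans hPD
  obtain ⟨c, hc0, hc1, hc⟩ : ∃ c : ℝ, 0 < c ∧ c < 1 ∧ ∀ x ∈ L, ‖fun i => q i x‖ ≤ c := by
    rcases L.eq_empty_or_nonempty with rfl | hne
    · exact ⟨1 / 2, by norm_num, by norm_num, by simp⟩
    obtain ⟨x, hx, hmax⟩ := hL.exists_isMaxOn hne (hqc.mono hLD).norm
    have hx1 : ‖fun i => q i x‖ < 1 := (pi_norm_lt_iff one_pos).2 fun i => hqL i x hx
    refine ⟨max ‖fun i => q i x‖ (1 / 2), by positivity, max_lt hx1 (by norm_num),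
      fun y hy => (hmax hy).trans (le_max_left _ _)⟩
  obtain ⟨e, he, hqe⟩ : ∃ e : ℝ, 0 < e ∧ ∀ x ∈ frontier P, 1 + e ≤ ‖fun i => q i x‖ := by
    rcases (frontier P).eq_empty_or_nonempty with he | hne
    · exact ⟨1, one_pos, by simp [he]⟩
    obtain ⟨x, hx, hmin⟩ := hFc.exists_isMinOn hne (hqc.mono hFD).norm
    have hx1 : 1 < ‖fun i => q i x‖ := by
      obtain ⟨i, hi⟩ := hqP x hx
      exact hi.trans_le (norm_le_pi_norm (fun i => q i x) i)
    exact ⟨‖fun i => q i x‖ - 1, by linarith, fun y hy => by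
      have : ‖fun i => q i x‖ ≤ ‖fun i => q i y‖ := hmin hy
      linarith⟩
  obtain ⟨B, hB⟩ := (hL.union hFc).exists_bound_of_continuousOn (f := fun z => ‖z‖ * ‖q 0 z‖)
    (continuousOn_id.norm.mul ((hq 0).continuousOn.mono (union_subset hLD hFD)).norm)
  obtain ⟨η, hη, hη1, hη2⟩ : ∃ η : ℝ, 0 < η ∧ η * |B| ≤ (1 - c) / 2 ∧ η * |B| < e := by
    have h1 : 0 < min ((1 - c) / 2) (e / 2) := lt_min (by linarith) (by linarith)
    refine ⟨min ((1 - c) / 2) (e / 2) / (|B| + 1), by positivity, ?_, ?_⟩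
    all_goals
      have h2 : min ((1 - c) / 2) (e / 2) / (|B| + 1) * |B| ≤ min ((1 - c) / 2) (e / 2) := by
        rw [div_mul_eq_mul_div, div_le_iff₀ (by positivity)]
        nlinarith [abs_nonneg B]
      have h3 := min_le_left ((1 - c) / 2) (e / 2)
      have h4 := min_le_right ((1 - c) / 2) (e / 2)
      linarith
  have hΩ : IsOpen (D ∩ q 0 ⁻¹' {0}ᶜ) :=
    (hq 0).continuousOn.isOpen_inter_preimage hD isOpen_compl_singleton
  have hRd : DifferentiableOn ℂ (fun z => (WithLp.toLp 2 fun j : Fin m => q j.succ z / q 0 z : Cn m))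
      (D ∩ q 0 ⁻¹' {0}ᶜ) := by
    refine differentiableOn_euclidean.2 fun j => ?_
    simp only [div_eq_mul_inv]
    exact ((hq j.succ).mono inter_subset_left).mul
      (((hq 0).mono inter_subset_left).fun_inv fun x hx => hx.2)
  obtain ⟨A, hA, hAc⟩ := exists_countable_fibres hm hΩ hRd hη
  let q' : Fin (m + 1) → Cn d → ℂ := Fin.cons (q 0) fun j z => q j.succ z + A z j * q 0 z
  have hdist : ∀ x ∈ L ∪ frontier P, ‖(fun i => q' i x) - fun i => q i x‖ ≤ η * |B| := by
    intro x hx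
    refine (pi_norm_le_iff_of_nonneg (by positivity)).2 fun i => ?_
    induction i using Fin.cases with
    | zero => simp only [q', Pi.sub_apply, Fin.cons_zero, sub_self, norm_zero]; positivity
    | succ j =>
      simp only [q', Pi.sub_apply, Fin.cons_succ, add_sub_cancel_left, norm_mul]
      have h1 : ‖A x j‖ ≤ η * ‖x‖ := (PiLp.norm_apply_le (A x) j).trans
        ((A.le_opNorm x).trans (by gcongr))
      have h2 : ‖x‖ * ‖q 0 x‖ ≤ |B| := (le_abs_self _).trans ((hB x hx).trans (le_abs_self _))
      nlinarith [norm_nonneg (q 0 x)]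
  refine ⟨q', P, (1 + c) / 2, fun i => ?_, hP, hLP, hPc, hPD, by linarith, by linarith,
    fun i x hx => ?_, fun z hz => ?_, fun w => ?_⟩
  · induction i using Fin.cases with
    | zero => exact hq 0
    | succ j =>
      exact (hq j.succ).add
        ((((EuclideanSpace.proj j : Cn m →L[ℂ] ℂ).comp A).differentiableOn).mul (hq 0))
  · have h1 := hdist x (Or.inl hx)
    have h2 := norm_le_pi_norm (fun i => q' i x) i
    have h3 := norm_sub_norm_le (fun i => q' i x) (fun i => q i x)
    have h4 := hc x hx
    linarith
  · by_contra! hle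
    have h1 := hdist z (Or.inr hz)
    have h2 : ‖fun i => q' i z‖ ≤ 1 := (pi_norm_le_iff_of_nonneg zero_le_one).2 hle
    have h3 := norm_sub_norm_le (fun i => q i z) (fun i => q' i z)
    rw [norm_sub_rev] at h3
    have h4 := hqe z hz
    linarith
  · refine (hAc (WithLp.toLp 2 w)).mono fun z hz => ?_
    refine ⟨⟨hz.1, hz.2.1⟩, PiLp.ext fun j => ?_⟩
    have h0 : q 0 z ≠ 0 := hz.2.1
    have h1 : q j.succ z + A z j * q 0 z = w j * q 0 z := hz.2.2 j
    simp only [PiLp.add_apply]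
    field_simp
    linear_combination h1

lemma continuousOn_ratio {S : Set (Cn d)} {q : Fin (m + 1) → Cn d → ℂ}
    (hq : ∀ i, ContinuousOn (q i) S) (h0 : ∀ z ∈ S, q 0 z ≠ 0) :
    ContinuousOn (fun z (j : Fin m) => q j.succ z / q 0 z) S := by
  have hj : ∀ j : Fin m, ContinuousOn (fun z => q j.succ z / q 0 z) S := fun j =>
    ContinuousOn.div₀ (hq j.succ) (hq 0) h0
  exact continuousOn_pi.2 hj

/-- If all fibres of the ratios `q_j / q_0` are countable, then near every point of the torus
some level of `‖q_0‖` is avoided by the fibres, uniformly. -/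
lemma exists_avoided_level {K : Set (Cn d)} (hK : IsCompact K) {q : Fin (m + 1) → Cn d → ℂ}
    (hq : ∀ i, ContinuousOn (q i) K)
    (hc : ∀ w : Fin m → ℂ, {z ∈ K | q 0 z ≠ 0 ∧ ∀ j : Fin m, q j.succ z = w j * q 0 z}.Countable)
    {a b : ℝ} (ha : 0 < a) (hab : a < b) :
    ∃ δ > 0, ∀ u ∈ pi univ fun _ : Fin m => sphere (0 : ℂ) 1, ∃ s ∈ Ioo a b, ∀ z ∈ K, ‖q 0 z‖ = s →
      δ ≤ dist (fun j : Fin m => q j.succ z / q 0 z) u := by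
  refine (isCompact_univ_pi fun _ : Fin m => isCompact_sphere (0 : ℂ) 1).induction_on
    (p := fun S => ∃ δ > 0, ∀ u ∈ S, ∃ s ∈ Ioo a b, ∀ z ∈ K, ‖q 0 z‖ = s →
      δ ≤ dist (fun j : Fin m => q j.succ z / q 0 z) u) ?_ ?_ ?_ ?_
  · exact ⟨1, one_pos, by simp⟩
  · rintro S T hST ⟨δ, hδ, h⟩
    exact ⟨δ, hδ, fun u hu => h u (hST hu)⟩
  · rintro S T ⟨δ, hδ, h⟩ ⟨δ', hδ', h'⟩
    refine ⟨min δ δ', lt_min hδ hδ', fun u hu => ?_⟩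
    rcases hu with hu | hu
    · obtain ⟨s, hs, hz⟩ := h u hu
      exact ⟨s, hs, fun z hzK hzs => (min_le_left _ _).trans (hz z hzK hzs)⟩
    · obtain ⟨s, hs, hz⟩ := h' u hu
      exact ⟨s, hs, fun z hzK hzs => (min_le_right _ _).trans (hz z hzK hzs)⟩
  · intro w _
    obtain ⟨s, hs, hsw⟩ := ((hc w).image fun z => ‖q 0 z‖).dense_compl ℝ |>.inter_open_nonempty _
      isOpen_Ioo (nonempty_Ioo.2 hab)
    have hZ : IsCompact (K ∩ (fun z => ‖q 0 z‖) ⁻¹' {s}) :=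
      hK.of_isClosed_subset ((hq 0).norm.preimage_isClosed_of_isClosed hK.isClosed
        isClosed_singleton) inter_subset_left
    have hne : ∀ z ∈ K ∩ (fun z => ‖q 0 z‖) ⁻¹' {s}, q 0 z ≠ 0 := fun z hz h0 => by
      have h1 : ‖q 0 z‖ = s := hz.2
      rw [h0, norm_zero] at h1
      linarith [hs.1]
    have hcont : ContinuousOn (fun z => dist (fun j : Fin m => q j.succ z / q 0 z) w)
        (K ∩ (fun z => ‖q 0 z‖) ⁻¹' {s}) :=
      (continuous_id.dist continuous_const).comp_continuousOn
        (continuousOn_ratio (fun i => (hq i).mono inter_subset_left) hne)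
    obtain ⟨δ, hδ, hδz⟩ : ∃ δ > 0, ∀ z ∈ K ∩ (fun z => ‖q 0 z‖) ⁻¹' {s},
        2 * δ ≤ dist (fun j : Fin m => q j.succ z / q 0 z) w := by
      rcases (K ∩ (fun z => ‖q 0 z‖) ⁻¹' {s}).eq_empty_or_nonempty with he | hn
      · exact ⟨1, one_pos, by simp [he]⟩
      obtain ⟨x, hx, hmin⟩ := hZ.exists_isMinOn hn hcont
      have hpos : 0 < dist (fun j : Fin m => q j.succ x / q 0 x) w := by
        refine dist_pos.2 fun h => hsw ⟨x, ⟨hx.1, hne x hx, fun j => ?_⟩, hx.2⟩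
        rw [← congrFun h j, div_mul_cancel₀ _ (hne x hx)]
      refine ⟨dist (fun j : Fin m => q j.succ x / q 0 x) w / 2, by positivity, fun z hz => ?_⟩
      have : dist (fun j : Fin m => q j.succ x / q 0 x) w ≤
        dist (fun j : Fin m => q j.succ z / q 0 z) w := hmin hz
      linarith
    refine ⟨ball w δ, mem_nhdsWithin_of_mem_nhds (ball_mem_nhds w hδ), δ, hδ, fun u hu =>
      ⟨s, hs, fun z hz hzs => ?_⟩⟩
    have h1 := hδz z ⟨hz, hzs⟩
    have h2 := dist_triangle (fun j : Fin m => q j.succ z / q 0 z) u w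
    rw [mem_ball] at hu
    linarith

/-- The root of unity nearest to a number whose `ν`-th power is close to one. -/
def nearRoot (ν : ℕ) (x : ℂ) : ℂ := x * cexp (-(log (x ^ ν) / ν))

lemma nearRoot_pow {ν : ℕ} (hν : ν ≠ 0) {x : ℂ} (hx : ‖x ^ ν - 1‖ ≤ 1 / 2) :
    nearRoot ν x ^ ν = 1 := by
  have hx0 : x ^ ν ≠ 0 := fun h => by
    rw [h] at hx
    norm_num at hx
  rw [nearRoot, mul_pow, ← Complex.exp_nat_mul, mul_neg,
    mul_div_cancel₀ _ (Nat.cast_ne_zero.2 hν), Complex.exp_neg, exp_log hx0, mul_inv_cancel₀ hx0]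

lemma dist_nearRoot_le {ν : ℕ} (hν : ν ≠ 0) {x : ℂ} (hx : ‖x ^ ν - 1‖ ≤ 1 / 2) :
    dist x (nearRoot ν x) ≤ 2 / ν := by
  have h1 : ‖log (x ^ ν)‖ ≤ 1 := by
    have := norm_log_one_add_half_le_self hx
    rw [add_sub_cancel] at this
    linarith
  have hν1 : (1 : ℝ) ≤ ν := by exact_mod_cast Nat.one_le_iff_ne_zero.2 hν
  have h2 : ‖log (x ^ ν) / ν‖ ≤ 1 / ν := by
    rw [norm_div, norm_natCast]
    gcongr
  have h3 : ‖log (x ^ ν) / ν‖ ≤ 1 := h2.trans ((div_le_one (by linarith)).2 hν1)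
  have hroot : ‖nearRoot ν x‖ = 1 := norm_eq_one_of_pow_eq_one (nearRoot_pow hν hx) hν
  have h4 : x = nearRoot ν x * cexp (log (x ^ ν) / ν) := by
    rw [nearRoot, mul_assoc, ← Complex.exp_add, neg_add_cancel, Complex.exp_zero, mul_one]
  rw [dist_eq_norm]
  nth_rewrite 1 [h4]
  rw [← mul_sub_one, norm_mul, hroot, one_mul]
  refine (norm_exp_sub_one_le h3).trans ?_
  linarith [show (2 : ℝ) / ν = 2 * (1 / ν) by ring]

lemma continuousAt_nearRoot {ν : ℕ} {x : ℂ} (hx : ‖x ^ ν - 1‖ ≤ 1 / 2) :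
    ContinuousAt (nearRoot ν) x := by
  have hs : x ^ ν ∈ slitPlane := by
    refine Or.inl ?_
    have := (abs_re_le_norm (x ^ ν - 1)).trans hx
    rw [abs_le, sub_re, one_re] at this
    linarith
  exact continuousAt_id.mul (((continuousAt_id.pow ν).clog hs).div_const _).neg.cexp

end ShellReduction

end SCV

namespace SCV

open MeasureTheory Filter Topology
open scoped ContDiff ENNReal NNReal Convolution ComplexConjugate

section ShellDimension

variable {d m : ℕ} {D L : Set (Cn d)}

lemma exists_pow_conditions {a b c e δ : ℝ} (ha : 0 < a) (hab : a < b) (hbc : b < c) (hce : c < e)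
    (he : e < 1) (hδ : 0 < δ) :
    ∃ ν : ℕ, ν ≠ 0 ∧ 2 * a ^ ν < b ^ ν ∧ 2 * b ^ ν ≤ c ^ ν ∧ b ^ ν + e ^ ν < 1 ∧ 2 / ν < δ := by
  have hb : 0 < b := ha.trans hab
  have hc : 0 < c := hb.trans hbc
  have hr : ∀ {x y : ℝ}, 0 < x → x < y → ∀ᶠ ν : ℕ in atTop, 2 * x ^ ν < y ^ ν := fun {x y} hx hxy => by
    have hy : 0 < y := hx.trans hxy
    filter_upwards [(tendsto_pow_atTop_nhds_zero_of_lt_one (by positivity)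
      ((div_lt_one hy).2 hxy)).eventually (gt_mem_nhds (show (0 : ℝ) < 1 / 2 by norm_num))] with ν hν
    rw [div_pow, div_lt_iff₀ (by positivity)] at hν
    linarith
  have h1 : ∀ {x : ℝ}, 0 < x → x < 1 → ∀ᶠ ν : ℕ in atTop, x ^ ν < 1 / 2 := fun {x} hx hx1 =>
    (tendsto_pow_atTop_nhds_zero_of_lt_one hx.le hx1).eventually (gt_mem_nhds (by norm_num))
  have h2 : ∀ᶠ ν : ℕ in atTop, (2 : ℝ) / ν < δ :=
    (tendsto_const_div_atTop_nhds_zero_nat 2).eventually (gt_mem_nhds hδ)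
  obtain ⟨ν, h3, h4, h5, h6, h7, h8⟩ := ((hr ha hab).and ((hr hb hbc).and ((h1 hb (by linarith)).and
    ((h1 (hc.trans hce) he).and (h2.and (eventually_ne_atTop 0)))))).exists
  exact ⟨ν, h8, h3, h4.le, by linarith, h7⟩

/-- One of the functions defining a shell can be dispensed with when there are many of them. -/
lemma HasShell.pred (hD : IsOpen D) (hm : 2 * d ≤ m + 1) (hL : IsCompact L)
    (h : HasShell D (m + 1) L) : HasShell D m L := by
  obtain ⟨q, P, c, hq, hP, hLP, hPc, hPD, hc0, hc1, hqL, hqP, hcount⟩ := h.exists_countable hD hm hL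
  obtain ⟨b, hcb, hb1⟩ := exists_between hc1
  obtain ⟨r, hbr, hr1⟩ := exists_between hb1
  obtain ⟨e, hre, he1⟩ := exists_between hr1
  have hb0 : 0 < b := hc0.trans hcb
  have hr0 : 0 < r := hb0.trans hbr
  have hqc : ∀ i, ContinuousOn (q i) (closure P) := fun i => (hq i).continuousOn.mono hPD
  have hcountP : ∀ w : Fin m → ℂ,
      {z ∈ closure P | q 0 z ≠ 0 ∧ ∀ j : Fin m, q j.succ z = w j * q 0 z}.Countable := fun w =>
    (hcount w).mono (fun z (hz : z ∈ closure P ∧ _) => And.intro (hPD hz.1) hz.2)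
  obtain ⟨δ, hδ, hlev⟩ := exists_avoided_level hPc hqc hcountP hr0 hre
  choose! s hs hsδ using hlev
  obtain ⟨ν, hν, h1, h2, h3, h4⟩ := exists_pow_conditions hc0 hcb hbr hre he1 hδ
  have hbν : 0 < b ^ ν := by positivity
  set Y : Set (Cn d) := {z ∈ closure P | ∀ j : Fin m, ‖q j.succ z ^ ν - q 0 z ^ ν‖ ≤ b ^ ν} with hYdef
  have hY : IsCompact Y := by
    have : Y = closure P ∩ ⋂ j : Fin m, closure P ∩
        (fun z => ‖q j.succ z ^ ν - q 0 z ^ ν‖) ⁻¹' Iic (b ^ ν) := by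
      ext z
      simp only [hYdef, mem_inter_iff, mem_iInter, mem_preimage, mem_Iic]
      exact ⟨fun hz => ⟨hz.1, fun j => ⟨hz.1, hz.2 j⟩⟩, fun hz => ⟨hz.1, fun j => (hz.2 j).2⟩⟩
    rw [this]
    exact hPc.inter_right (isClosed_iInter fun j =>
      (((hqc j.succ).pow ν).sub ((hqc 0).pow ν)).norm.preimage_isClosed_of_isClosed isClosed_closure
        isClosed_Iic)
  have hYP : Y ⊆ closure P := fun z hz => hz.1
  have hnc : ContinuousOn (fun z => ‖q 0 z‖) Y := ((hqc 0).mono hYP).norm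
  set Z : Set (Cn d) := Y ∩ (fun z => ‖q 0 z‖) ⁻¹' Ici r with hZdef
  have hZ : IsCompact Z := hY.of_isClosed_subset
    (hnc.preimage_isClosed_of_isClosed hY.isClosed isClosed_Ici) inter_subset_left
  have hZ0 : ∀ z ∈ Z, q 0 z ≠ 0 := fun z hz h0 => by
    have : r ≤ ‖q 0 z‖ := hz.2
    rw [h0, norm_zero] at this
    linarith
  have hhalf : ∀ z ∈ Z, ∀ j : Fin m, ‖(q j.succ z / q 0 z) ^ ν - 1‖ ≤ 1 / 2 := fun z hz j => by
    have h0 : q 0 z ^ ν ≠ 0 := pow_ne_zero _ (hZ0 z hz)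
    have hr : r ^ ν ≤ ‖q 0 z‖ ^ ν := by
      have : r ≤ ‖q 0 z‖ := hz.2
      gcongr
    rw [div_pow, div_sub_one h0, norm_div, norm_pow, div_le_iff₀ (by
      have := hZ0 z hz
      positivity)]
    linarith [hz.1.2 j]
  let u : Cn d → Fin m → ℂ := fun z j => nearRoot ν (q j.succ z / q 0 z)
  have huc : ContinuousOn u Z := by
    have hrat := continuousOn_pi.1
      (continuousOn_ratio (fun i => (hqc i).mono (inter_subset_left.trans hYP)) hZ0)
    refine continuousOn_pi.2 fun j z hz => ?_
    exact ContinuousAt.comp_continuousWithinAt (f := fun z => q j.succ z / q 0 z)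
      (continuousAt_nearRoot (hhalf z hz j)) (hrat j z hz)
  have hroots : (pi univ fun _ : Fin m => {x : ℂ | x ^ ν = 1}).Finite := by
    refine Set.Finite.pi fun _ => ?_
    refine ((Polynomial.nthRoots ν (1 : ℂ)).toFinset.finite_toSet).subset fun x hx => ?_
    simpa [Polynomial.mem_nthRoots (Nat.pos_of_ne_zero hν)] using hx
  have huroot : MapsTo u Z (pi univ fun _ : Fin m => {x : ℂ | x ^ ν = 1}) := fun z hz j _ =>
    nearRoot_pow hν (hhalf z hz j)
  have husphere : ∀ z ∈ Z, u z ∈ pi univ fun _ : Fin m => sphere (0 : ℂ) 1 := fun z hz j _ => by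
    rw [mem_sphere_zero_iff_norm]
    exact norm_eq_one_of_pow_eq_one (nearRoot_pow hν (hhalf z hz j)) hν
  have hsc : ContinuousOn (fun z => s (u z)) Z :=
    (hroots.continuousOn s).comp huc huroot
  have hne : ∀ z ∈ Z, ‖q 0 z‖ ≠ s (u z) := fun z hz heq => by
    have h5 := hsδ (u z) (husphere z hz) z hz.1.1 heq
    have h6 : dist (fun j : Fin m => q j.succ z / q 0 z) (u z) ≤ 2 / ν :=
      (dist_pi_le_iff (by positivity)).2 fun j => dist_nearRoot_le hν (hhalf z hz j)
    linarith
  have hgc : ContinuousOn (fun z => ‖q 0 z‖ - s (u z)) Z := (hnc.mono inter_subset_left).sub hsc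
  set Y₁ : Set (Cn d) := (Y ∩ (fun z => ‖q 0 z‖) ⁻¹' Iic r) ∪
    (Z ∩ (fun z => ‖q 0 z‖ - s (u z)) ⁻¹' Iic 0) with hY₁def
  set Y₂ : Set (Cn d) := Z ∩ (fun z => ‖q 0 z‖ - s (u z)) ⁻¹' Ici 0 with hY₂def
  have hY₁ : IsCompact Y₁ := IsCompact.union
    (hY.of_isClosed_subset (hnc.preimage_isClosed_of_isClosed hY.isClosed isClosed_Iic)
      inter_subset_left)
    (hZ.of_isClosed_subset (hgc.preimage_isClosed_of_isClosed hZ.isClosed isClosed_Iic)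
      inter_subset_left)
  have hY₂ : IsCompact Y₂ :=
    hZ.of_isClosed_subset (hgc.preimage_isClosed_of_isClosed hZ.isClosed isClosed_Ici)
      inter_subset_left
  have hdisj : Disjoint Y₁ Y₂ := by
    rw [Set.disjoint_left]
    rintro z (hz | hz) hz2
    · have h5 : ‖q 0 z‖ ≤ r := hz.2
      have h6 : 0 ≤ ‖q 0 z‖ - s (u z) := hz2.2
      linarith [(hs (u z) (husphere z hz2.1)).1]
    · have h5 : ‖q 0 z‖ - s (u z) ≤ 0 := hz.2
      have h6 : 0 ≤ ‖q 0 z‖ - s (u z) := hz2.2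
      exact hne z hz.1 (by linarith)
  have hcover : ∀ z ∈ Y, z ∈ Y₁ ∨ z ∈ Y₂ := fun z hz => by
    rcases le_total ‖q 0 z‖ r with h5 | h5
    · exact Or.inl (Or.inl ⟨hz, h5⟩)
    · rcases le_total (‖q 0 z‖ - s (u z)) 0 with h6 | h6
      · exact Or.inl (Or.inr ⟨⟨hz, h5⟩, h6⟩)
      · exact Or.inr ⟨⟨hz, h5⟩, h6⟩
  have hfront : ∀ z ∈ Y, z ∈ frontier P → z ∈ Y₂ := fun z hz hzP => by
    have h5 : e < ‖q 0 z‖ := by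
      obtain ⟨i, hi⟩ := hqP z hzP
      induction i using Fin.cases with
      | zero => linarith
      | succ j =>
        have h6 : 1 < ‖q j.succ z‖ ^ ν := one_lt_pow₀ hi hν
        have h7 := norm_sub_norm_le (q j.succ z ^ ν) (q 0 z ^ ν)
        rw [norm_pow, norm_pow] at h7
        have h8 := hz.2 j
        exact lt_of_pow_lt_pow_left₀ ν (norm_nonneg _) (by linarith)
    have hzZ : z ∈ Z := ⟨hz, (hre.trans h5).le⟩
    refine ⟨hzZ, ?_⟩
    have := (hs (u z) (husphere z hzZ)).2
    change 0 ≤ ‖q 0 z‖ - s (u z)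
    linarith
  obtain ⟨U₁, U₂, hU₁, hU₂, hYU₁, hYU₂, hUU⟩ := SeparatedNhds.of_isCompact_isCompact hY₁ hY₂ hdisj
  have hcl : closure (P ∩ U₁) ⊆ closure P := closure_mono inter_subset_left
  have hq' : ∀ j : Fin m, DifferentiableOn ℂ
      (fun z => (q j.succ z ^ ν - q 0 z ^ ν) * ((b ^ ν : ℝ) : ℂ)⁻¹) D := fun j =>
    (((hq j.succ).pow ν).sub ((hq 0).pow ν)).mul_const _
  have hnorm : ∀ (j : Fin m) z, ‖(q j.succ z ^ ν - q 0 z ^ ν) * ((b ^ ν : ℝ) : ℂ)⁻¹‖ =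
      ‖q j.succ z ^ ν - q 0 z ^ ν‖ / b ^ ν := fun j z => by
    rw [← div_eq_mul_inv, norm_div, norm_real, Real.norm_of_nonneg hbν.le]
  have hqL' : ∀ x ∈ L, ∀ j : Fin m, ‖q j.succ x ^ ν - q 0 x ^ ν‖ < b ^ ν := fun x hx j => by
    have h5 := norm_sub_le (q j.succ x ^ ν) (q 0 x ^ ν)
    rw [norm_pow, norm_pow] at h5
    have h6 : ∀ i, ‖q i x‖ ^ ν ≤ c ^ ν := fun i => by
      have := hqL i x hx
      gcongr
    linarith [h6 0, h6 j.succ]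
  refine ⟨fun j z => (q j.succ z ^ ν - q 0 z ^ ν) * ((b ^ ν : ℝ) : ℂ)⁻¹, P ∩ U₁, hq', hP.inter hU₁,
    fun x hx => ⟨hLP hx, hYU₁ (Or.inl ⟨⟨subset_closure (hLP hx), fun j => (hqL' x hx j).le⟩, ?_⟩)⟩,
    hPc.of_isClosed_subset isClosed_closure hcl, hcl.trans hPD, fun j x hx => ?_, fun z hz => ?_⟩
  · exact (hqL 0 x hx).trans (hcb.trans hbr).le
  · rw [hnorm, div_lt_one hbν]
    exact hqL' x hx j
  · by_contra! hle
    have hzcl : z ∈ closure (P ∩ U₁) := frontier_subset_closure hz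
    have hzY : z ∈ Y := ⟨hcl hzcl, fun j => by
      have := hle j
      rwa [hnorm, div_le_one hbν] at this⟩
    rcases hcover z hzY with h5 | h5
    · have hzP : z ∈ frontier P := by
        rw [hP.frontier_eq]
        refine ⟨hcl hzcl, fun hzP => ?_⟩
        rw [(hP.inter hU₁).frontier_eq] at hz
        exact hz.2 ⟨hzP, hYU₁ h5⟩
      exact Set.disjoint_left.1 hdisj h5 (hfront z hzY hzP)
    · obtain ⟨y, hy2, hy1⟩ := mem_closure_iff.1 hzcl U₂ hU₂ (hYU₂ h5)
      exact Set.disjoint_left.1 hUU hy1.2 hy2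

/-- Compact subsets of `D` are surrounded by shells defined by at most `2 d - 1` functions. -/
lemma IsExhaustion.hasShell {s : Cn d → ℝ} (hD : IsOpen D) (hs : IsExhaustion D s)
    (hL : IsCompact L) (hLD : L ⊆ D) (hm : 2 * d ≤ m + 1) : HasShell D m L := by
  obtain ⟨k, hk⟩ := hs.exists_hasShell hD hL hLD
  have : ∀ j, HasShell D (m + j) L → HasShell D m L := fun j => by
    induction j with
    | zero => exact id
    | succ j ih => exact fun h => ih (h.pred hD (by omega) hL)
  exact this k (hk.mono (Nat.le_add_left k m))

end ShellDimension

end SCV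

namespace SCV

open MeasureTheory Filter Topology
open scoped ContDiff ENNReal NNReal Convolution ComplexConjugate

section NormSq

variable {d m : ℕ} {D : Set (Cn d)} {f : Cn d → Cn m}

lemma contDiffOn_norm_sq_of_holomorphic (hD : IsOpen D) (hf : DifferentiableOn ℂ f D) :
    ContDiffOn ℝ ∞ (fun z => ‖f z‖ ^ 2) D :=
  (contDiffOn_of_holomorphic_vector hD hf).norm_sq ℝ

/-- The squared norm of a holomorphic map is plurisubharmonic. -/
lemma levi_norm_sq_nonneg (hD : IsOpen D) (hf : DifferentiableOn ℂ f D) {x : Cn d} (hx : x ∈ D)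
    (v : Cn d) : 0 ≤ levi (fun z => ‖f z‖ ^ 2) x v := by
  have hc : ContDiffOn ℝ ∞ f D := contDiffOn_of_holomorphic_vector hD hf
  have hcx : ContDiffAt ℝ ∞ f x := hc.contDiffAt (hD.mem_nhds hx)
  have hd1 : ∀ᶠ y in 𝓝 x, DifferentiableAt ℂ f y := by
    filter_upwards [hD.mem_nhds hx] with y hy using hf.differentiableAt (hD.mem_nhds hy)
  have hd2 : DifferentiableAt ℝ (fderiv ℝ f) x :=
    ((hcx.of_le two_le_infty).fderiv_right (m := 1) (by norm_num)).differentiableAt (by simp)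
  have hdx : DifferentiableAt ℝ f x := hcx.differentiableAt (by simp)
  have hI : ∀ᶠ y in 𝓝 x, ∀ w, fderiv ℝ f y (I • w) = I • fderiv ℝ f y w := by
    filter_upwards [hd1] with y hy w
    rw [(hy.hasFDerivAt.restrictScalars ℝ).fderiv]
    simp
  have hsymm : IsSymmSndFDerivAt ℝ f x := hcx.isSymmSndFDerivAt (by simpa using two_le_infty)
  have hB : ∀ a b, fderiv ℝ (fderiv ℝ f) x a (I • b) = I • fderiv ℝ (fderiv ℝ f) x a b := by
    intro a b
    have h1 : ∀ b, fderiv ℝ (fun y => fderiv ℝ f y b) x a = fderiv ℝ (fderiv ℝ f) x a b := fun b => by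
      rw [fderiv_clm_apply hd2 (differentiableAt_const _)]
      simp
    have h2 : (fun y => fderiv ℝ f y (I • b)) =ᶠ[𝓝 x] fun y => I • fderiv ℝ f y b :=
      hI.mono fun y hy => hy b
    rw [← h1, ← h1, h2.fderiv_eq,
      fderiv_fun_const_smul (hd2.clm_apply (differentiableAt_const _))]
    rfl
  have key : ∀ w, fderiv ℝ (fun y => fderiv ℝ (fun z => ‖f z‖ ^ 2) y w) x w =
      2 * (inner ℝ (f x) (fderiv ℝ (fderiv ℝ f) x w w) + ‖fderiv ℝ f x w‖ ^ 2) := by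
    intro w
    have h1 : (fun y => fderiv ℝ (fun z => ‖f z‖ ^ 2) y w) =ᶠ[𝓝 x]
        fun y => 2 * inner ℝ (f y) (fderiv ℝ f y w) := by
      filter_upwards [hd1] with y hy
      rw [((hy.restrictScalars ℝ).hasFDerivAt.norm_sq).fderiv]
      simp
    have h2 : DifferentiableAt ℝ (fun y => fderiv ℝ f y w) x :=
      hd2.clm_apply (differentiableAt_const _)
    rw [h1.fderiv_eq, fderiv_const_mul (hdx.inner ℝ h2), smul_apply, fderiv_inner_apply ℝ hdx h2,
      fderiv_clm_apply hd2 (differentiableAt_const _), real_inner_self_eq_norm_sq]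
    simp
  have h3 : fderiv ℝ (fderiv ℝ f) x (I • v) (I • v) = -fderiv ℝ (fderiv ℝ f) x v v := by
    rw [hB, hsymm.eq, hB, smul_smul, I_mul_I, neg_one_smul]
  rw [levi, key, key, h3, inner_neg_right]
  nlinarith [sq_nonneg ‖fderiv ℝ f x v‖, sq_nonneg ‖fderiv ℝ f x (I • v)‖]

end NormSq

section Splitting

variable {d : ℕ} {D P Q : Set (Cn d)} {s φ : Cn d → ℝ}

/-- A holomorphic function can be approximated on the part of `P` below a level of a
plurisubharmonic function, while being almost constant on the part of `Q \ P` below this level. -/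
lemma IsExhaustion.exists_split (hD : IsOpen D) (hs : IsExhaustion D s) (hφ : ContDiffOn ℝ ∞ φ D)
    (hφl : ∀ x ∈ D, ∀ v, 0 ≤ levi φ x v) (hP : IsOpen P) (hQ : IsOpen Q) (hPQ : closure P ⊆ Q)
    (hQc : IsCompact (closure Q)) (hQD : closure Q ⊆ D) {κ : ℝ}
    (hκP : ∀ z ∈ frontier P, κ + 2 < φ z) (hκQ : ∀ z ∈ frontier Q, κ + 2 < φ z) {h : Cn d → ℂ}
    (hh : DifferentiableOn ℂ h D) (M : ℂ) {ε : ℝ} (hε : 0 < ε) :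
    ∃ H : Cn d → ℂ, DifferentiableOn ℂ H D ∧ (∀ z ∈ closure P, φ z ≤ κ → ‖H z - h z‖ < ε) ∧
      ∀ z ∈ closure Q \ P, φ z ≤ κ → ‖H z - M‖ < ε := by
  obtain ⟨θ, hθ, -, hθ1, hθ0, -⟩ := exists_smooth_step
  classical
  let k : Cn d → ℂ := fun z => if z ∈ P then h z else if z ∈ Q then M else 0
  let G : Cn d → ℂ := fun z => (θ (φ z - κ) : ℂ) * k z
  have hφc : ContinuousOn φ D := hφ.continuousOn
  -- away from the two frontiers, `k` is locally holomorphic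
  have hk : ∀ x ∈ D, x ∉ frontier P ∪ frontier Q →
      ∃ g : Cn d → ℂ, DifferentiableOn ℂ g D ∧ k =ᶠ[𝓝 x] g := by
    intro x hx hxF
    rw [mem_union, not_or, hP.frontier_eq, hQ.frontier_eq] at hxF
    by_cases hxP : x ∈ P
    · refine ⟨h, hh, ?_⟩
      filter_upwards [hP.mem_nhds hxP] with y hy
      simp [k, hy]
    have hxcP : x ∉ closure P := fun h => hxF.1 ⟨h, hxP⟩
    have hnP := isClosed_closure.isOpen_compl.mem_nhds hxcP
    by_cases hxQ : x ∈ Q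
    · refine ⟨fun _ => M, differentiableOn_const M, ?_⟩
      filter_upwards [hnP, hQ.mem_nhds hxQ] with y hy hyQ
      simp [k, notMem_subset subset_closure hy, hyQ]
    · have hxcQ : x ∉ closure Q := fun h => hxF.2 ⟨h, hxQ⟩
      refine ⟨fun _ => 0, differentiableOn_const 0, ?_⟩
      filter_upwards [hnP, isClosed_closure.isOpen_compl.mem_nhds hxcQ] with y hy hyQ
      simp [k, notMem_subset subset_closure hy, notMem_subset subset_closure hyQ]
  have hG0 : ∀ x ∈ D, κ + 2 < φ x → G =ᶠ[𝓝 x] fun _ => 0 := fun x hx hlt => by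
    filter_upwards [(hφc.continuousAt (hD.mem_nhds hx)).eventually (lt_mem_nhds hlt)] with y hy
    simp [G, hθ0 (φ y - κ) (by linarith)]
  have hG1 : ∀ x ∈ D, φ x < κ + 1 → G =ᶠ[𝓝 x] k := fun x hx hlt => by
    filter_upwards [(hφc.continuousAt (hD.mem_nhds hx)).eventually (gt_mem_nhds hlt)] with y hy
    simp [G, hθ1 (φ y - κ) (by linarith)]
  have hlow : ∀ x, φ x ≤ κ + 2 → x ∉ frontier P ∪ frontier Q := by
    rintro x hx (h1 | h1)
    · linarith [hκP x h1]
    · linarith [hκQ x h1]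
  have hGc : ContDiffOn ℝ ∞ G D := fun x hx => by
    refine ContDiffAt.contDiffWithinAt ?_
    by_cases hlt : κ + 2 < φ x
    · exact contDiffAt_const.congr_of_eventuallyEq (hG0 x hx hlt)
    · obtain ⟨g, hg, hkg⟩ := hk x hx (hlow x (not_lt.1 hlt))
      have h1 : ContDiffAt ℝ ∞ (fun z => (θ (φ z - κ) : ℂ) * g z) x :=
        (ofRealCLM.contDiff.contDiffAt.comp x (hθ.contDiffAt.comp x
          ((hφ.contDiffAt (hD.mem_nhds hx)).sub contDiffAt_const))).mul
          (contDiffAt_of_holomorphic hD hg hx)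
      refine h1.congr_of_eventuallyEq ?_
      filter_upwards [hkg] with y hy
      simp only [G, hy]
  set C : Set (Cn d) := closure Q ∩ φ ⁻¹' Icc (κ + 1) (κ + 2) with hCdef
  have hC : IsCompact C := hQc.of_isClosed_subset
    ((hφc.mono hQD).preimage_isClosed_of_isClosed isClosed_closure isClosed_Icc) inter_subset_left
  have hCD : C ⊆ D := inter_subset_left.trans hQD
  have hdbar : ∀ x ∈ D \ C, ∀ j, dbar j G x = 0 := by
    rintro x ⟨hx, hxC⟩ j
    rcases lt_or_ge (κ + 2) (φ x) with hlt | hle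
    · rw [dbar_congr (hG0 x hx hlt), dbar_eq_zero_of_differentiableAt (differentiableAt_const 0)]
    rcases lt_or_ge (φ x) (κ + 1) with hlt | hge
    · obtain ⟨g, hg, hkg⟩ := hk x hx (hlow x hle)
      rw [dbar_congr ((hG1 x hx hlt).trans hkg),
        dbar_eq_zero_of_differentiableAt (hg.differentiableAt (hD.mem_nhds hx))]
    · have hxQ : x ∉ closure Q := fun h => hxC ⟨h, hge, hle⟩
      have h1 : G =ᶠ[𝓝 x] fun _ => 0 := by
        filter_upwards [isClosed_closure.isOpen_compl.mem_nhds hxQ] with y hy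
        have hyQ : y ∉ Q := notMem_subset subset_closure hy
        have hyP : y ∉ P := fun h => hyQ (hPQ (subset_closure h))
        simp [G, k, hyQ, hyP]
      rw [dbar_congr h1, dbar_eq_zero_of_differentiableAt (differentiableAt_const 0)]
  obtain ⟨B, hB⟩ := hC.exists_bound_of_continuousOn (f := fun x => ∑ j, ‖dbar j G x‖ ^ 2)
    (continuousOn_finsetSum _ fun j _ =>
      ((contDiffOn_dbar hD hGc j).continuousOn.mono hCD).norm.pow 2)
  set L : Set (Cn d) := closure Q ∩ φ ⁻¹' Iic κ with hLdef
  have hL : IsCompact L := hQc.of_isClosed_subset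
    ((hφc.mono hQD).preimage_isClosed_of_isClosed isClosed_closure isClosed_Iic) inter_subset_left
  have hLD : L ⊆ D := inter_subset_left.trans hQD
  obtain ⟨δ, hδ, hδV⟩ := hL.exists_thickening_subset_open
    (hφc.isOpen_inter_preimage hD (isOpen_Iio (a := κ + 1 / 2)))
    fun x hx => ⟨hLD hx, show φ x < κ + 1 / 2 by
      have : φ x ≤ κ := hx.2
      linarith⟩
  have hball : ∀ z ∈ L, ∀ x ∈ ball z δ, x ∈ D ∧ φ x < κ + 1 / 2 := fun z hz x hx =>
    hδV (mem_thickening_iff.2 ⟨z, hz, hx⟩)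
  obtain ⟨A, hA, hcorr⟩ := hs.exists_correction hD hL hLD hC hCD hδ
  obtain ⟨t, ht, htε⟩ := exists_exp_neg_mul_lt (B := A * |B|) (κ := 1 / 2) (by norm_num)
    (show 0 < ε ^ 2 by positivity)
  obtain ⟨F, hF, hFG⟩ := hcorr (fun z => t * (φ z - (κ + 1 / 2))) G (|B| * Real.exp (-(t * (1 / 2))))
    (by positivity) (contDiffOn_const.mul (hφ.sub contDiffOn_const))
    (fun x hx v => by
      rw [levi_const_mul_sub ((hφ.contDiffAt (hD.mem_nhds hx)).of_le two_le_infty)]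
      exact mul_nonneg ht.le (hφl x hx v))
    hGc hdbar
    (fun x hx => by
      have h1 : ∑ j, ‖dbar j G x‖ ^ 2 ≤ |B| :=
        (le_abs_self _).trans ((hB x hx).trans (le_abs_self _))
      have h2 : κ + 1 ≤ φ x := hx.2.1
      gcongr
      linarith)
  have hfin : ∀ z ∈ L, ‖F z - k z‖ < ε := fun z hz => by
    have h1 := hFG z hz 0
      (fun x hx => (differentiableAt_of_dbar_eq_zero
        ((hGc.contDiffAt (hD.mem_nhds (hball z hz x hx).1)).differentiableAt (by simp))
        (hdbar x ⟨(hball z hz x hx).1, fun hxC => by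
          have h2 : κ + 1 ≤ φ x := hxC.2.1
          linarith [(hball z hz x hx).2]⟩)).differentiableWithinAt)
      (fun x hx => mul_nonpos_of_nonneg_of_nonpos ht.le (by linarith [(hball z hz x hx).2]))
    have h2 : φ z ≤ κ := hz.2
    rw [(hG1 z (hLD hz) (by linarith)).eq_of_nhds, Real.exp_zero, mul_one] at h1
    refine lt_of_pow_lt_pow_left₀ 2 hε.le (h1.trans_lt ?_)
    rwa [← mul_assoc]
  refine ⟨F, hF, fun z hz hzκ => ?_, fun z hz hzκ => ?_⟩
  · have hzP : z ∈ P := by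
      by_contra hzP
      have := hκP z (by rw [hP.frontier_eq]; exact ⟨hz, hzP⟩)
      linarith
    simpa [k, hzP] using hfin z ⟨subset_closure (hPQ hz), hzκ⟩
  · have hzQ : z ∈ Q := by
      by_contra hzQ
      have := hκQ z (by rw [hQ.frontier_eq]; exact ⟨hz.1, hzQ⟩)
      linarith
    simpa [k, hz.2, hzQ] using hfin z ⟨hz.1, hzκ⟩

end Splitting

end SCV

namespace SCV

open MeasureTheory Filter Topology
open scoped ContDiff ENNReal NNReal Convolution ComplexConjugate

section Limits

variable {d m : ℕ} {D : Set (Cn d)} {s : Cn d → ℝ}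

/-- Limits of sequences of holomorphic functions whose increments decay geometrically. -/
lemma exists_limit_of_telescoping (hD : IsOpen D) {F : ℕ → Cn d → ℂ}
    (hF : ∀ k, DifferentiableOn ℂ (F k) D) {ε : ℝ}
    (h : ∀ C ⊆ D, IsCompact C → ∃ k₀, ∀ k ≥ k₀, ∀ z ∈ C, ‖F (k + 1) z - F k z‖ ≤ ε / 2 / 2 ^ k) :
    ∃ f : Cn d → ℂ, DifferentiableOn ℂ f D ∧ ∀ z ∈ D, ∀ k,
      (∀ j ≥ k, ‖F (j + 1) z - F j z‖ ≤ ε / 2 / 2 ^ j) → ‖f z - F k z‖ ≤ ε / 2 ^ k := by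
  have hgeo : ∀ z k, (∀ j ≥ k, ‖F (j + 1) z - F j z‖ ≤ ε / 2 / 2 ^ j) →
      ∀ n, dist (F (n + k) z) (F (n + 1 + k) z) ≤ ε / 2 ^ k / 2 / 2 ^ n := fun z k hk n => by
    have := hk (n + k) (Nat.le_add_left k n)
    rw [dist_comm, dist_eq_norm, show n + 1 + k = n + k + 1 by ring]
    refine this.trans_eq ?_
    rw [pow_add]
    field_simp
  have hlim : ∀ z ∈ D, ∃ w, Tendsto (fun k => F k z) atTop (𝓝 w) := fun z hz => by
    obtain ⟨k, hk⟩ := h {z} (by simpa using hz) isCompact_singleton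
    obtain ⟨w, hw⟩ := cauchySeq_tendsto_of_complete
      (cauchySeq_of_le_geometric_two (hgeo z k fun j hj => hk j hj z rfl))
    exact ⟨w, (tendsto_add_atTop_iff_nat k).1 hw⟩
  choose! f hf using hlim
  have hfF : ∀ z ∈ D, ∀ k, (∀ j ≥ k, ‖F (j + 1) z - F j z‖ ≤ ε / 2 / 2 ^ j) →
      ‖f z - F k z‖ ≤ ε / 2 ^ k := fun z hz k hk => by
    have := dist_le_of_le_geometric_two_of_tendsto₀ (hgeo z k hk)
      ((tendsto_add_atTop_iff_nat k).2 (hf z hz))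
    rwa [zero_add, dist_comm, dist_eq_norm] at this
  refine ⟨f, differentiableOn_of_tendstoLocallyUniformlyOn hD hF ?_, hfF⟩
  refine (tendstoLocallyUniformlyOn_iff_forall_isCompact hD).2 fun C hCD hC => ?_
  obtain ⟨k₀, hk₀⟩ := h C hCD hC
  rw [Metric.tendstoUniformlyOn_iff]
  intro η hη
  have h0 : Tendsto (fun k : ℕ => ε / 2 ^ k) atTop (𝓝 0) :=
    tendsto_const_nhds.div_atTop (tendsto_pow_atTop_atTop_of_one_lt one_lt_two)
  filter_upwards [h0.eventually (gt_mem_nhds hη), eventually_ge_atTop k₀] with k hk hkk z hz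
  rw [dist_eq_norm]
  exact (hfF z (hCD hz) k fun j hj => hk₀ j (hkk.trans hj) z hz).trans_lt hk

/-- Adding large powers of the functions of a shell makes a map large on its frontier. -/
lemma HasShell.exists_large {L : Set (Cn d)} (hL : IsCompact L) (h : HasShell D m L)
    {f : Fin m → Cn d → ℂ} (hf : ∀ i, DifferentiableOn ℂ (f i) D) {ε : ℝ} (hε : 0 < ε) (c : ℝ) :
    ∃ (g : Fin m → Cn d → ℂ) (P : Set (Cn d)), (∀ i, DifferentiableOn ℂ (g i) D) ∧ IsOpen P ∧
      L ⊆ P ∧ IsCompact (closure P) ∧ closure P ⊆ D ∧ (∀ i, ∀ z ∈ L, ‖g i z - f i z‖ < ε) ∧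
      ∀ z ∈ frontier P, ∃ i, c < ‖g i z‖ := by
  obtain ⟨q, P, hq, hP, hLP, hPc, hPD, hqL, hqP⟩ := h
  have hqc : ContinuousOn (fun z i => q i z) D := continuousOn_pi.2 fun i => (hq i).continuousOn
  have hfc : ContinuousOn (fun z i => f i z) D := continuousOn_pi.2 fun i => (hf i).continuousOn
  have hLD : L ⊆ D := hLP.trans (subset_closure.trans hPD)
  have hFc : IsCompact (frontier P) := hPc.of_isClosed_subset isClosed_frontier
    frontier_subset_closure
  have hFD : frontier P ⊆ D := frontier_subset_closure.trans hPD
  obtain ⟨a, ha0, ha1, ha⟩ : ∃ a : ℝ, 0 ≤ a ∧ a < 1 ∧ ∀ x ∈ L, ‖fun i => q i x‖ ≤ a := by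
    rcases L.eq_empty_or_nonempty with rfl | hne
    · exact ⟨0, le_rfl, one_pos, by simp⟩
    obtain ⟨x, hx, hmax⟩ := hL.exists_isMaxOn hne (hqc.mono hLD).norm
    exact ⟨‖fun i => q i x‖, norm_nonneg _, (pi_norm_lt_iff one_pos).2 fun i => hqL i x hx,
      fun y hy => hmax hy⟩
  obtain ⟨b, hb1, hb⟩ : ∃ b : ℝ, 1 < b ∧ ∀ x ∈ frontier P, b ≤ ‖fun i => q i x‖ := by
    rcases (frontier P).eq_empty_or_nonempty with he | hne
    · exact ⟨2, one_lt_two, by simp [he]⟩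
    obtain ⟨x, hx, hmin⟩ := hFc.exists_isMinOn hne (hqc.mono hFD).norm
    obtain ⟨i, hi⟩ := hqP x hx
    exact ⟨‖fun i => q i x‖, hi.trans_le (norm_le_pi_norm (fun i => q i x) i), fun y hy => hmin hy⟩
  obtain ⟨B, hB⟩ := hFc.exists_bound_of_continuousOn (hfc.mono hFD)
  obtain ⟨N, hNa, hNb, hN0⟩ := (((tendsto_pow_atTop_nhds_zero_of_lt_one ha0 ha1).eventually
    (gt_mem_nhds hε)).and (((tendsto_pow_atTop_atTop_of_one_lt hb1).eventually_gt_atTop (c + B)).and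
    (eventually_ne_atTop 0))).exists
  refine ⟨fun i z => f i z + q i z ^ N, P, fun i => (hf i).add ((hq i).pow N), hP, hLP, hPc, hPD,
    fun i z hz => ?_, fun z hz => ?_⟩
  · rw [add_sub_cancel_left, norm_pow]
    exact (pow_le_pow_left₀ (norm_nonneg _) ((norm_le_pi_norm (fun i => q i z) i).trans (ha z hz))
      N).trans_lt hNa
  · obtain ⟨i, hi⟩ : ∃ i, b ≤ ‖q i z‖ := by
      by_contra! hlt
      exact (hb z hz).not_gt ((pi_norm_lt_iff (by linarith)).2 hlt)
    refine ⟨i, ?_⟩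
    have h1 : b ^ N ≤ ‖q i z ^ N‖ := by
      rw [norm_pow]
      gcongr
    have h2 := (norm_le_pi_norm (fun i => f i z) i).trans (hB z hz)
    have h3 := norm_sub_le (f i z + q i z ^ N) (f i z)
    rw [add_sub_cancel_left] at h3
    linarith

/-- Holomorphic maps can be approximated by maps which are large on the frontiers of an exhausting
sequence of relatively compact open sets. -/
lemma IsExhaustion.exists_large_on_frontiers (hD : IsOpen D) (hs : IsExhaustion D s)
    (hm : 2 * d ≤ m + 1) {K : Set (Cn d)} (hK : IsCompact K) (hKD : K ⊆ D) {f : Fin m → Cn d → ℂ}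
    (hf : ∀ i, DifferentiableOn ℂ (f i) D) {ε : ℝ} (hε : 0 < ε) (c : ℕ → ℝ) :
    ∃ (g : Fin m → Cn d → ℂ) (P : ℕ → Set (Cn d)), (∀ i, DifferentiableOn ℂ (g i) D) ∧
      (∀ k, IsOpen (P k)) ∧ (∀ k, IsCompact (closure (P k))) ∧ (∀ k, closure (P k) ⊆ D) ∧
      (∀ k, closure (P k) ⊆ P (k + 1)) ∧ (∀ C ⊆ D, IsCompact C → ∃ k, C ⊆ P k) ∧ K ⊆ P 0 ∧
      (∀ i, ∀ z ∈ K, ‖g i z - f i z‖ ≤ ε) ∧ ∀ k, ∀ z ∈ frontier (P k), ∃ i, c k < ‖g i z‖ := by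
  let S := {p : (Fin m → Cn d → ℂ) × Set (Cn d) //
    (∀ i, DifferentiableOn ℂ (p.1 i) D) ∧ IsCompact p.2 ∧ p.2 ⊆ D}
  have hstep : ∀ (k : ℕ) (p : S), ∃ (g : Fin m → Cn d → ℂ) (P : Set (Cn d)),
      (∀ i, DifferentiableOn ℂ (g i) D) ∧ IsOpen P ∧ p.1.2 ⊆ P ∧ IsCompact (closure P) ∧
      closure P ⊆ D ∧ (∀ i, ∀ z ∈ p.1.2, ‖g i z - p.1.1 i z‖ < ε / 2 / 2 ^ k) ∧
      ∀ z ∈ frontier P, ∃ i, c k + ε < ‖g i z‖ := fun k p =>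
    (hs.hasShell hD p.2.2.1 p.2.2.2 hm).exists_large p.2.2.1 p.2.1 (by positivity) _
  choose g P hg hP hLP hPc hPD hgf hgP using hstep
  let next : ℕ → S → S := fun k p => ⟨(g k p, closure (P k p) ∪ {x | x ∈ D ∧ s x ≤ k}), hg k p,
    (hPc k p).union (hs.compact k), union_subset (hPD k p) fun x hx => hx.1⟩
  let σ : ℕ → S := fun k => Nat.rec ⟨(f, K), hf, hK, hKD⟩ next k
  have hσ : ∀ k, σ (k + 1) = next k (σ k) := fun k => rfl
  have hLmono : Monotone fun k => (σ k).1.2 := monotone_nat_of_le_succ fun k =>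
    (hLP k (σ k)).trans (subset_closure.trans subset_union_left)
  have hexh : ∀ C ⊆ D, IsCompact C → ∃ k, C ⊆ (σ k).1.2 := fun C hCD hC => by
    obtain ⟨B, hB⟩ := hC.exists_bound_of_continuousOn (hs.contDiffOn.continuousOn.mono hCD)
    obtain ⟨k, hk⟩ := exists_nat_ge B
    exact ⟨k + 1, fun x hx => Or.inr ⟨hCD hx, (le_abs_self _).trans ((hB x hx).trans hk)⟩⟩
  have htel : ∀ i k, ∀ z ∈ (σ k).1.2, ∀ j ≥ k,
      ‖(σ (j + 1)).1.1 i z - (σ j).1.1 i z‖ ≤ ε / 2 / 2 ^ j := fun i k z hz j hj =>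
    (hgf j (σ j) i z (hLmono hj hz)).le
  choose G hG hGσ using fun i => exists_limit_of_telescoping (F := fun k => (σ k).1.1 i) hD
    (fun k => (σ k).2.1 i) (ε := ε) fun C hCD hC => by
      obtain ⟨k, hk⟩ := hexh C hCD hC
      exact ⟨k, fun j hj z hz => htel i k z (hk hz) j hj⟩
  refine ⟨G, fun k => P k (σ k), hG, fun k => hP k _, fun k => hPc k _, fun k => hPD k _,
    fun k => subset_union_left.trans (hLP (k + 1) (σ (k + 1))), fun C hCD hC => ?_, hLP 0 (σ 0),
    fun i z hz => ?_, fun k z hz => ?_⟩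
  · obtain ⟨k, hk⟩ := hexh C hCD hC
    exact ⟨k, hk.trans (hLP k (σ k))⟩
  · exact (hGσ i z (hKD hz) 0 (htel i 0 z hz)).trans_eq (by simp)
  · obtain ⟨i, hi⟩ := hgP k (σ k) z hz
    have hzL : z ∈ (σ (k + 1)).1.2 := Or.inl (frontier_subset_closure hz)
    have h1 : ‖G i z - g k (σ k) i z‖ ≤ ε / 2 ^ (k + 1) :=
      hGσ i z ((σ (k + 1)).2.2.2 hzL) (k + 1) (htel i (k + 1) z hzL)
    have h2 : ε / 2 ^ (k + 1) ≤ ε := div_le_self hε.le (one_le_pow₀ one_le_two)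
    have h3 := norm_sub_norm_le (g k (σ k) i z) (G i z)
    rw [norm_sub_rev] at h3
    exact ⟨i, by linarith⟩

/-- Given a plurisubharmonic function which is large on the frontiers of an exhausting sequence,
there are holomorphic functions which are large wherever it is small. -/
lemma IsExhaustion.exists_complementary (hD : IsOpen D) (hs : IsExhaustion D s) {φ : Cn d → ℝ}
    (hφ : ContDiffOn ℝ ∞ φ D) (hφl : ∀ x ∈ D, ∀ v, 0 ≤ levi φ x v) {P : ℕ → Set (Cn d)}
    (hP : ∀ k, IsOpen (P k)) (hPc : ∀ k, IsCompact (closure (P k))) (hPD : ∀ k, closure (P k) ⊆ D)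
    (hPs : ∀ k, closure (P k) ⊆ P (k + 1)) (hexh : ∀ C ⊆ D, IsCompact C → ∃ k, C ⊆ P k) {κ : ℝ}
    (hκ : ∀ k : ℕ, ∀ z ∈ frontier (P k), κ + k + 2 < φ z) {h : Cn d → ℂ}
    (hh : DifferentiableOn ℂ h D) {ε : ℝ} (hε : 0 < ε) :
    ∃ H : Cn d → ℂ, DifferentiableOn ℂ H D ∧ (∀ z ∈ P 0, φ z ≤ κ → ‖H z - h z‖ ≤ ε) ∧
      ∀ k : ℕ, ∀ z ∈ P (k + 1) \ P k, φ z ≤ κ + k → k ≤ ‖H z‖ := by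
  have hstep : ∀ (k : ℕ) (p : {h : Cn d → ℂ // DifferentiableOn ℂ h D}), ∃ H : Cn d → ℂ,
      DifferentiableOn ℂ H D ∧
      (∀ z ∈ closure (P k), φ z ≤ κ + k → ‖H z - p.1 z‖ < ε / 2 / 2 ^ k) ∧
      ∀ z ∈ closure (P (k + 1)) \ P k, φ z ≤ κ + k → ‖H z - (k + ε : ℝ)‖ < ε / 2 / 2 ^ k := fun k p =>
    hs.exists_split hD hφ hφl (hP k) (hP (k + 1)) (hPs k) (hPc (k + 1)) (hPD (k + 1)) (hκ k)
      (fun z hz => by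
        have := hκ (k + 1) z hz
        push_cast at this
        linarith) p.2 _ (by positivity)
  choose N hN hNp hNM using hstep
  let σ : ℕ → {h : Cn d → ℂ // DifferentiableOn ℂ h D} := fun k =>
    Nat.rec ⟨h, hh⟩ (fun k p => ⟨N k p, hN k p⟩) k
  have hPmono : Monotone P := monotone_nat_of_le_succ fun k => subset_closure.trans (hPs k)
  have htel : ∀ k : ℕ, ∀ z ∈ P k, φ z ≤ κ + k → ∀ j ≥ k,
      ‖(σ (j + 1)).1 z - (σ j).1 z‖ ≤ ε / 2 / 2 ^ j := fun k z hz hzφ j hj => by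
    have : (k : ℝ) ≤ j := by exact_mod_cast hj
    exact (hNp j (σ j) z (subset_closure (hPmono hj hz)) (by linarith)).le
  obtain ⟨H, hH, hHσ⟩ := exists_limit_of_telescoping (F := fun k => (σ k).1) hD
    (fun k => (σ k).2) (ε := ε) fun C hCD hC => by
      obtain ⟨k, hk⟩ := hexh C hCD hC
      obtain ⟨B, hB⟩ := hC.exists_bound_of_continuousOn (hφ.continuousOn.mono hCD)
      obtain ⟨l, hl⟩ := exists_nat_ge (B - κ)
      refine ⟨max k l, fun j hj z hz => htel (max k l) z (hPmono (le_max_left k l) (hk hz)) ?_ j hj⟩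
      have h1 := (le_abs_self _).trans (hB z hz)
      have h2 : (l : ℝ) ≤ (max k l : ℕ) := by exact_mod_cast le_max_right k l
      linarith
  refine ⟨H, hH, fun z hz hzφ => ?_, fun k z hz hzφ => ?_⟩
  · exact (hHσ z (hPD 0 (subset_closure hz)) 0 (htel 0 z hz (by simpa using hzφ))).trans_eq
      (by simp)
  · have h1 : ‖H z - N k (σ k) z‖ ≤ ε / 2 ^ (k + 1) :=
      hHσ z (hPD _ (subset_closure hz.1)) (k + 1) (htel (k + 1) z hz.1 (by push_cast; linarith))
    have h2 := hNM k (σ k) z ⟨subset_closure hz.1, hz.2⟩ hzφ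
    have h3 : ε / 2 ^ (k + 1) ≤ ε / 2 := by
      rw [pow_succ', ← div_div]
      exact div_le_self (by positivity) (one_le_pow₀ one_le_two)
    have h4 : ε / 2 / 2 ^ k ≤ ε / 2 := div_le_self (by positivity) (one_le_pow₀ one_le_two)
    have h5 := norm_sub_le_norm_sub_add_norm_sub (H z) (N k (σ k) z) ((k + ε : ℝ) : ℂ)
    have h6 := norm_sub_norm_le ((k + ε : ℝ) : ℂ) (H z)
    rw [norm_sub_rev, norm_real, Real.norm_of_nonneg (by positivity)] at h6
    linarith

end Limits

end SCV

namespace SCV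

open MeasureTheory Filter Topology
open scoped ContDiff ENNReal NNReal Convolution ComplexConjugate

section ProperMaps

variable {d m : ℕ} {D K : Set (Cn d)} {s : Cn d → ℝ}

/-- Approximation of holomorphic maps into `ℂ^(m + 1)` by proper ones. -/
theorem IsExhaustion.exists_proper (hD : IsOpen D) (hs : IsExhaustion D s) (hm : 2 * d ≤ m + 1)
    {f₀ : Cn d → Cn (m + 1)} (hf₀ : DifferentiableOn ℂ f₀ D) (hK : IsCompact K) (hKD : K ⊆ D)
    {ε : ℝ} (hε : 0 < ε) :
    ∃ f : Cn d → Cn (m + 1), DifferentiableOn ℂ f D ∧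
      (∀ R, ∃ C ⊆ D, IsCompact C ∧ ∀ z ∈ D, ‖f z‖ ≤ R → z ∈ C) ∧ ∀ z ∈ K, ‖f z - f₀ z‖ < ε := by
  have hf₀' := differentiableOn_euclidean.1 hf₀
  set η : ℝ := ε / (m + 2) with hηdef
  have hη : 0 < η := by positivity
  obtain ⟨B, hB⟩ := hK.exists_bound_of_continuousOn (hf₀.continuousOn.mono hKD)
  set κ : ℝ := m * (|B| + η) ^ 2 with hκdef
  have hκ0 : 0 ≤ κ := by positivity
  obtain ⟨g, P, hg, hP, hPc, hPD, hPs, hexh, hKP, hgf, hgP⟩ := hs.exists_large_on_frontiers hD hm hK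
    hKD (f := fun i z => f₀ z i.succ) (fun i => hf₀' i.succ) hη fun k => κ + k + 2
  have hG : DifferentiableOn ℂ (fun z => (WithLp.toLp 2 fun i => g i z : Cn m)) D :=
    differentiableOn_euclidean.2 hg
  have hφ : ∀ z, ‖(WithLp.toLp 2 fun i => g i z : Cn m)‖ ^ 2 = ∑ i, ‖g i z‖ ^ 2 := fun z =>
    EuclideanSpace.norm_sq_eq _
  obtain ⟨H, hH, hHK, hHP⟩ := hs.exists_complementary hD (contDiffOn_norm_sq_of_holomorphic hD hG)
    (fun x hx => levi_norm_sq_nonneg hD hG hx) hP hPc hPD hPs hexh (κ := κ)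
    (fun k z hz => by
      obtain ⟨i, hi⟩ := hgP k z hz
      have h1 : ‖g i z‖ ^ 2 ≤ ∑ i, ‖g i z‖ ^ 2 :=
        Finset.single_le_sum (f := fun i => ‖g i z‖ ^ 2) (fun j _ => sq_nonneg _) (Finset.mem_univ i)
      have h2 : (0 : ℝ) ≤ k := k.cast_nonneg
      rw [hφ]
      nlinarith)
    (hf₀' 0) hη
  let f : Cn d → Cn (m + 1) := fun z => WithLp.toLp 2 (Fin.cons (H z) fun i => g i z)
  have hfsq : ∀ z, ‖f z‖ ^ 2 = ‖H z‖ ^ 2 + ∑ i, ‖g i z‖ ^ 2 := fun z => by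
    rw [EuclideanSpace.norm_sq_eq, Fin.sum_univ_succ]
    simp [f]
  refine ⟨f, differentiableOn_euclidean.2 fun i => ?_, fun R => ?_, fun z hz => ?_⟩
  · induction i using Fin.cases with
    | zero => exact hH
    | succ i => exact hg i
  · obtain ⟨k, hk⟩ := exists_nat_gt (max R (R ^ 2))
    refine ⟨closure (P k), hPD k, hPc k, fun z hz hzR => subset_closure ?_⟩
    have h1 : ‖H z‖ ^ 2 + ∑ i, ‖g i z‖ ^ 2 ≤ R ^ 2 := by
      rw [← hfsq]
      gcongr
    have h2 : 0 ≤ ∑ i, ‖g i z‖ ^ 2 := Finset.sum_nonneg fun i _ => sq_nonneg _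
    have h3 : ‖H z‖ ≤ R := by
      have hR : 0 ≤ R := (norm_nonneg _).trans hzR
      nlinarith [norm_nonneg (H z)]
    have h4 : R < k := (le_max_left _ _).trans_lt hk
    have h5 : R ^ 2 < k := (le_max_right _ _).trans_lt hk
    by_contra hzk
    have hout : ∀ j ≥ k, z ∉ P j := fun j hj => by
      induction j, hj using Nat.le_induction with
      | base => exact hzk
      | succ j hj ih =>
        intro hzj
        have h6 : (k : ℝ) ≤ j := by exact_mod_cast hj
        have h7 := hHP j z ⟨hzj, ih⟩ (by rw [hφ]; nlinarith [sq_nonneg ‖H z‖])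
        linarith
    obtain ⟨l, hl⟩ := hexh {z} (by simpa using hz) isCompact_singleton
    have hPmono : Monotone P := monotone_nat_of_le_succ fun k => subset_closure.trans (hPs k)
    exact hout (max k l) (le_max_left k l) (hPmono (le_max_right k l) (hl rfl))
  · have h1 : ∀ i, ‖g i z - f₀ z i.succ‖ ≤ η := fun i => hgf i z hz
    have h2 : ‖H z - f₀ z 0‖ ≤ η := hHK z (hKP hz) (by
      rw [hφ, hκdef]
      refine (Finset.sum_le_card_nsmul _ _ ((|B| + η) ^ 2) fun i _ => ?_).trans_eq (by simp)
      have h3 : ‖f₀ z i.succ‖ ≤ |B| :=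
        (PiLp.norm_apply_le _ _).trans ((hB z hz).trans (le_abs_self B))
      have h4 := norm_sub_norm_le (g i z) (f₀ z i.succ)
      have h5 : ‖g i z‖ ≤ |B| + η := by linarith [h1 i]
      gcongr)
    have h3 : ‖f z - f₀ z‖ ^ 2 ≤ (m + 1) * η ^ 2 := by
      rw [EuclideanSpace.norm_sq_eq]
      refine (Finset.sum_le_card_nsmul _ _ (η ^ 2) fun i _ => ?_).trans_eq (by simp)
      have h4 : ‖(f z - f₀ z) i‖ ≤ η := by
        induction i using Fin.cases with
        | zero => exact h2
        | succ i => exact h1 i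
      gcongr
    have h4 : ε = (m + 2) * η := by
      rw [hηdef]
      field_simp
    refine lt_of_pow_lt_pow_left₀ 2 hε.le (h3.trans_lt ?_)
    rw [h4]
    have : (0 : ℝ) ≤ m := m.cast_nonneg
    nlinarith [sq_nonneg η, mul_pos hη hη]

/-- Approximation of holomorphic maps by proper holomorphic immersions. -/
theorem IsExhaustion.exists_proper_immersion (hD : IsOpen D) (hDb : IsBounded D)
    (hs : IsExhaustion D s) (hm : 2 * d ≤ m + 1) {f₀ : Cn d → Cn (m + 1)}
    (hf₀ : DifferentiableOn ℂ f₀ D) (hK : IsCompact K) (hKD : K ⊆ D) {ε : ℝ} (hε : 0 < ε) :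
    ∃ f : Cn d → Cn (m + 1), DifferentiableOn ℂ f D ∧
      (∀ K', IsCompact K' → IsCompact {z ∈ D | f z ∈ K'}) ∧
      (∀ z ∈ D, Function.Injective (fderiv ℂ f z)) ∧ ∀ z ∈ K, ‖f z - f₀ z‖ < ε := by
  obtain ⟨f, hf, hfp, hfK⟩ := hs.exists_proper hD hm hf₀ hK hKD (half_pos hε)
  obtain ⟨r, hr0, hr⟩ := hDb.exists_pos_norm_le
  obtain ⟨A, hA, hAinj⟩ := exists_injective_perturbation hm hD hf
    (show 0 < ε / 2 / r by positivity)
  have hAz : ∀ z ∈ D, ‖A z‖ ≤ ε / 2 := fun z hz => by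
    refine (A.le_opNorm z).trans ?_
    calc ‖A‖ * ‖z‖ ≤ ε / 2 / r * r := by
          gcongr
          exact hr z hz
      _ = ε / 2 := by field_simp
  have hfA : DifferentiableOn ℂ (fun z => f z + A z) D := hf.add A.differentiableOn
  refine ⟨fun z => f z + A z, hfA, fun K' hK' => ?_, fun z hz => ?_, fun z hz => ?_⟩
  · obtain ⟨R, hR⟩ := hK'.isBounded.exists_norm_le
    obtain ⟨C, hCD, hC, hCz⟩ := hfp (R + ε / 2)
    have hCK : IsCompact (C ∩ (fun z => f z + A z) ⁻¹' K') := hC.of_isClosed_subset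
      ((hfA.continuousOn.mono hCD).preimage_isClosed_of_isClosed hC.isClosed hK'.isClosed)
      inter_subset_left
    convert hCK using 1
    ext z
    refine ⟨fun hz => ⟨hCz z hz.1 ?_, hz.2⟩, fun hz => ⟨hCD hz.1, hz.2⟩⟩
    have h1 := norm_sub_le (f z + A z) (A z)
    rw [add_sub_cancel_right] at h1
    linarith [hR _ hz.2, hAz z hz.1]
  · rw [fderiv_fun_add (hf.differentiableAt (hD.mem_nhds hz)) A.differentiableAt,
      ContinuousLinearMap.fderiv]
    exact hAinj z hz
  · have h1 := norm_add_le (f z - f₀ z) (A z)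
    rw [show f z - f₀ z + A z = f z + A z - f₀ z by abel] at h1
    linarith [hfK z hz, hAz z (hKD hz)]

end ProperMaps

end SCV

/-- Corollary 1.7(i) for `X = ℂⁿ`: approximation by proper holomorphic immersions
when `n ≥ 2d`. -/
theorem approx_by_proper_holomorphic_immersions
    {d n : ℕ} (hd : 1 ≤ d) (hn : 2 * d ≤ n)
    {D : Set (EuclideanSpace ℂ (Fin d))} (hD : IsSPCDomain D ⊤)
    {f₀ : EuclideanSpace ℂ (Fin d) → EuclideanSpace ℂ (Fin n)}
    (hf₀cont : ContinuousOn f₀ (closure D)) (hf₀hol : DifferentiableOn ℂ f₀ D)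
    {K : Set (EuclideanSpace ℂ (Fin d))} (hK : IsCompact K) (hKD : K ⊆ D)
    {ε : ℝ} (hε : 0 < ε) :
    ∃ f : EuclideanSpace ℂ (Fin d) → EuclideanSpace ℂ (Fin n),
      DifferentiableOn ℂ f D ∧
      (∀ K' : Set (EuclideanSpace ℂ (Fin n)), IsCompact K' → IsCompact {z ∈ D | f z ∈ K'}) ∧
      (∀ z ∈ D, Function.Injective (fderiv ℂ f z)) ∧
      (∀ z ∈ K, ‖f z - f₀ z‖ < ε) := by
  obtain ⟨hDo, -, hDb, U, r, hU, hDU, hr, hrD, -, hlevi⟩ := hD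
  have hr' : ContDiffOn ℝ (⊤ : ℕ∞) r U := hr
  obtain ⟨s, hs⟩ := SCV.exists_isExhaustion hDo hDb hU hDU hr' hrD fun x hx v hv h1 h2 => by
    have hrx : ContDiffAt ℝ 2 r x :=
      (hr'.contDiffAt (hU.mem_nhds (hDU hx))).of_le SCV.two_le_infty
    have h3 := hlevi x hx v hv h1 h2
    rw [leviForm, iteratedFDeriv_two_apply, iteratedFDeriv_two_apply] at h3
    rw [SCV.levi_eq hrx]
    simpa using h3
  obtain ⟨m, rfl⟩ : ∃ m, n = m + 1 := ⟨n - 1, by omega⟩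
  exact hs.exists_proper_immersion hDo hDb hn hf₀hol hK hKD hε

end
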